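/- arXiv:1109.2274 — 3 statements merged into one kernel-verified Lean document; each statement's English description precedes it below -/
import Mathlib

section
/- For every fixed positive integer a there exists a constant C = C(a) such that for every natural number N ≥ 2, the sum over n ≤ N with gcd(n,a) = 1 of the quantity |R(n;a) − (1/φ(a)) · Σ_{χ mod a, χ² = χ₀} χ̄(−n) · Σ_{u | n²} χ(u)|² is at most C · N · (log N)², where the inner sum over χ runs over the Dirichlet characters modulo a whose square is the principal character χ₀ modulo a. -/
open scoped Classical

/-- `R n a` is the number of ordered pairs `(x, y)` of positive integers
satisfying `a / n = 1 / x + 1 / y`. -/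
noncomputable def R (n a : ℕ) : ℕ :=
  Nat.card {p : ℕ × ℕ | 0 < p.1 ∧ 0 < p.2 ∧ (a : ℚ) / n = 1 / p.1 + 1 / p.2}

lemma unitFraction_eq_iff {a n x y : ℕ} (hn : 0 < n) (hx : 0 < x) (hy : 0 < y) :
    (a : ℚ) / n = 1 / x + 1 / y ↔ a * x * y = n * (x + y) := by
  have hn' : (n : ℚ) ≠ 0 := by positivity
  have hx' : (x : ℚ) ≠ 0 := by positivity
  have hy' : (y : ℚ) ≠ 0 := by positivity
  rw [div_add_div _ _ hx' hy', div_eq_div_iff hn' (mul_ne_zero hx' hy')]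
  rw [← @Nat.cast_inj ℚ]
  push_cast
  constructor <;> intro h <;> linarith

/-- Solutions of `a / n = 1 / x + 1 / y` correspond to divisors `u = a * x - n` of `n ^ 2`. -/
lemma R_eq_card_filter_divisors {a n : ℕ} (ha : 0 < a) (hn : 0 < n) (h : Nat.gcd n a = 1) :
    R n a = ((n ^ 2).divisors.filter fun u : ℕ => -(n : ZMod a) = u).card := by
  have key (u : ℕ) : -(n : ZMod a) = u ↔ a ∣ u + n := by
    rw [← ZMod.natCast_eq_zero_iff, Nat.cast_add, neg_eq_iff_add_eq_zero, add_comm]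
  simp only [key]
  rw [R, ← Set.ncard_coe_finset]
  change Set.ncard _ = _
  have hS : {p : ℕ × ℕ | 0 < p.1 ∧ 0 < p.2 ∧ (a : ℚ) / n = 1 / p.1 + 1 / p.2} =
      (fun u : ℕ => ((u + n) / a, (n ^ 2 / u + n) / a)) ''
        ((n ^ 2).divisors.filter fun u : ℕ => a ∣ u + n) := by
    ext ⟨x, y⟩
    simp only [Set.mem_ofPred_eq, Set.mem_image, Finset.coe_filter, Nat.mem_divisors, Prod.mk.injEq]
    constructor
    · rintro ⟨hx, hy, hxy⟩
      rw [unitFraction_eq_iff hn hx hy] at hxy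
      have h1 : n < a * x := by
        by_contra! hc
        nlinarith [Nat.mul_le_mul_right y hc, Nat.mul_pos hn hx]
      have h2 : n < a * y := by
        by_contra! hc
        nlinarith [Nat.mul_le_mul_right x hc, Nat.mul_pos hn hy]
      obtain ⟨u, hu⟩ := Nat.exists_eq_add_of_lt h1
      obtain ⟨w, hw⟩ := Nat.exists_eq_add_of_lt h2
      have huw : (u + 1) * (w + 1) = n ^ 2 := by
        zify at hu hw hxy ⊢
        have e1 : (u : ℤ) + 1 = a * x - n := by linarith
        have e2 : (w : ℤ) + 1 = a * y - n := by linarith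
        rw [e1, e2]
        linear_combination (a : ℤ) * hxy
      refine ⟨u + 1, ⟨⟨⟨w + 1, huw.symm⟩, by positivity⟩, ?_⟩, ?_, ?_⟩
      · exact ⟨x, by omega⟩
      · rw [show u + 1 + n = a * x by omega, Nat.mul_div_cancel_left _ ha]
      · rw [← huw, Nat.mul_div_cancel_left _ (Nat.succ_pos u),
          show w + 1 + n = a * y by omega, Nat.mul_div_cancel_left _ ha]
    · rintro ⟨u, ⟨⟨⟨w, huw⟩, -⟩, hau⟩, hx, hy⟩
      have hu : 0 < u := Nat.pos_of_ne_zero fun h0 => by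
        rw [h0, zero_mul] at huw; exact (pow_pos hn 2).ne' huw
      rw [huw, Nat.mul_div_cancel_left _ hu] at hy
      have haw : a ∣ w + n := by
        have hc : Nat.Coprime a u :=
          (Nat.Coprime.coprime_dvd_left ⟨w, huw⟩ (Nat.Coprime.pow_left 2 h)).symm
        refine hc.dvd_of_dvd_mul_left ?_
        rw [show u * (w + n) = (u + n) * n by nlinarith]
        exact hau.mul_right n
      obtain ⟨x', hx'⟩ := hau
      obtain ⟨y', hy'⟩ := haw
      rw [hx', Nat.mul_div_cancel_left _ ha] at hx
      rw [hy', Nat.mul_div_cancel_left _ ha] at hy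
      subst hx hy
      have hxpos : 0 < x' := Nat.pos_of_ne_zero fun h0 => by
        rw [h0, mul_zero] at hx'; omega
      have hypos : 0 < y' := Nat.pos_of_ne_zero fun h0 => by
        rw [h0, mul_zero] at hy'; omega
      refine ⟨hxpos, hypos, ?_⟩
      rw [unitFraction_eq_iff hn hxpos hypos]
      zify at hx' hy' huw ⊢
      have ha' : (a : ℤ) ≠ 0 := by exact_mod_cast ha.ne'
      apply mul_left_cancel₀ ha'
      have e1 : (u : ℤ) = a * x' - n := by linarith
      have e2 : (w : ℤ) = a * y' - n := by linarith
      rw [e1, e2] at huw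
      linear_combination -huw
  rw [hS, Set.InjOn.ncard_image]
  intro u hu v hv huv
  simp only [Finset.coe_filter, Set.mem_ofPred_eq] at hu hv
  have := Nat.div_left_inj hu.2 hv.2 |>.1 (Prod.mk.inj huv).1
  omega

/-- The expansion of `R n a` into Dirichlet characters modulo `a`. -/
lemma R_eq_sum_characters {a n : ℕ} (ha : 0 < a) (hn : 0 < n) (h : Nat.gcd n a = 1) :
    (R n a : ℂ) = (1 / (a.totient : ℂ)) * ∑ χ : DirichletCharacter ℂ a,
      (starRingEnd ℂ) (χ (-(n : ZMod a))) * ∑ u ∈ (n ^ 2).divisors, χ (u : ZMod a) := by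
  have : NeZero a := ⟨ha.ne'⟩
  have hunit : IsUnit (-(n : ZMod a)) := ((ZMod.isUnit_iff_coprime n a).2 h).neg
  have hconj (χ : DirichletCharacter ℂ a) :
      (starRingEnd ℂ) (χ (-(n : ZMod a))) = χ (-(n : ZMod a))⁻¹ := by
    rw [starRingEnd_apply, MulChar.star_apply', MulChar.inv_apply_eq_inv']
    have h1 : χ (-(n : ZMod a))⁻¹ * χ (-(n : ZMod a)) = 1 := by
      rw [← map_mul, ZMod.inv_mul_of_unit _ hunit, map_one]
    exact (eq_inv_of_mul_eq_one_left h1).symm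
  simp only [hconj]
  rw [Finset.sum_congr rfl fun χ _ => Finset.mul_sum _ _ _]
  rw [Finset.sum_comm]
  simp only [DirichletCharacter.sum_char_inv_mul_char_eq ℂ hunit]
  rw [R_eq_card_filter_divisors ha hn h, ← Finset.sum_filter, Finset.sum_const, nsmul_eq_mul]
  have : (a.totient : ℂ) ≠ 0 := by exact_mod_cast (Nat.totient_pos.2 ha).ne'
  field_simp

/-- The squared absolute value of the sum of `χ` over the divisors of `n ^ 2`. -/
noncomputable def divisorSumSq {a : ℕ} (χ : DirichletCharacter ℂ a) (n : ℕ) : ℝ :=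
  ‖∑ u ∈ (n ^ 2).divisors, χ (u : ZMod a)‖ ^ 2

section divisorSumSq

variable {a : ℕ} (χ : DirichletCharacter ℂ a)

lemma divisorSumSq_nonneg (n : ℕ) : 0 ≤ divisorSumSq χ n := by
  unfold divisorSumSq; positivity

lemma divisorSumSq_one : divisorSumSq χ 1 = 1 := by simp [divisorSumSq]

lemma divisorSumSq_mul {m n : ℕ} (h : Nat.Coprime m n) :
    divisorSumSq χ (m * n) = divisorSumSq χ m * divisorSumSq χ n := by
  have h2 : Nat.Coprime (m ^ 2) (n ^ 2) := Nat.Coprime.pow 2 2 h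
  rw [divisorSumSq, divisorSumSq, divisorSumSq, ← mul_pow, ← norm_mul, mul_pow, Nat.divisors_mul,
    Finset.mul_def, Finset.sum_image h2.mul_injOn_divisors, Finset.sum_product,
    Finset.sum_mul_sum]
  simp

lemma divisorSumSq_prime_pow_le {p : ℕ} (hp : p.Prime) (k : ℕ) :
    divisorSumSq χ (p ^ k) ≤ (2 * k + 1) ^ 2 := by
  rw [divisorSumSq, ← pow_mul, Nat.sum_divisors_prime_pow hp]
  gcongr
  refine (norm_sum_le_of_le _ fun i _ => χ.norm_le_one _).trans (le_of_eq ?_)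
  simp [mul_comm]

lemma norm_one_add_add_sq_sq_le {z : ℂ} (hz : z = 0 ∨ ‖z‖ = 1) :
    ‖1 + z + z ^ 2‖ ^ 2 ≤ 3 + 4 * z.re + 2 * (z ^ 2).re := by
  rcases hz with rfl | hz
  · norm_num
  · have h : z.re * z.re + z.im * z.im = 1 := by
      rw [← Complex.normSq_apply, Complex.normSq_eq_norm_sq, hz, one_pow]
    rw [← Complex.normSq_eq_norm_sq, Complex.normSq_apply]
    simp only [pow_two, Complex.add_re, Complex.mul_re, Complex.one_re, Complex.add_im,
      Complex.mul_im, Complex.one_im]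
    apply le_of_eq
    linear_combination (2 + 2 * z.re + z.re * z.re + z.im * z.im) * h

lemma divisorSumSq_prime_le {p : ℕ} (hp : p.Prime) :
    divisorSumSq χ p ≤ 3 + 4 * (χ p).re + 2 * ((χ ^ 2) p).re := by
  have hz : χ p = 0 ∨ ‖χ p‖ = 1 := by
    by_cases h : IsUnit (p : ZMod a)
    · obtain ⟨u, hu⟩ := h
      exact Or.inr (hu ▸ χ.unit_norm_eq_one u)
    · exact Or.inl (χ.map_nonunit h)
  have h2 : (χ ^ 2) p = (χ p) ^ 2 := MulChar.pow_apply' χ two_ne_zero _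
  rw [h2]
  refine le_trans (le_of_eq ?_) (norm_one_add_add_sq_sq_le hz)
  rw [divisorSumSq, Nat.sum_divisors_prime_pow hp]
  simp [Finset.sum_range_succ]

end divisorSumSq

lemma summable_primePowWeight :
    Summable fun v : ℕ => (2 * (v : ℝ) + 1) ^ 2 * v * (1 / 2) ^ v := by
  have h (k : ℕ) := summable_pow_mul_geometric_of_norm_lt_one (R := ℝ) k
    (r := 1 / 2) (by norm_num)
  refine (((h 3).mul_left 4).add (((h 2).mul_left 4).add (h 1))).congr fun v => ?_
  ring

lemma summable_log_div_sq : Summable fun n : ℕ => Real.log n / (n : ℝ) ^ 2 := by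
  have h : Summable fun n : ℕ => 2 * (1 / (n : ℝ) ^ (3 / 2 : ℝ)) :=
    (Real.summable_one_div_nat_rpow.2 (by norm_num)).mul_left 2
  refine Summable.of_nonneg_of_le (fun n => ?_) (fun n => ?_) h
  · have := Real.log_natCast_nonneg n
    positivity
  · rcases Nat.eq_zero_or_pos n with rfl | hn
    · norm_num
    · have hn' : (0 : ℝ) < n := by exact_mod_cast hn
      have h1 := Real.log_le_rpow_div hn'.le (show (0 : ℝ) < 1 / 2 by norm_num)
      rw [div_le_iff₀ (by positivity)]
      calc Real.log n ≤ (n : ℝ) ^ (1 / 2 : ℝ) / (1 / 2) := h1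
        _ = 2 * (n : ℝ) ^ ((2 : ℝ) - 3 / 2) := by norm_num; ring
        _ = 2 * (1 / (n : ℝ) ^ (3 / 2 : ℝ)) * (n : ℝ) ^ 2 := by
            rw [Real.rpow_sub hn', Real.rpow_two]; ring

/-- A Chebyshev bound for prime powers weighted by a polynomial in the exponent. -/
lemma exists_sum_primePow_le : ∃ C : ℝ, 0 ≤ C ∧ ∀ (N : ℕ) (x : ℝ), 0 ≤ x →
    ∑ p ∈ (Finset.Icc 1 N).filter Nat.Prime, ∑ v ∈ Finset.Icc 1 N,
      (if (p : ℝ) ^ v ≤ x then (2 * (v : ℝ) + 1) ^ 2 * v * Real.log p else 0) ≤ C * x := by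
  set W := ∑' v : ℕ, (2 * (v : ℝ) + 1) ^ 2 * v * (1 / 2) ^ v
  set L := ∑' n : ℕ, Real.log n / (n : ℝ) ^ 2
  have hW : 0 ≤ W := tsum_nonneg fun v => by positivity
  have hL0 (n : ℕ) : 0 ≤ Real.log n / (n : ℝ) ^ 2 := by
    have := Real.log_natCast_nonneg n
    positivity
  have hL : 0 ≤ L := tsum_nonneg hL0
  have h4 : 0 ≤ Real.log 4 := Real.log_nonneg (by norm_num)
  refine ⟨9 * Real.log 4 + 4 * L * W, by positivity, fun N x hx => ?_⟩
  have hterm (p : ℕ) (hp : p.Prime) (v : ℕ) (hv : 1 ≤ v) :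
      (if (p : ℝ) ^ v ≤ x then (2 * (v : ℝ) + 1) ^ 2 * v * Real.log p else 0) ≤
      (if v = 1 then (if (p : ℝ) ≤ x then 9 * Real.log p else 0) else 0) +
        4 * x * (Real.log p / (p : ℝ) ^ 2) * ((2 * (v : ℝ) + 1) ^ 2 * v * (1 / 2) ^ v) := by
    have hlog := Real.log_natCast_nonneg p
    have hp2 : (2 : ℝ) ≤ p := by exact_mod_cast hp.two_le
    have hnn : 0 ≤ 4 * x * (Real.log p / (p : ℝ) ^ 2) *
        ((2 * (v : ℝ) + 1) ^ 2 * v * (1 / 2) ^ v) := by positivity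
    rcases hv.eq_or_lt with rfl | hv
    · simp only [pow_one, if_true] at hnn ⊢
      norm_num at hnn ⊢
      exact hnn
    · rw [if_neg (show v ≠ 1 by omega), zero_add]
      split_ifs with hpx
      · obtain ⟨w, rfl⟩ := Nat.exists_eq_add_of_le hv
        have h1 : (p : ℝ) ^ 2 * 2 ^ w ≤ x := by
          refine le_trans ?_ hpx
          rw [Nat.succ_eq_add_one, pow_add]
          gcongr
        have h2 : 1 ≤ 4 * x / (p : ℝ) ^ 2 * (1 / 2) ^ (2 + w) := by
          rw [pow_add, div_pow (1 : ℝ) 2 w, one_pow]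
          rw [show 4 * x / (p : ℝ) ^ 2 * ((1 / 2) ^ 2 * (1 / 2 ^ w)) =
            x / ((p : ℝ) ^ 2 * 2 ^ w) by field_simp; ring]
          rwa [one_le_div (by positivity)]
        set v : ℕ := 1 + 1 + w
        have h3 : 0 ≤ (2 * (v : ℝ) + 1) ^ 2 * v * Real.log p := by positivity
        calc _ ≤ (2 * (v : ℝ) + 1) ^ 2 * v * Real.log p *
              (4 * x / (p : ℝ) ^ 2 * (1 / 2) ^ (2 + w)) := le_mul_of_one_le_right h3 h2
          _ = _ := by simp only [v]; ring
      · exact hnn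
  calc _ ≤ ∑ p ∈ (Finset.Icc 1 N).filter Nat.Prime,
        ((if (p : ℝ) ≤ x then 9 * Real.log p else 0) +
          4 * x * (Real.log p / (p : ℝ) ^ 2) * W) := by
        refine Finset.sum_le_sum fun p hp => ?_
        have hp' := (Finset.mem_filter.1 hp).2
        have hlog := Real.log_natCast_nonneg p
        refine (Finset.sum_le_sum fun v hv =>
          hterm p hp' v (Finset.mem_Icc.1 hv).1).trans ?_
        rw [Finset.sum_add_distrib, ← Finset.mul_sum, Finset.sum_ite_eq']
        refine add_le_add ?_ ?_
        · split_ifs <;> first | exact le_rfl | positivity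
        · have := summable_primePowWeight.sum_le_tsum (Finset.Icc 1 N) fun v _ => by positivity
          have := hL0 p
          gcongr
    _ = 9 * (∑ p ∈ (Finset.Icc 1 N).filter Nat.Prime, if (p : ℝ) ≤ x then Real.log p else 0) +
        4 * x * (∑ p ∈ (Finset.Icc 1 N).filter Nat.Prime, Real.log p / (p : ℝ) ^ 2) * W := by
        rw [Finset.sum_add_distrib, Finset.mul_sum, Finset.mul_sum, Finset.sum_mul]
        simp only [mul_ite, mul_zero]
    _ ≤ 9 * (Real.log 4 * x) + 4 * x * L * W := by
        have h1 : (∑ p ∈ (Finset.Icc 1 N).filter Nat.Prime,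
            if (p : ℝ) ≤ x then Real.log p else 0) ≤ Real.log 4 * x := by
          refine le_trans ?_ (Chebyshev.theta_le_log4_mul_x hx)
          rw [Chebyshev.theta_eq_sum_Icc, ← Finset.sum_filter]
          refine Finset.sum_le_sum_of_subset_of_nonneg (fun p hp => ?_) fun p _ _ =>
            Real.log_natCast_nonneg p
          simp only [Finset.mem_filter, Finset.mem_Icc] at hp ⊢
          exact ⟨⟨Nat.zero_le _, Nat.le_floor hp.2⟩, hp.1.2⟩
        have h2 : (∑ p ∈ (Finset.Icc 1 N).filter Nat.Prime, Real.log p / (p : ℝ) ^ 2) ≤ L :=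
          summable_log_div_sq.sum_le_tsum _ fun n _ => hL0 n
        gcongr
    _ = _ := by ring

/-- Weighting by `log n` and splitting it over the prime powers exactly dividing `n`. -/
lemma sum_mul_log_le {f : ℕ → ℝ} (hf : ∀ n, 0 ≤ f n)
    (hmul : ∀ {m n : ℕ}, Nat.Coprime m n → f (m * n) = f m * f n)
    (hpow : ∀ {p : ℕ}, p.Prime → ∀ k : ℕ, f (p ^ k) ≤ (2 * k + 1) ^ 2) (N : ℕ) :
    ∑ n ∈ Finset.Icc 1 N, f n * Real.log n ≤
      ∑ m ∈ Finset.Icc 1 N, f m * ∑ p ∈ (Finset.Icc 1 N).filter Nat.Prime,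
        ∑ v ∈ Finset.Icc 1 N, (if (p : ℝ) ^ v ≤ (N : ℝ) / m then
          (2 * (v : ℝ) + 1) ^ 2 * v * Real.log p else 0) := by
  set P := (Finset.Icc 1 N).filter Nat.Prime
  have hw (p v : ℕ) : 0 ≤ (2 * (v : ℝ) + 1) ^ 2 * v * Real.log p := by
    have := Real.log_natCast_nonneg p
    positivity
  have hstep (n : ℕ) (hn : n ∈ Finset.Icc 1 N) : f n * Real.log n ≤
      ∑ m ∈ Finset.Icc 1 N, ∑ p ∈ P, ∑ v ∈ Finset.Icc 1 N,
        (if p ^ v * m = n then f m * ((2 * (v : ℝ) + 1) ^ 2 * v * Real.log p) else 0) := by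
    have hn' := Finset.mem_Icc.1 hn
    have hn0 : n ≠ 0 := by omega
    have ht (m p v : ℕ) : 0 ≤
        (if p ^ v * m = n then f m * ((2 * (v : ℝ) + 1) ^ 2 * v * Real.log p) else 0) := by
      split_ifs
      · exact mul_nonneg (hf m) (hw p v)
      · exact le_rfl
    rw [Real.log_nat_eq_sum_factorization, Finsupp.sum, Finset.mul_sum, Finset.sum_comm]
    have hsub : n.factorization.support ⊆ P := fun p hp => by
      rw [Nat.support_factorization, Nat.mem_primeFactors] at hp
      have := Nat.le_of_dvd (by omega) hp.2.1
      exact Finset.mem_filter.2 ⟨Finset.mem_Icc.2 ⟨hp.1.pos, by omega⟩, hp.1⟩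
    refine le_trans (Finset.sum_le_sum fun p hp => ?_)
      (Finset.sum_le_sum_of_subset_of_nonneg hsub fun p _ _ =>
        Finset.sum_nonneg fun m _ => Finset.sum_nonneg fun v _ => ht m p v)
    rw [Nat.support_factorization, Nat.mem_primeFactors] at hp
    obtain ⟨hp, hpn, -⟩ := hp
    set v := n.factorization p
    have hv : 1 ≤ v := (hp.dvd_iff_one_le_factorization hn0).1 hpn
    have hprod : p ^ v * (n / p ^ v) = n := Nat.ordProj_mul_ordCompl_eq_self n p
    have hm0 : 0 < n / p ^ v := Nat.ordCompl_pos p hn0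
    have hm : n / p ^ v ∈ Finset.Icc 1 N :=
      Finset.mem_Icc.2 ⟨hm0, (Nat.div_le_self _ _).trans hn'.2⟩
    have hvN : v ∈ Finset.Icc 1 N :=
      Finset.mem_Icc.2 ⟨hv, (Nat.factorization_lt p hn0).le.trans hn'.2⟩
    refine le_trans ?_ (Finset.single_le_sum
      (fun m _ => Finset.sum_nonneg fun v _ => ht m p v) hm)
    refine le_trans ?_ (Finset.single_le_sum (fun v _ => ht _ p v) hvN)
    rw [if_pos hprod]
    have hcop : Nat.Coprime (p ^ v) (n / p ^ v) :=
      Nat.Coprime.pow_left _ (Nat.coprime_ordCompl hp hn0)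
    have hlog := Real.log_natCast_nonneg p
    have := hf (n / p ^ v)
    calc f n * (v * Real.log p) = f (n / p ^ v) * (f (p ^ v) * (v * Real.log p)) := by
          conv_lhs => rw [← hprod, hmul hcop]
          ring
      _ ≤ f (n / p ^ v) * ((2 * v + 1) ^ 2 * (v * Real.log p)) := by
          gcongr
          exact hpow hp v
      _ = _ := by ring
  refine (Finset.sum_le_sum hstep).trans ?_
  rw [Finset.sum_comm]
  refine Finset.sum_le_sum fun m hm => ?_
  rw [Finset.sum_comm, Finset.mul_sum]
  refine Finset.sum_le_sum fun p hp => ?_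
  rw [Finset.sum_comm, Finset.mul_sum]
  refine Finset.sum_le_sum fun v hv => ?_
  rw [Finset.sum_ite_eq]
  have hm0 : (0 : ℝ) < m := by exact_mod_cast (Finset.mem_Icc.1 hm).1
  split_ifs with h1 h2 h2
  · exact le_rfl
  · refine absurd ?_ h2
    rw [le_div_iff₀ hm0]
    exact_mod_cast (Finset.mem_Icc.1 h1).2
  · exact mul_nonneg (hf m) (hw p v)
  · simp

/-- The mean of a nonnegative multiplicative function of polynomial growth on prime powers is
controlled by its logarithmic mean. -/
lemma exists_sum_mul_log_le : ∃ C : ℝ, 0 ≤ C ∧ ∀ f : ℕ → ℝ, (∀ n, 0 ≤ f n) →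
    (∀ {m n : ℕ}, Nat.Coprime m n → f (m * n) = f m * f n) →
    (∀ {p : ℕ}, p.Prime → ∀ k : ℕ, f (p ^ k) ≤ (2 * k + 1) ^ 2) → ∀ N : ℕ,
    (∑ n ∈ Finset.Icc 1 N, f n) * Real.log N ≤ C * N * ∑ m ∈ Finset.Icc 1 N, f m / m := by
  obtain ⟨C, hC, h⟩ := exists_sum_primePow_le
  refine ⟨C + 1, by positivity, fun f hf hmul hpow N => ?_⟩
  have h1 : ∑ n ∈ Finset.Icc 1 N, f n * Real.log n ≤ C * N * ∑ m ∈ Finset.Icc 1 N, f m / m := by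
    refine (sum_mul_log_le hf hmul hpow N).trans ?_
    rw [Finset.mul_sum]
    refine Finset.sum_le_sum fun m _ => ?_
    refine (mul_le_mul_of_nonneg_left (h N (N / m) (by positivity)) (hf m)).trans
      (le_of_eq (by ring))
  have h2 : ∑ n ∈ Finset.Icc 1 N, f n * (Real.log N - Real.log n) ≤
      N * ∑ m ∈ Finset.Icc 1 N, f m / m := by
    rw [Finset.mul_sum]
    refine Finset.sum_le_sum fun n hn => ?_
    have hn' := Finset.mem_Icc.1 hn
    have hn0 : (0 : ℝ) < n := by exact_mod_cast hn'.1
    have hN0 : (0 : ℝ) < N := by exact_mod_cast hn'.1.trans hn'.2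
    rw [← Real.log_div hN0.ne' hn0.ne']
    refine (mul_le_mul_of_nonneg_left (Real.log_le_self (by positivity)) (hf n)).trans
      (le_of_eq (by ring))
  calc _ = ∑ n ∈ Finset.Icc 1 N, f n * Real.log n +
        ∑ n ∈ Finset.Icc 1 N, f n * (Real.log N - Real.log n) := by
        rw [← Finset.sum_add_distrib, Finset.sum_mul]
        exact Finset.sum_congr rfl fun n _ => by ring
    _ ≤ _ := by linarith

open Complex in
/-- The real part of the prime sum of `χ` is bounded by the logarithm of its `L`-series. -/
lemma exists_exp_tsum_primes_le {a : ℕ} (χ : DirichletCharacter ℂ a) : ∃ K : ℝ, 0 ≤ K ∧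
    ∀ σ : ℝ, 1 < σ →
      Real.exp (∑' p : Nat.Primes, (χ (p : ℕ)).re * ((p : ℕ) : ℝ) ^ (-σ)) ≤
        K * ‖LSeries (fun n => χ (n : ZMod a)) σ‖ := by
  have hs2 : Summable fun p : Nat.Primes => ((p : ℕ) : ℝ) ^ (-2 : ℝ) :=
    Nat.Primes.summable_rpow.2 (by norm_num)
  refine ⟨Real.exp (∑' p : Nat.Primes, ((p : ℕ) : ℝ) ^ (-2 : ℝ)), (Real.exp_pos _).le,
    fun σ hσ => ?_⟩
  have hσ' : 1 < (σ : ℂ).re := by simpa using hσ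
  have hlog := Complex.hasSum_re
    (DirichletCharacter.summable_neg_log_one_sub_mul_prime_cpow χ hσ').hasSum
  rw [← DirichletCharacter.LSeries_eulerProduct_exp_log χ hσ', Complex.norm_exp, ← Real.exp_add,
    Real.exp_le_exp, ← hlog.tsum_eq, ← hs2.tsum_add hlog.summable]
  have hz (p : Nat.Primes) : ‖χ (p : ℕ) * ((p : ℕ) : ℂ) ^ (-(σ : ℂ))‖ ≤ ((p : ℕ) : ℝ) ^ (-σ) := by
    rw [norm_mul, Complex.norm_natCast_cpow_of_pos p.2.pos]
    simpa using mul_le_mul_of_nonneg_right (χ.norm_le_one (p : ℕ))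
      (Real.rpow_nonneg (Nat.cast_nonneg (p : ℕ)) (-σ))
  have hre (p : Nat.Primes) : (χ (p : ℕ) * ((p : ℕ) : ℂ) ^ (-(σ : ℂ))).re =
      (χ (p : ℕ)).re * ((p : ℕ) : ℝ) ^ (-σ) := by
    have : ((p : ℕ) : ℂ) ^ (-(σ : ℂ)) = ((((p : ℕ) : ℝ) ^ (-σ) : ℝ) : ℂ) := by
      rw [Complex.ofReal_cpow (Nat.cast_nonneg _)]; push_cast; rfl
    rw [this, Complex.re_mul_ofReal]
  have hsum : Summable fun p : Nat.Primes => (χ (p : ℕ)).re * ((p : ℕ) : ℝ) ^ (-σ) := by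
    refine Summable.of_norm_bounded (Nat.Primes.summable_rpow.2 (by linarith : -σ < -1))
      fun p => ?_
    rw [← hre]
    exact (Complex.abs_re_le_norm _).trans (hz p)
  refine hsum.tsum_le_tsum (fun p => ?_) (hs2.add hlog.summable)
  rw [← hre]
  set z := χ (p : ℕ) * ((p : ℕ) : ℂ) ^ (-(σ : ℂ))
  have hp0 : (0 : ℝ) < (p : ℕ) := by exact_mod_cast p.2.pos
  have hp2 : (2 : ℝ) ≤ (p : ℕ) := by exact_mod_cast p.2.two_le
  have hzp : ‖z‖ ≤ ((p : ℕ) : ℝ)⁻¹ := by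
    refine (hz p).trans ?_
    rw [← Real.rpow_neg_one]
    exact Real.rpow_le_rpow_of_exponent_le (by linarith) (by linarith)
  have hz2 : ‖z‖ ≤ 1 / 2 := hzp.trans (by
    rw [← one_div]; exact one_div_le_one_div_of_le (by norm_num) hp2)
  have hb : ‖-log (1 - z) - z‖ ≤ ‖z‖ ^ 2 := by
    have h1 := Complex.norm_log_one_add_sub_self_le (z := -z) (by rw [norm_neg]; linarith)
    rw [norm_neg] at h1
    rw [← norm_neg, show -(-log (1 - z) - z) = log (1 + -z) - -z by ring_nf]
    refine h1.trans ?_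
    have h2 : (1 - ‖z‖)⁻¹ ≤ 2 := by
      rw [inv_le_comm₀ (by linarith) (by norm_num)]; linarith
    nlinarith [sq_nonneg ‖z‖, mul_le_mul_of_nonneg_left h2 (sq_nonneg ‖z‖)]
  have h3 : z.re - (-log (1 - z)).re ≤ ‖z‖ ^ 2 := by
    refine le_trans ?_ hb
    rw [← Complex.sub_re, ← norm_neg, neg_sub]
    exact Complex.re_le_norm _
  have h4 : ‖z‖ ^ 2 ≤ ((p : ℕ) : ℝ) ^ (-2 : ℝ) := by
    rw [Real.rpow_neg hp0.le, Real.rpow_two, ← inv_pow]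
    gcongr
  linarith

/-- The `L`-series of a nontrivial character is bounded near `1`. -/
lemma exists_norm_LSeries_le {a : ℕ} [NeZero a] {χ : DirichletCharacter ℂ a} (hχ : χ ≠ 1) :
    ∃ K : ℝ, 0 ≤ K ∧ ∀ σ : ℝ, 1 < σ → σ ≤ 4 →
      ‖LSeries (fun n => χ (n : ZMod a)) σ‖ ≤ K := by
  have hc : Continuous fun σ : ℝ => DirichletCharacter.LFunction χ σ :=
    (DirichletCharacter.differentiable_LFunction hχ).continuous.comp Complex.continuous_ofReal
  obtain ⟨K, hK⟩ := (isCompact_Icc (a := (1 : ℝ)) (b := 4)).exists_bound_of_continuousOn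
    hc.continuousOn
  refine ⟨K, (norm_nonneg _).trans (hK 1 (by norm_num)), fun σ h1 h4 => ?_⟩
  rw [← DirichletCharacter.LFunction_eq_LSeries χ (by simpa using h1)]
  exact hK σ ⟨h1.le, h4⟩

/-- The `L`-series of the trivial character has at most a simple pole at `1`. -/
lemma exists_norm_LSeries_one_le (a : ℕ) [NeZero a] : ∃ K : ℝ, 0 ≤ K ∧ ∀ σ : ℝ, 1 < σ → σ ≤ 4 →
    ‖LSeries (fun n => (1 : DirichletCharacter ℂ a) (n : ZMod a)) σ‖ ≤ K / (σ - 1) := by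
  have hc : Continuous fun σ : ℝ => DirichletCharacter.LFunctionTrivChar₁ a σ :=
    (DirichletCharacter.differentiable_LFunctionTrivChar₁ a).continuous.comp
      Complex.continuous_ofReal
  obtain ⟨K, hK⟩ := (isCompact_Icc (a := (1 : ℝ)) (b := 4)).exists_bound_of_continuousOn
    hc.continuousOn
  refine ⟨K, (norm_nonneg _).trans (hK 1 (by norm_num)), fun σ h1 h4 => ?_⟩
  rw [← DirichletCharacter.LFunction_eq_LSeries _ (by simpa using h1)]
  have h := hK σ ⟨h1.le, h4⟩
  rw [DirichletCharacter.LFunctionTrivChar₁, Function.update_of_ne (by exact_mod_cast h1.ne'),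
    norm_mul] at h
  rw [le_div_iff₀ (by linarith), mul_comm]
  have h0 : ‖(σ : ℂ) - 1‖ = σ - 1 := by
    rw [← Complex.ofReal_one, ← Complex.ofReal_sub, Complex.norm_real, Real.norm_eq_abs,
      abs_of_pos (by linarith)]
  rwa [h0] at h

lemma summable_odd_sq_geometric :
    Summable fun k : ℕ => (2 * (k : ℝ) + 1) ^ 2 * (1 / 2) ^ k := by
  have h (k : ℕ) := summable_pow_mul_geometric_of_norm_lt_one (R := ℝ) k
    (r := 1 / 2) (by norm_num)
  refine (((h 2).mul_left 4).add (((h 1).mul_left 4).add (h 0))).congr fun v => ?_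
  ring

/-- Rankin's bound for the partial sums of a nonnegative multiplicative function. -/
lemma exists_sum_rpow_le : ∃ C : ℝ, ∀ f : ℕ → ℝ, f 1 = 1 → (∀ n, 0 ≤ f n) →
    (∀ {m n : ℕ}, Nat.Coprime m n → f (m * n) = f m * f n) →
    (∀ {p : ℕ}, p.Prime → ∀ k : ℕ, f (p ^ k) ≤ (2 * k + 1) ^ 2) →
    ∀ σ : ℝ, 1 < σ → ∀ N : ℕ, ∑ m ∈ Finset.Icc 1 N, f m * (m : ℝ) ^ (-σ) ≤
      Real.exp (∑' p : Nat.Primes, f p * ((p : ℕ) : ℝ) ^ (-σ) + C) := by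
  set W := ∑' k : ℕ, (2 * (k : ℝ) + 1) ^ 2 * (1 / 2) ^ k
  have hW : 0 ≤ W := tsum_nonneg fun k => by positivity
  have hs2 : Summable fun p : Nat.Primes => ((p : ℕ) : ℝ) ^ (-2 : ℝ) :=
    Nat.Primes.summable_rpow.2 (by norm_num)
  refine ⟨∑' p : Nat.Primes, 4 * W * ((p : ℕ) : ℝ) ^ (-2 : ℝ),
    fun f hf1 hf hmul hpow σ hσ N => ?_⟩
  set g : ℕ → ℝ := fun n => f n * (n : ℝ) ^ (-σ)
  have hg (n : ℕ) : 0 ≤ g n := mul_nonneg (hf n) (by positivity)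
  have hg1 : g 1 = 1 := by simp [g, hf1]
  have hgmul {m n : ℕ} (h : Nat.Coprime m n) : g (m * n) = g m * g n := by
    simp only [g]
    rw [hmul h, Nat.cast_mul, Real.mul_rpow (by positivity) (by positivity)]
    ring
  have hgpow {p : ℕ} (hp : p.Prime) (k : ℕ) :
      g (p ^ k) ≤ (2 * k + 1) ^ 2 * (((p : ℝ)⁻¹) ^ k) := by
    have hp1 : (1 : ℝ) ≤ p := by exact_mod_cast hp.one_le
    refine mul_le_mul (hpow hp k) ?_ (by positivity) (by positivity)
    rw [Nat.cast_pow, inv_pow, ← Real.rpow_neg_one]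
    exact Real.rpow_le_rpow_of_exponent_le (one_le_pow₀ hp1) (by linarith)
  have hinv {p : ℕ} (hp : p.Prime) : (p : ℝ)⁻¹ ≤ 1 / 2 := by
    rw [← one_div]
    exact one_div_le_one_div_of_le (by norm_num) (by exact_mod_cast hp.two_le)
  have hgsum {p : ℕ} (hp : p.Prime) : Summable fun k : ℕ => g (p ^ k) := by
    refine Summable.of_nonneg_of_le (fun k => hg _) (fun k => (hgpow hp k).trans ?_)
      summable_odd_sq_geometric
    have := hinv hp
    gcongr
  have hlocal {p : ℕ} (hp : p.Prime) :
      ∑' k : ℕ, g (p ^ k) ≤ Real.exp (g p + 4 * W * (p : ℝ) ^ (-2 : ℝ)) := by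
    refine le_trans ?_ (Real.add_one_le_exp _)
    rw [← (hgsum hp).sum_add_tsum_nat_add 2]
    simp only [Finset.sum_range_succ, Finset.sum_range_zero, pow_zero, pow_one, hg1]
    have htail : ∑' k : ℕ, g (p ^ (k + 2)) ≤ 4 * W * (p : ℝ) ^ (-2 : ℝ) := by
      have hW' := (summable_nat_add_iff 2).2 summable_odd_sq_geometric
      have hle : ∑' k : ℕ, (2 * ((k + 2 : ℕ) : ℝ) + 1) ^ 2 * (1 / 2 : ℝ) ^ (k + 2) ≤ W := by
        have h := summable_odd_sq_geometric.sum_add_tsum_nat_add 2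
        have h0 : 0 ≤ ∑ k ∈ Finset.range 2, (2 * (k : ℝ) + 1) ^ 2 * (1 / 2 : ℝ) ^ k :=
          Finset.sum_nonneg fun k _ => by positivity
        linarith
      have hterm (k : ℕ) : g (p ^ (k + 2)) ≤ 4 * (p : ℝ) ^ (-2 : ℝ) *
          ((2 * ((k + 2 : ℕ) : ℝ) + 1) ^ 2 * (1 / 2 : ℝ) ^ (k + 2)) := by
        refine (hgpow hp (k + 2)).trans ?_
        have h1 := hinv hp
        rw [Real.rpow_neg (by positivity), Real.rpow_two, ← inv_pow, pow_add ((p : ℝ)⁻¹) k 2]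
        calc _ ≤ (2 * ((k + 2 : ℕ) : ℝ) + 1) ^ 2 * ((1 / 2) ^ k * (p : ℝ)⁻¹ ^ 2) := by gcongr
          _ = _ := by rw [pow_add (1 / 2 : ℝ) k 2]; ring
      calc _ ≤ ∑' k : ℕ, 4 * (p : ℝ) ^ (-2 : ℝ) *
            ((2 * ((k + 2 : ℕ) : ℝ) + 1) ^ 2 * (1 / 2 : ℝ) ^ (k + 2)) :=
            ((summable_nat_add_iff 2).2 (hgsum hp)).tsum_le_tsum hterm (hW'.mul_left _)
        _ = 4 * (p : ℝ) ^ (-2 : ℝ) *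
            ∑' k : ℕ, (2 * ((k + 2 : ℕ) : ℝ) + 1) ^ 2 * (1 / 2 : ℝ) ^ (k + 2) := tsum_mul_left
        _ ≤ 4 * (p : ℝ) ^ (-2 : ℝ) * W := by gcongr
        _ = _ := by ring
    linarith
  have hprod := EulerProduct.summable_and_hasSum_smoothNumbers_prod_primesBelow_tsum hg1 hgmul
    (fun hp => (hgsum hp).norm) (N + 1)
  have hle : ∑ m ∈ Finset.Icc 1 N, g m ≤
      ∏ p ∈ (N + 1).primesBelow, ∑' k : ℕ, g (p ^ k) := by
    rw [← hprod.2.tsum_eq, tsum_subtype]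
    have hsub : Summable ((N + 1).smoothNumbers.indicator g) :=
      summable_subtype_iff_indicator.1 hprod.2.summable
    refine le_trans (Finset.sum_le_sum fun m hm => ?_) (hsub.sum_le_tsum (Finset.Icc 1 N)
      fun m _ => Set.indicator_nonneg (fun m _ => hg m) m)
    rw [Set.indicator_of_mem]
    have hm' := Finset.mem_Icc.1 hm
    exact Nat.mem_smoothNumbers_of_lt (by omega) (by omega)
  have hgp : Summable fun p : Nat.Primes => g p := by
    refine Summable.of_nonneg_of_le (fun p => hg _) (fun p => ?_)
      ((Nat.Primes.summable_rpow.2 (by linarith : -σ < -1)).mul_left 9)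
    have := hpow p.2 1
    rw [pow_one] at this
    norm_num at this
    simp only [g]
    gcongr
  refine hle.trans ?_
  rw [← hgp.tsum_add (hs2.mul_left _)]
  have hall := hgp.add (hs2.mul_left (4 * W))
  have hfin : ∑ p ∈ (N + 1).primesBelow, (g p + 4 * W * (p : ℝ) ^ (-2 : ℝ)) ≤
      ∑' p : Nat.Primes, (g p + 4 * W * ((p : ℕ) : ℝ) ^ (-2 : ℝ)) := by
    let t : Finset Nat.Primes := (N + 1).primesBelow.subtype Nat.Prime
    have h := hall.sum_le_tsum t fun p _ => add_nonneg (hg p) (by positivity)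
    rwa [← Finset.sum_subtype_of_mem (fun p : ℕ => g p + 4 * W * (p : ℝ) ^ (-2 : ℝ))
      fun p hp => Nat.prime_of_mem_primesBelow hp]
  refine le_trans ?_ (Real.exp_le_exp.2 hfin)
  rw [Real.exp_sum]
  exact Finset.prod_le_prod (fun p _ => tsum_nonneg fun k => hg _) fun p hp =>
    hlocal (Nat.prime_of_mem_primesBelow hp)

lemma summable_re_char_mul_rpow {a : ℕ} (χ : DirichletCharacter ℂ a) {σ : ℝ} (hσ : 1 < σ) :
    Summable fun p : Nat.Primes => (χ (p : ℕ)).re * ((p : ℕ) : ℝ) ^ (-σ) := by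
  refine Summable.of_norm_bounded (Nat.Primes.summable_rpow.2 (by linarith : -σ < -1))
    fun p => ?_
  rw [norm_mul, Real.norm_eq_abs, Real.norm_of_nonneg (Real.rpow_nonneg (Nat.cast_nonneg _) _)]
  exact mul_le_of_le_one_left (by positivity)
    ((Complex.abs_re_le_norm _).trans (χ.norm_le_one _))

lemma exists_exp_tsum_divisorSumSq_le {a : ℕ} [NeZero a] {χ : DirichletCharacter ℂ a}
    (hχ : χ ^ 2 ≠ 1) : ∃ K : ℝ, 0 ≤ K ∧ ∀ σ : ℝ, 1 < σ → σ ≤ 4 →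
      Real.exp (∑' p : Nat.Primes, divisorSumSq χ p * ((p : ℕ) : ℝ) ^ (-σ)) ≤
        K / (σ - 1) ^ 3 := by
  have hχ1 : χ ≠ 1 := fun h => hχ (by rw [h, one_pow])
  obtain ⟨A₀, hA₀, h₀⟩ := exists_exp_tsum_primes_le (1 : DirichletCharacter ℂ 1)
  obtain ⟨A₁, hA₁, h₁⟩ := exists_exp_tsum_primes_le χ
  obtain ⟨A₂, hA₂, h₂⟩ := exists_exp_tsum_primes_le (χ ^ 2)
  obtain ⟨B₀, hB₀, k₀⟩ := exists_norm_LSeries_one_le 1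
  obtain ⟨B₁, hB₁, k₁⟩ := exists_norm_LSeries_le hχ1
  obtain ⟨B₂, hB₂, k₂⟩ := exists_norm_LSeries_le hχ
  refine ⟨(A₀ * B₀) ^ 3 * (A₁ * B₁) ^ 4 * (A₂ * B₂) ^ 2, by positivity, fun σ h1 h4 => ?_⟩
  set S₀ := ∑' p : Nat.Primes, ((1 : DirichletCharacter ℂ 1) (p : ℕ)).re * ((p : ℕ) : ℝ) ^ (-σ)
  set S₁ := ∑' p : Nat.Primes, (χ (p : ℕ)).re * ((p : ℕ) : ℝ) ^ (-σ)
  set S₂ := ∑' p : Nat.Primes, ((χ ^ 2) (p : ℕ)).re * ((p : ℕ) : ℝ) ^ (-σ)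
  have e₀ : Real.exp S₀ ≤ A₀ * (B₀ / (σ - 1)) :=
    (h₀ σ h1).trans (mul_le_mul_of_nonneg_left (k₀ σ h1 h4) hA₀)
  have e₁ : Real.exp S₁ ≤ A₁ * B₁ :=
    (h₁ σ h1).trans (mul_le_mul_of_nonneg_left (k₁ σ h1 h4) hA₁)
  have e₂ : Real.exp S₂ ≤ A₂ * B₂ :=
    (h₂ σ h1).trans (mul_le_mul_of_nonneg_left (k₂ σ h1 h4) hA₂)
  have s₀ := (summable_re_char_mul_rpow (1 : DirichletCharacter ℂ 1) h1).mul_left 3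
  have s₁ := (summable_re_char_mul_rpow χ h1).mul_left 4
  have s₂ := (summable_re_char_mul_rpow (χ ^ 2) h1).mul_left 2
  have hle : ∑' p : Nat.Primes, divisorSumSq χ p * ((p : ℕ) : ℝ) ^ (-σ) ≤
      3 * S₀ + 4 * S₁ + 2 * S₂ := by
    rw [← tsum_mul_left, ← tsum_mul_left, ← tsum_mul_left, ← s₀.tsum_add s₁,
      ← (s₀.add s₁).tsum_add s₂]
    have hterm (p : Nat.Primes) : divisorSumSq χ p * ((p : ℕ) : ℝ) ^ (-σ) ≤
        3 * (((1 : DirichletCharacter ℂ 1) (p : ℕ)).re * ((p : ℕ) : ℝ) ^ (-σ)) +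
        4 * ((χ (p : ℕ)).re * ((p : ℕ) : ℝ) ^ (-σ)) +
        2 * (((χ ^ 2) (p : ℕ)).re * ((p : ℕ) : ℝ) ^ (-σ)) := by
      rw [show ((1 : DirichletCharacter ℂ 1) (p : ℕ)) = 1 by
        rw [Subsingleton.elim ((p : ℕ) : ZMod 1) 1, map_one], Complex.one_re]
      refine (mul_le_mul_of_nonneg_right (divisorSumSq_prime_le χ p.2)
        (by positivity)).trans (le_of_eq (by ring))
    have hsum := (s₀.add s₁).add s₂
    have hsum' : Summable fun p : Nat.Primes => divisorSumSq χ p * ((p : ℕ) : ℝ) ^ (-σ) :=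
      Summable.of_nonneg_of_le (fun p : Nat.Primes => mul_nonneg (divisorSumSq_nonneg χ p)
        (by positivity)) hterm hsum
    exact hsum'.tsum_le_tsum hterm hsum
  calc _ ≤ Real.exp (3 * S₀ + 4 * S₁ + 2 * S₂) := Real.exp_le_exp.2 hle
    _ = Real.exp S₀ ^ 3 * Real.exp S₁ ^ 4 * Real.exp S₂ ^ 2 := by
        rw [← Real.exp_nat_mul, ← Real.exp_nat_mul, ← Real.exp_nat_mul, ← Real.exp_add,
          ← Real.exp_add]
        norm_num
    _ ≤ (A₀ * (B₀ / (σ - 1))) ^ 3 * (A₁ * B₁) ^ 4 * (A₂ * B₂) ^ 2 := by gcongr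
    _ = _ := by rw [← mul_div_assoc, div_pow]; ring

/-- For `χ ^ 2 ≠ 1` the mean of `divisorSumSq χ` over `n ≤ N` is `O((log N) ^ 2)`. -/
lemma exists_sum_divisorSumSq_le {a : ℕ} [NeZero a] {χ : DirichletCharacter ℂ a}
    (hχ : χ ^ 2 ≠ 1) : ∃ C : ℝ, 0 ≤ C ∧ ∀ N : ℕ, 2 ≤ N →
      ∑ n ∈ Finset.Icc 1 N, divisorSumSq χ n ≤ C * N * Real.log N ^ 2 := by
  obtain ⟨A, hA, h₁⟩ := exists_sum_mul_log_le
  obtain ⟨B, h₂⟩ := exists_sum_rpow_le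
  obtain ⟨K, hK, h₃⟩ := exists_exp_tsum_divisorSumSq_le hχ
  refine ⟨A * (Real.exp 1 * (K * Real.exp B)), by positivity, fun N hN => ?_⟩
  have hN0 : (0 : ℝ) < N := by exact_mod_cast (by omega : 0 < N)
  have hlog : 1 / 2 ≤ Real.log N := by
    have h2 : Real.log 2 ≤ Real.log N :=
      Real.log_le_log (by norm_num) (by exact_mod_cast hN)
    linarith [Real.log_two_gt_d9]
  have hlog0 : 0 < Real.log N := by linarith
  set σ : ℝ := 1 + 1 / Real.log N with hσ
  have hσ1 : 1 < σ := by rw [hσ]; linarith [one_div_pos.2 hlog0]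
  have hσ4 : σ ≤ 4 := by
    have : 1 / Real.log N ≤ 2 := by
      rw [div_le_iff₀ hlog0]; linarith
    linarith
  have hterm (m : ℕ) (hm : m ∈ Finset.Icc 1 N) :
      divisorSumSq χ m / m ≤ Real.exp 1 * (divisorSumSq χ m * (m : ℝ) ^ (-σ)) := by
    have hm' := Finset.mem_Icc.1 hm
    have hm0 : (0 : ℝ) < m := by exact_mod_cast hm'.1
    have hf := divisorSumSq_nonneg χ m
    have h : (m : ℝ) ^ (1 / Real.log N) ≤ Real.exp 1 := by
      rw [Real.rpow_def_of_pos hm0, Real.exp_le_exp, mul_one_div, div_le_one hlog0]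
      exact Real.log_le_log hm0 (by exact_mod_cast hm'.2)
    have hpos : 0 < (m : ℝ) ^ (1 / Real.log N) := Real.rpow_pos_of_pos hm0 _
    rw [hσ, Real.rpow_neg hm0.le, Real.rpow_add hm0, Real.rpow_one]
    calc divisorSumSq χ m / m = (m : ℝ) ^ (1 / Real.log N) *
          (divisorSumSq χ m * (m * (m : ℝ) ^ (1 / Real.log N))⁻¹) := by field_simp
      _ ≤ _ := by gcongr
  have hS : ∑ m ∈ Finset.Icc 1 N, divisorSumSq χ m / m ≤
      Real.exp 1 * (K * Real.exp B) * Real.log N ^ 3 := by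
    refine (Finset.sum_le_sum hterm).trans ?_
    rw [← Finset.mul_sum]
    have hR := h₂ (divisorSumSq χ) (divisorSumSq_one χ) (divisorSumSq_nonneg χ)
      (divisorSumSq_mul χ) (divisorSumSq_prime_pow_le χ) σ hσ1 N
    rw [Real.exp_add] at hR
    have hE := h₃ σ hσ1 hσ4
    rw [show σ - 1 = 1 / Real.log N by rw [hσ]; ring, one_div, inv_pow, div_inv_eq_mul] at hE
    calc _ ≤ Real.exp 1 * (K * Real.log N ^ 3 * Real.exp B) := by
          refine mul_le_mul_of_nonneg_left (hR.trans ?_) (Real.exp_pos 1).le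
          exact mul_le_mul_of_nonneg_right hE (Real.exp_pos B).le
      _ = _ := by ring
  have hmain := h₁ (divisorSumSq χ) (divisorSumSq_nonneg χ) (divisorSumSq_mul χ)
    (divisorSumSq_prime_pow_le χ) N
  refine le_of_mul_le_mul_right (hmain.trans ?_) hlog0
  calc _ ≤ A * N * (Real.exp 1 * (K * Real.exp B) * Real.log N ^ 3) := by gcongr
    _ = _ := by ring

/-- The error left after removing the characters of order at most `2` is controlled by the
divisor sums of the remaining characters. -/
lemma norm_R_sub_sq_le {a n : ℕ} (ha : 0 < a) (hn : 0 < n) (h : Nat.gcd n a = 1) :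
    ‖(R n a : ℂ) - (1 / (a.totient : ℂ)) *
        ∑ χ : DirichletCharacter ℂ a,
          (if χ ^ 2 = 1 then
            (starRingEnd ℂ) (χ (-(n : ZMod a))) * ∑ u ∈ (n ^ 2).divisors, χ (u : ZMod a)
          else 0)‖ ^ 2 ≤
      (Finset.univ.filter fun χ : DirichletCharacter ℂ a => ¬χ ^ 2 = 1).card *
        ∑ χ : DirichletCharacter ℂ a with ¬χ ^ 2 = 1, divisorSumSq χ n := by
  rw [R_eq_sum_characters ha hn h, ← mul_sub, ← Finset.sum_filter,
    ← Finset.sum_filter_add_sum_filter_not Finset.univ (fun χ : DirichletCharacter ℂ a => χ ^ 2 = 1),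
    add_sub_cancel_left]
  have hφ : ‖(1 / (a.totient : ℂ))‖ ≤ 1 := by
    rw [norm_div, norm_one, Complex.norm_natCast]
    refine div_le_one_of_le₀ ?_ (Nat.cast_nonneg _)
    exact_mod_cast Nat.totient_pos.2 ha
  have hnorm : ‖(1 / (a.totient : ℂ)) * ∑ χ : DirichletCharacter ℂ a with ¬χ ^ 2 = 1,
      (starRingEnd ℂ) (χ (-(n : ZMod a))) * ∑ u ∈ (n ^ 2).divisors, χ (u : ZMod a)‖ ≤
      ∑ χ : DirichletCharacter ℂ a with ¬χ ^ 2 = 1, ‖∑ u ∈ (n ^ 2).divisors, χ (u : ZMod a)‖ := by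
    rw [norm_mul]
    refine (mul_le_of_le_one_left (norm_nonneg _) hφ).trans
      (norm_sum_le_of_le _ fun χ _ => ?_)
    rw [norm_mul, RCLike.norm_conj]
    exact mul_le_of_le_one_left (norm_nonneg _) (χ.norm_le_one _)
  exact (pow_le_pow_left₀ (norm_nonneg _) hnorm 2).trans sq_sum_le_card_mul_sum_sq

theorem stmt0 (a : ℕ) (ha : 0 < a) :
    ∃ C : ℝ, ∀ N : ℕ, 2 ≤ N →
      ∑ n ∈ (Finset.Icc 1 N).filter (fun n => Nat.gcd n a = 1),
        ‖(R n a : ℂ) - (1 / (a.totient : ℂ)) *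
            ∑ χ : DirichletCharacter ℂ a,
              (if χ ^ 2 = 1 then
                (starRingEnd ℂ) (χ (-(n : ZMod a))) * ∑ u ∈ (n ^ 2).divisors, χ (u : ZMod a)
              else 0)‖ ^ 2
        ≤ C * N * Real.log N ^ 2 := by
  have hC (χ : DirichletCharacter ℂ a) : ∃ C : ℝ, ¬χ ^ 2 = 1 → ∀ N : ℕ, 2 ≤ N →
      ∑ n ∈ Finset.Icc 1 N, divisorSumSq χ n ≤ C * N * Real.log N ^ 2 := by
    by_cases hχ : χ ^ 2 = 1
    · exact ⟨0, fun h => absurd hχ h⟩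
    · have : NeZero a := ⟨ha.ne'⟩
      obtain ⟨C, -, h⟩ := exists_sum_divisorSumSq_le hχ
      exact ⟨C, fun _ => h⟩
  choose C hC using hC
  set s := Finset.univ.filter fun χ : DirichletCharacter ℂ a => ¬χ ^ 2 = 1
  refine ⟨s.card * ∑ χ ∈ s, C χ, fun N hN => ?_⟩
  calc _ ≤ ∑ n ∈ (Finset.Icc 1 N).filter (fun n => Nat.gcd n a = 1),
        s.card * ∑ χ ∈ s, divisorSumSq χ n := by
        refine Finset.sum_le_sum fun n hn => ?_
        rw [Finset.mem_filter, Finset.mem_Icc] at hn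
        exact norm_R_sub_sq_le ha hn.1.1 hn.2
    _ ≤ ∑ n ∈ Finset.Icc 1 N, s.card * ∑ χ ∈ s, divisorSumSq χ n :=
        Finset.sum_le_sum_of_subset_of_nonneg (Finset.filter_subset _ _) fun n _ _ =>
          mul_nonneg (Nat.cast_nonneg _) (Finset.sum_nonneg fun χ _ => divisorSumSq_nonneg χ n)
    _ = s.card * ∑ χ ∈ s, ∑ n ∈ Finset.Icc 1 N, divisorSumSq χ n := by
        rw [← Finset.mul_sum, Finset.sum_comm]
    _ ≤ s.card * ∑ χ ∈ s, C χ * N * Real.log N ^ 2 := by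
        refine mul_le_mul_of_nonneg_left (Finset.sum_le_sum fun χ hχ => ?_) (Nat.cast_nonneg _)
        exact hC χ (Finset.mem_filter.1 hχ).2 N hN
    _ = _ := by rw [← Finset.sum_mul, ← Finset.sum_mul]; ring
end

section
/- For every fixed positive integer a, the function log R(n;a) has normal order (log 3)·log log n; that is, for every ε > 0, the set of positive integers n satisfying |log R(n;a) − (log 3)·log log n| ≤ ε·log log n has natural density 1. -/
open scoped Classical

open Filter Topology

lemma card_filter_dvd_Icc (N d : ℕ) : ((Finset.Icc 1 N).filter (d ∣ ·)).card = N / d := by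
  rw [← Nat.Ioc_filter_dvd_card_eq_div]
  rfl

lemma sum_ite_dvd_Icc (N d : ℕ) :
    ∑ n ∈ Finset.Icc 1 N, (if d ∣ n then (1 : ℝ) else 0) = (N / d : ℕ) := by
  rw [Finset.sum_boole, card_filter_dvd_Icc]

lemma sub_one_le_natCast_div (N d : ℕ) : (N : ℝ) / d - 1 ≤ (N / d : ℕ) := by
  rw [← Nat.floor_div_eq_div (K := ℝ)]
  exact (Nat.sub_one_lt_floor _).le

/-- The Turán–Kubilius inequality for the number of prime divisors in a finite set of primes. -/
lemma turan_kubilius (N : ℕ) (P : Finset ℕ) (hP : ∀ p ∈ P, p.Prime ∧ p ≤ N) :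
    ∑ n ∈ Finset.Icc 1 N, (((P.filter (· ∣ n)).card : ℝ) - ∑ p ∈ P, (1 : ℝ) / p) ^ 2 ≤
      3 * N * ∑ p ∈ P, (1 : ℝ) / p := by
  set S := ∑ p ∈ P, (1 : ℝ) / p with hS
  have hS0 : 0 ≤ S := Finset.sum_nonneg fun p _ => by positivity
  have hcard : (P.card : ℝ) ≤ N := by
    have : P ⊆ Finset.Icc 1 N := fun p hp =>
      Finset.mem_Icc.2 ⟨(hP p hp).1.one_le, (hP p hp).2⟩
    have := Finset.card_le_card this
    rw [Nat.card_Icc] at this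
    exact_mod_cast this
  have hω (n : ℕ) : ((P.filter (· ∣ n)).card : ℝ) = ∑ p ∈ P, if p ∣ n then (1 : ℝ) else 0 := by
    rw [Finset.sum_boole]
  have h1 : N * S - N ≤ ∑ n ∈ Finset.Icc 1 N, ((P.filter (· ∣ n)).card : ℝ) := by
    simp_rw [hω]
    rw [Finset.sum_comm]
    simp_rw [sum_ite_dvd_Icc]
    calc N * S - N ≤ N * S - P.card := by linarith
      _ = ∑ p ∈ P, ((N : ℝ) / p - 1) := by
        rw [Finset.sum_sub_distrib, hS, Finset.mul_sum]; simp [div_eq_mul_inv]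
      _ ≤ _ := Finset.sum_le_sum fun p _ => sub_one_le_natCast_div N p
  have h2 : ∑ n ∈ Finset.Icc 1 N, ((P.filter (· ∣ n)).card : ℝ) ^ 2 ≤ N * S ^ 2 + N * S := by
    simp_rw [hω, sq, Finset.sum_mul_sum]
    rw [Finset.sum_comm]
    have : N * (S * S) + N * S =
        ∑ p ∈ P, ∑ q ∈ P, ((N : ℝ) / (p * q) + if p = q then (N : ℝ) / p else 0) := by
      simp_rw [Finset.sum_add_distrib, Finset.sum_ite_eq]
      rw [hS, Finset.sum_mul_sum, Finset.mul_sum, Finset.mul_sum]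
      congr 1
      · refine Finset.sum_congr rfl fun p _ => ?_
        rw [Finset.mul_sum]
        refine Finset.sum_congr rfl fun q _ => ?_
        ring
      · refine Finset.sum_congr rfl fun p hp => ?_
        rw [if_pos hp]; ring
    rw [this]
    refine Finset.sum_le_sum fun p hp => ?_
    rw [Finset.sum_comm]
    refine Finset.sum_le_sum fun q hq => ?_
    have hpq (n : ℕ) : (if p ∣ n then (1 : ℝ) else 0) * (if q ∣ n then (1 : ℝ) else 0) =
        if p ∣ n ∧ q ∣ n then 1 else 0 := by
      by_cases h : p ∣ n <;> by_cases h' : q ∣ n <;> simp [h, h']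
    simp_rw [hpq]
    split_ifs with h
    · subst h
      simp only [and_self]
      rw [sum_ite_dvd_Icc]
      have : ((N / p : ℕ) : ℝ) ≤ (N : ℝ) / p := Nat.cast_div_le
      have : 0 ≤ (N : ℝ) / (p * p) := by positivity
      linarith
    · have hc : p.Coprime q := (Nat.coprime_primes (hP p hp).1 (hP q hq).1).2 h
      have hd (n : ℕ) : p ∣ n ∧ q ∣ n ↔ p * q ∣ n :=
        ⟨fun h => hc.mul_dvd_of_dvd_of_dvd h.1 h.2,
          fun h => ⟨(dvd_mul_right _ _).trans h, (dvd_mul_left _ _).trans h⟩⟩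
      simp_rw [hd]
      rw [sum_ite_dvd_Icc, add_zero]
      exact_mod_cast (Nat.cast_div_le (α := ℝ) (m := N) (n := p * q))
  have h3 : ∑ n ∈ Finset.Icc 1 N, (((P.filter (· ∣ n)).card : ℝ) - S) ^ 2 =
      ∑ n ∈ Finset.Icc 1 N, ((P.filter (· ∣ n)).card : ℝ) ^ 2
      - 2 * S * ∑ n ∈ Finset.Icc 1 N, ((P.filter (· ∣ n)).card : ℝ) + N * S ^ 2 := by
    simp_rw [sub_sq, Finset.sum_add_distrib, Finset.sum_sub_distrib, Finset.mul_sum]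
    simp
    refine Finset.sum_congr rfl fun p _ => ?_
    ring
  rw [h3]
  nlinarith [mul_le_mul_of_nonneg_left h1 hS0]

/-- Chebyshev's inequality. -/
lemma card_filter_mul_sq_le {ι : Type*} (s : Finset ι) (f : ι → ℝ) {t : ℝ} (ht : 0 ≤ t) :
    ((s.filter (fun n => t ≤ |f n|)).card : ℝ) * t ^ 2 ≤ ∑ n ∈ s, f n ^ 2 := by
  calc _ = ∑ n ∈ s.filter (fun n => t ≤ |f n|), t ^ 2 := by simp
    _ ≤ ∑ n ∈ s.filter (fun n => t ≤ |f n|), f n ^ 2 := Finset.sum_le_sum fun n hn => by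
        rw [← sq_abs (f n)]
        exact pow_le_pow_left₀ ht (Finset.mem_filter.1 hn).2 2
    _ ≤ _ := Finset.sum_le_sum_of_subset_of_nonneg (Finset.filter_subset _ _)
        fun _ _ _ => sq_nonneg _

/-- Markov's inequality. -/
lemma card_filter_mul_le {ι : Type*} (s : Finset ι) (f : ι → ℝ) (hf : ∀ n ∈ s, 0 ≤ f n) (t : ℝ) :
    ((s.filter (fun n => t ≤ f n)).card : ℝ) * t ≤ ∑ n ∈ s, f n := by
  calc _ = ∑ n ∈ s.filter (fun n => t ≤ f n), t := by simp
    _ ≤ ∑ n ∈ s.filter (fun n => t ≤ f n), f n :=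
        Finset.sum_le_sum fun n hn => (Finset.mem_filter.1 hn).2
    _ ≤ _ := Finset.sum_le_sum_of_subset_of_nonneg (Finset.filter_subset _ _)
        fun n hn _ => hf n hn

lemma sum_log_prime_div_le {N : ℕ} (hN : 0 < N) :
    ∑ p ∈ N.primesLE, Real.log p / p ≤ Real.log N + Real.log 4 := by
  have hN' : (0 : ℝ) < N := by exact_mod_cast hN
  have h1 : ∑ p ∈ N.primesLE, Real.log p * ((N : ℝ) / p - 1) ≤
      ∑ p ∈ N.primesLE, Real.log p * (N / p : ℕ) := Finset.sum_le_sum fun p _ =>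
    mul_le_mul_of_nonneg_left (sub_one_le_natCast_div N p) (Real.log_natCast_nonneg p)
  have h2 : ∑ p ∈ N.primesLE, Real.log p * (N / p : ℕ) ≤ N * Real.log N := by
    simp_rw [← sum_ite_dvd_Icc, Finset.mul_sum]
    rw [Finset.sum_comm]
    calc _ ≤ ∑ n ∈ Finset.Icc 1 N, Real.log N := Finset.sum_le_sum fun n hn => ?_
      _ = _ := by simp
    obtain ⟨hn1, hn2⟩ := Finset.mem_Icc.1 hn
    simp_rw [mul_ite, mul_one, mul_zero]
    rw [← Finset.sum_filter, ← Real.log_prod fun p hp =>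
      by simpa using (Nat.prime_of_mem_primesLE (Finset.mem_filter.1 hp).1).ne_zero]
    rw [← Nat.cast_prod]
    refine Real.log_le_log ?_ ?_
    · exact_mod_cast Finset.prod_pos fun p hp =>
        (Nat.prime_of_mem_primesLE (Finset.mem_filter.1 hp).1).pos
    · refine Nat.cast_le.2 ((Nat.le_of_dvd hn1 ?_).trans hn2)
      refine (Finset.prod_dvd_prod_of_subset _ _ _ ?_).trans (Nat.prod_primeFactors_dvd n)
      intro p hp
      rw [Finset.mem_filter] at hp
      exact Nat.mem_primeFactors.2 ⟨Nat.prime_of_mem_primesLE hp.1, hp.2, by omega⟩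
  have h3 : ∑ p ∈ N.primesLE, Real.log p ≤ Real.log 4 * N := by
    rw [← Chebyshev.theta_eq_sum_primesLE_log]
    exact Chebyshev.theta_le_log4_mul_x hN'.le
  have h4 : ∑ p ∈ N.primesLE, Real.log p * ((N : ℝ) / p - 1) =
      N * ∑ p ∈ N.primesLE, Real.log p / p - ∑ p ∈ N.primesLE, Real.log p := by
    rw [Finset.mul_sum, ← Finset.sum_sub_distrib]
    exact Finset.sum_congr rfl fun p _ => by ring
  have : N * ∑ p ∈ N.primesLE, Real.log p / p ≤ N * (Real.log N + Real.log 4) := by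
    linarith
  exact le_of_mul_le_mul_left this hN'

lemma sum_primesLE_inv_mul_pred_le (N : ℕ) :
    ∑ p ∈ N.primesLE, (1 : ℝ) / (p * (p - 1)) ≤ 1 := by
  have h (N : ℕ) : ∑ k ∈ Finset.Icc 2 (N + 1), (1 : ℝ) / (k * (k - 1)) = 1 - 1 / (N + 1) := by
    induction N with
    | zero => simp
    | succ n ih =>
      rw [Finset.sum_Icc_succ_top (by omega), ih]
      push_cast
      field_simp
      ring
  calc _ ≤ ∑ k ∈ Finset.Icc 2 (N + 1), (1 : ℝ) / (k * (k - 1)) := by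
        refine Finset.sum_le_sum_of_subset_of_nonneg ?_ ?_
        · intro p hp
          have := Nat.two_le_of_mem_primesLE hp
          have := Nat.le_of_mem_primesLE hp
          exact Finset.mem_Icc.2 ⟨by omega, by omega⟩
        · intro k hk _
          have : (2 : ℝ) ≤ k := by exact_mod_cast (Finset.mem_Icc.1 hk).1
          have : (0 : ℝ) ≤ k - 1 := by linarith
          positivity
    _ ≤ 1 := by
      rw [h]
      have : (0 : ℝ) ≤ 1 / (N + 1) := by positivity
      linarith

lemma log_log_le_sum_primesLE {N : ℕ} (hN : 0 < N) :
    Real.log (Real.log (N + 1)) ≤ ∑ p ∈ N.primesLE, (1 : ℝ) / p + 1 := by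
  let f : ℕ →* ℝ :=
    { toFun := fun n => (n : ℝ)⁻¹, map_one' := by simp, map_mul' := by intros; simp [mul_comm] }
  have hf (n : ℕ) : f n = (n : ℝ)⁻¹ := rfl
  obtain ⟨hs, hp⟩ := EulerProduct.summable_and_hasSum_smoothNumbers_prod_primesBelow_geometric
    (f := f) (fun {p} hp => by
      rw [hf, norm_inv, Real.norm_natCast]
      exact inv_lt_one_of_one_lt₀ (by exact_mod_cast hp.one_lt)) (N + 1)
  have hprod : Real.log (N + 1) ≤ ∏ p ∈ N.primesLE, (1 - f p)⁻¹ := by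
    rw [← Nat.cast_add_one]
    refine (log_add_one_le_harmonic N).trans ?_
    change _ ≤ ∏ p ∈ (N + 1).primesBelow, _
    rw [← hp.tsum_eq]
    have hmem (n : ℕ) (hn : n ∈ Finset.range N) : n + 1 ∈ (N + 1).smoothNumbers := by
      rw [Nat.mem_smoothNumbers']
      intro p _ hp
      have := Nat.le_of_dvd (by omega) hp
      have := Finset.mem_range.1 hn
      omega
    have hle := hp.summable.sum_le_tsum
      ((Finset.range N).attach.map ⟨fun n => ⟨n.1 + 1, hmem n.1 n.2⟩, by
        intro a b hab
        exact Subtype.ext (Nat.succ_injective (congrArg Subtype.val hab))⟩)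
      (fun m _ => by rw [hf]; positivity)
    rw [Finset.sum_map] at hle
    have hh : (harmonic N : ℝ) = ∑ n ∈ (Finset.range N).attach, ((n.1 + 1 : ℕ) : ℝ)⁻¹ := by
      rw [Finset.sum_attach (Finset.range N) (fun n => ((n + 1 : ℕ) : ℝ)⁻¹)]
      simp [harmonic]
    exact hh.trans_le hle
  have hlog : 0 < Real.log (N + 1) := Real.log_pos (by
    have : (0 : ℝ) < N := by exact_mod_cast hN
    linarith)
  have hpos (p : ℕ) (hp : p ∈ N.primesLE) : 1 < (p : ℝ) := by
    exact_mod_cast Nat.one_lt_of_mem_primesLE hp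
  have hpos' (p : ℕ) (hp : p ∈ N.primesLE) : 0 < 1 - f p := by
    rw [hf, sub_pos]
    exact inv_lt_one_of_one_lt₀ (hpos p hp)
  calc _ ≤ Real.log (∏ p ∈ N.primesLE, (1 - f p)⁻¹) := Real.log_le_log hlog hprod
    _ = ∑ p ∈ N.primesLE, Real.log (1 - f p)⁻¹ :=
      Real.log_prod fun p hp => (inv_pos.2 (hpos' p hp)).ne'
    _ ≤ ∑ p ∈ N.primesLE, ((1 : ℝ) / p + 1 / (p * (p - 1))) := Finset.sum_le_sum fun p hp => by
      refine (Real.log_le_sub_one_of_pos (inv_pos.2 (hpos' p hp))).trans (le_of_eq ?_)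
      have h1 := hpos p hp
      have h2 : (p : ℝ) - 1 ≠ 0 := by linarith
      rw [hf]
      field_simp
      ring
    _ ≤ _ := by
      rw [Finset.sum_add_distrib]
      linarith [sum_primesLE_inv_mul_pred_le N]

lemma sum_primesLE_rpow_le {s : ℝ} (hs : 1 < s) (N : ℕ) :
    ∑ p ∈ N.primesLE, 1 / (p : ℝ) ^ s ≤ Real.log (∑' n : ℕ, 1 / (n : ℝ) ^ s) := by
  let f : ℕ →* ℝ :=
    { toFun := fun n => 1 / (n : ℝ) ^ s
      map_one' := by simp
      map_mul' := by
        intro m n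
        rw [Nat.cast_mul, Real.mul_rpow (by positivity) (by positivity)]
        field_simp }
  have hf (n : ℕ) : f n = 1 / (n : ℝ) ^ s := rfl
  have hsum : Summable fun n : ℕ => 1 / (n : ℝ) ^ s := Real.summable_one_div_nat_rpow.2 hs
  have hlt (p : ℕ) (hp : p.Prime) : f p < 1 := by
    rw [hf, one_div]
    exact inv_lt_one_of_one_lt₀ (Real.one_lt_rpow (by exact_mod_cast hp.one_lt) (by linarith))
  have hnn (n : ℕ) : 0 ≤ f n := by rw [hf]; positivity
  obtain ⟨-, hp⟩ := EulerProduct.summable_and_hasSum_smoothNumbers_prod_primesBelow_geometric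
    (f := f) (fun {p} hp => by
      rw [Real.norm_of_nonneg (hnn p)]
      exact hlt p hp) (N + 1)
  have hprod : ∏ p ∈ N.primesLE, (1 - f p)⁻¹ ≤ ∑' n : ℕ, 1 / (n : ℝ) ^ s := by
    change ∏ p ∈ (N + 1).primesBelow, _ ≤ _
    rw [← hp.tsum_eq]
    exact hsum.tsum_subtype_le _ _ hnn
  have hpos' (p : ℕ) (hp : p ∈ N.primesLE) : 0 < 1 - f p :=
    sub_pos.2 (hlt p (Nat.prime_of_mem_primesLE hp))
  calc _ ≤ ∑ p ∈ N.primesLE, Real.log (1 - f p)⁻¹ := Finset.sum_le_sum fun p hp => by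
        rw [Real.log_inv, ← hf]
        linarith [Real.log_le_sub_one_of_pos (hpos' p hp)]
    _ = Real.log (∏ p ∈ N.primesLE, (1 - f p)⁻¹) :=
      (Real.log_prod fun p hp => (inv_pos.2 (hpos' p hp)).ne').symm
    _ ≤ _ := Real.log_le_log (Finset.prod_pos fun p hp => inv_pos.2 (hpos' p hp)) hprod

/-- Mertens' second theorem, up to a bounded error. -/
lemma exists_abs_sum_primesLE_sub_log_log_le : ∃ C : ℝ, ∀ᶠ N : ℕ in atTop,
    |∑ p ∈ N.primesLE, (1 : ℝ) / p - Real.log (Real.log N)| ≤ C := by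
  have hlog : Tendsto (fun N : ℕ => Real.log N) atTop atTop :=
    Real.tendsto_log_atTop.comp tendsto_natCast_atTop_atTop
  have hs : Tendsto (fun N : ℕ => 1 + (Real.log N)⁻¹) atTop (𝓝[>] 1) := by
    refine tendsto_nhdsWithin_iff.2 ⟨?_, ?_⟩
    · simpa using (tendsto_inv_atTop_zero.comp hlog).const_add 1
    · filter_upwards [hlog.eventually_gt_atTop 0] with N hN
      simpa using hN
  have hz := (tendsto_sub_mul_tsum_nat_rpow.comp hs).eventually (gt_mem_nhds (show (1:ℝ) < 2 by norm_num))
  refine ⟨Real.log 2 + 1 + Real.log 4 + 1, ?_⟩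
  filter_upwards [hz, hlog.eventually_ge_atTop 1, eventually_gt_atTop 1] with N hz hl hN
  have hlN : 0 < Real.log N := by linarith
  have h4 : 0 < Real.log 4 := Real.log_pos (by norm_num)
  have h2 : 0 < Real.log 2 := Real.log_pos (by norm_num)
  rw [abs_le]
  constructor
  · have := log_log_le_sum_primesLE (N := N) (by omega)
    have : Real.log (Real.log N) ≤ Real.log (Real.log (N + 1)) :=
      Real.log_le_log hlN (Real.log_le_log (by positivity) (by linarith))
    linarith
  · set δ := (Real.log N)⁻¹ with hδ
    have hδ0 : 0 < δ := inv_pos.2 hlN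
    have hδ1 : δ ≤ 1 := inv_le_one_of_one_le₀ hl
    have hδl : δ * Real.log N = 1 := inv_mul_cancel₀ hlN.ne'
    have hA := sum_primesLE_rpow_le (s := 1 + δ) (by linarith) N
    have hB : Real.log (∑' n : ℕ, 1 / (n : ℝ) ^ (1 + δ)) ≤ Real.log 2 + Real.log (Real.log N) := by
      rw [← Real.log_mul (by norm_num) hlN.ne']
      have hz' : δ * ∑' n : ℕ, 1 / (n : ℝ) ^ (1 + δ) < 2 := by
        simpa [Function.comp] using hz
      refine Real.log_le_log ?_ ?_
      · have hsum : Summable fun n : ℕ => 1 / (n : ℝ) ^ (1 + δ) :=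
          Real.summable_one_div_nat_rpow.2 (by linarith)
        exact hsum.tsum_pos (fun n => by positivity) 1 (by simp)
      · calc _ = (δ * ∑' n : ℕ, 1 / (n : ℝ) ^ (1 + δ)) * Real.log N := by
              rw [mul_right_comm, hδl, one_mul]
          _ ≤ _ := by gcongr
    have hC : ∑ p ∈ N.primesLE, (1 : ℝ) / p ≤
        ∑ p ∈ N.primesLE, (1 / (p : ℝ) ^ (1 + δ) + δ * (Real.log p / p)) := by
      refine Finset.sum_le_sum fun p hp => ?_
      have hp0 : (0 : ℝ) < p := by exact_mod_cast (Nat.prime_of_mem_primesLE hp).pos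
      have h := Real.add_one_le_exp (-(δ * Real.log p))
      have he : 1 / (p : ℝ) ^ (1 + δ) = 1 / p * Real.exp (-(δ * Real.log p)) := by
        rw [Real.rpow_add hp0, Real.rpow_one, Real.exp_neg, Real.rpow_def_of_pos hp0,
          mul_comm δ]
        field_simp
      rw [he]
      have := mul_le_mul_of_nonneg_left h (show 0 ≤ 1 / (p : ℝ) by positivity)
      calc (1 : ℝ) / p = 1 / p * (-(δ * Real.log p) + 1) + δ * (Real.log p / p) := by ring
        _ ≤ _ := by linarith
    rw [Finset.sum_add_distrib, ← Finset.mul_sum] at hC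
    have hD := mul_le_mul_of_nonneg_left (sum_log_prime_div_le (N := N) (by omega)) hδ0.le
    rw [mul_add, hδl] at hD
    have : δ * Real.log 4 ≤ Real.log 4 := mul_le_of_le_one_left h4.le hδ1
    linarith

open ArithmeticFunction.vonMangoldt in
lemma not_summable_one_div_prime_and_eq {q : ℕ} [NeZero q] {r : ZMod q} (hr : IsUnit r) :
    ¬ Summable fun n : ℕ => if n.Prime ∧ (n : ZMod q) = r then (1 : ℝ) / n else 0 := by
  intro hg
  obtain ⟨C, hC⟩ := LSeries_residueClass_lower_bound hr
  have hlim : Tendsto (fun δ : ℝ => ∑' n : ℕ, δ * (residueClass r n / (n : ℝ) ^ (1 + δ)))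
      (𝓝[>] 0) (𝓝 (∑' _ : ℕ, 0)) := by
    refine tendsto_tsum_of_dominated_convergence
      ((summable_residueClass_non_primes_div r).add hg) (fun n => ?_) ?_
    · refine tendsto_nhdsWithin_of_tendsto_nhds ?_
      rcases n.eq_zero_or_pos with rfl | hn
      · simp
      · have hn' : (n : ℝ) ≠ 0 := by positivity
        have hc : Continuous fun δ : ℝ => δ * (residueClass r n / (n : ℝ) ^ (1 + δ)) := by
          refine continuous_id.mul (continuous_const.div ?_ fun δ => by positivity)
          exact (Real.continuous_const_rpow hn').comp (continuous_const.add continuous_id)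
        simpa using hc.tendsto 0
    · filter_upwards [Ioc_mem_nhdsGT (show (0 : ℝ) < 1 by norm_num)] with δ hδ n
      obtain ⟨hδ0, hδ1⟩ := hδ
      have hnn := residueClass_nonneg r n
      rw [Real.norm_of_nonneg (by positivity)]
      rcases n.eq_zero_or_pos with rfl | hn
      · simp
      have hn0 : (0 : ℝ) < n := by exact_mod_cast hn
      have hn1 : (1 : ℝ) ≤ n := by exact_mod_cast hn
      have hpow : (1 : ℝ) ≤ (n : ℝ) ^ δ := Real.one_le_rpow hn1 hδ0.le
      have hlog : δ * Real.log n ≤ (n : ℝ) ^ δ := by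
        rw [← Real.log_rpow hn0]
        linarith [Real.log_le_sub_one_of_pos (show 0 < (n : ℝ) ^ δ by positivity)]
      have hsplit : δ * (residueClass r n / (n : ℝ) ^ (1 + δ)) =
          δ * residueClass r n / (n : ℝ) ^ δ / n := by
        rw [Real.rpow_add hn0, Real.rpow_one]
        field_simp
      rw [hsplit]
      by_cases hp : n.Prime
      · by_cases hr : (n : ZMod q) = r
        · have hv : residueClass r n = Real.log n := by
            rw [residueClass, Set.indicator_of_mem (by exact hr),
              ArithmeticFunction.vonMangoldt_apply_prime hp]
          simp only [hp, hr, hv, if_true, and_self, zero_div, zero_add]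
          gcongr
          exact (div_le_one (by positivity)).2 hlog
        · simp [hr]
      · simp only [hp, if_false, false_and, add_zero]
        gcongr
        refine (div_le_self (by positivity) hpow).trans ?_
        exact mul_le_of_le_one_left hnn hδ1
  rw [tsum_zero] at hlim
  have hlow : Tendsto (fun δ : ℝ => (q.totient : ℝ)⁻¹ - C * δ) (𝓝[>] 0)
      (𝓝 ((q.totient : ℝ)⁻¹ - C * 0)) :=
    tendsto_nhdsWithin_of_tendsto_nhds
      ((continuous_const.sub (continuous_const.mul continuous_id)).tendsto 0)
  have hle := le_of_tendsto_of_tendsto hlow hlim (by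
    filter_upwards [Ioc_mem_nhdsGT (show (0 : ℝ) < 1 by norm_num)] with δ hδ
    obtain ⟨hδ0, hδ1⟩ := hδ
    have h := mul_le_mul_of_nonneg_left
      (hC (x := 1 + δ) ⟨by linarith, by linarith⟩) hδ0.le
    rw [tsum_mul_left]
    refine le_trans (le_of_eq ?_) h
    rw [add_sub_cancel_left]
    field_simp)
  have hq : 0 < (q.totient : ℝ)⁻¹ := inv_pos.2 (mod_cast q.totient.pos_of_neZero)
  linarith

lemma tendsto_sum_primesLE_filter_eq {q : ℕ} [NeZero q] {r : ZMod q} (hr : IsUnit r) :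
    Tendsto (fun N : ℕ => ∑ p ∈ N.primesLE.filter (fun p : ℕ => (p : ZMod q) = r), (1 : ℝ) / p)
      atTop atTop := by
  have h := (not_summable_iff_tendsto_nat_atTop_of_nonneg fun n => by
    split_ifs <;> positivity).1 (not_summable_one_div_prime_and_eq hr)
  refine ((tendsto_add_atTop_iff_nat 1).2 h).congr fun N => ?_
  rw [← Finset.sum_filter, Nat.primesLE_eq_filter_range, Finset.filter_filter]

lemma filter_dvd_primesLE {N n : ℕ} (hn : n ∈ Finset.Icc 1 N) :
    N.primesLE.filter (· ∣ n) = n.primeFactors := by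
  obtain ⟨h1, h2⟩ := Finset.mem_Icc.1 hn
  ext p
  rw [Finset.mem_filter, Nat.mem_primesLE, Nat.mem_primeFactors]
  constructor
  · rintro ⟨⟨-, hp⟩, hd⟩
    exact ⟨hp, hd, by omega⟩
  · rintro ⟨hp, hd, -⟩
    exact ⟨⟨(Nat.le_of_dvd h1 hd).trans h2, hp⟩, hd⟩

/-- Almost all integers have a prime factor in a given invertible residue class. -/
lemma tendsto_card_filter_forall_prime_ne {q : ℕ} [NeZero q] {r : ZMod q} (hr : IsUnit r) :
    Tendsto (fun N : ℕ => (((Finset.Icc 1 N).filter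
      (fun n => ∀ p : ℕ, p.Prime → p ∣ n → (p : ZMod q) ≠ r)).card : ℝ) / N) atTop (𝓝 0) := by
  have hS := tendsto_sum_primesLE_filter_eq hr
  refine squeeze_zero' (.of_forall fun N => by positivity) ?_
    (((tendsto_inv_atTop_zero.comp hS).const_mul 3).trans (by simp))
  filter_upwards [hS.eventually_gt_atTop 0, eventually_gt_atTop 0] with N hSN hN
  have hN' : (0 : ℝ) < N := by exact_mod_cast hN
  set P := N.primesLE.filter (fun p : ℕ => (p : ZMod q) = r)
  set S := ∑ p ∈ P, (1 : ℝ) / p with hSdef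
  have hT := turan_kubilius N P fun p hp =>
    (Nat.mem_primesLE.1 (Finset.mem_filter.1 hp).1).symm
  have hM := card_filter_mul_sq_le (Finset.Icc 1 N)
    (fun n => ((P.filter (· ∣ n)).card : ℝ) - S) hSN.le
  have hle : (((Finset.Icc 1 N).filter
      (fun n => ∀ p : ℕ, p.Prime → p ∣ n → (p : ZMod q) ≠ r)).card : ℝ) ≤
      ((Finset.Icc 1 N).filter
        (fun n => S ≤ |((P.filter (· ∣ n)).card : ℝ) - S|)).card := by
    refine Nat.cast_le.2 (Finset.card_le_card ?_)
    refine Finset.monotone_filter_right _ fun n _ hn => ?_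
    have : P.filter (· ∣ n) = ∅ := Finset.filter_eq_empty_iff.2 fun p hp hd => by
      obtain ⟨h1, h2⟩ := Finset.mem_filter.1 hp
      exact hn p (Nat.prime_of_mem_primesLE h1) hd h2
    rw [this]
    simpa using le_abs_self S
  rw [Function.comp_apply, div_le_iff₀ hN']
  refine hle.trans ?_
  have := hM.trans hT
  rw [← hSdef, sq, ← mul_assoc] at this
  have := le_of_mul_le_mul_right this hSN
  calc _ = _ * S * S⁻¹ := (mul_inv_cancel_right₀ hSN.ne' _).symm
    _ ≤ 3 * N * S⁻¹ := by gcongr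
    _ = _ := by ring

lemma tendsto_log_log_natCast :
    Tendsto (fun N : ℕ => Real.log (Real.log N)) atTop atTop :=
  Real.tendsto_log_atTop.comp (Real.tendsto_log_atTop.comp tendsto_natCast_atTop_atTop)

/-- The Hardy–Ramanujan theorem for the number of distinct prime factors. -/
lemma tendsto_card_filter_primeFactors {η : ℝ} (hη : 0 < η) :
    Tendsto (fun N : ℕ => (((Finset.Icc 1 N).filter (fun n => η * Real.log (Real.log N) ≤
      |(n.primeFactors.card : ℝ) - Real.log (Real.log N)|)).card : ℝ) / N) atTop (𝓝 0) := by
  have hL := tendsto_log_log_natCast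
  obtain ⟨C, hC⟩ := exists_abs_sum_primesLE_sub_log_log_le
  refine squeeze_zero' (.of_forall fun N => by positivity) ?_
    (((tendsto_inv_atTop_zero.comp hL).const_mul (24 / η ^ 2)).trans (by simp))
  filter_upwards [hC, hL.eventually_gt_atTop 0, hL.eventually_ge_atTop C,
    hL.eventually_ge_atTop (2 * C / η), eventually_gt_atTop 0] with N hCN hL0 hLC hLC' hN
  have hN' : (0 : ℝ) < N := by exact_mod_cast hN
  set L := Real.log (Real.log N)
  set S := ∑ p ∈ N.primesLE, (1 : ℝ) / p with hSdef
  rw [div_le_iff₀ hη] at hLC'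
  have hT := turan_kubilius N N.primesLE fun p hp => (Nat.mem_primesLE.1 hp).symm
  have ht : 0 ≤ η / 2 * L := by positivity
  have hM := card_filter_mul_sq_le (Finset.Icc 1 N)
    (fun n => ((N.primesLE.filter (· ∣ n)).card : ℝ) - S) ht
  have hle : (((Finset.Icc 1 N).filter
      (fun n => η * L ≤ |(n.primeFactors.card : ℝ) - L|)).card : ℝ) ≤
      ((Finset.Icc 1 N).filter
        (fun n => η / 2 * L ≤ |((N.primesLE.filter (· ∣ n)).card : ℝ) - S|)).card := by
    refine Nat.cast_le.2 (Finset.card_le_card ?_)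
    refine Finset.monotone_filter_right _ fun n hn' hn => ?_
    rw [filter_dvd_primesLE hn']
    have := abs_sub_le (n.primeFactors.card : ℝ) S L
    linarith
  rw [Function.comp_apply, div_le_iff₀ hN']
  refine hle.trans ?_
  have hSL : S ≤ 2 * L := by linarith [(abs_le.1 hCN).2]
  have h1 := (hM.trans hT).trans (mul_le_mul_of_nonneg_left hSL (by positivity))
  have h2 : (24 / η ^ 2 * L⁻¹ * N) * (η / 2 * L) ^ 2 = 3 * N * (2 * L) := by
    field_simp
    ring
  rw [← h2] at h1
  exact le_of_mul_le_mul_right h1 (by positivity)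

lemma sum_cardFactors_sub_card_primeFactors_le (N : ℕ) :
    ∑ n ∈ Finset.Icc 1 N, ((ArithmeticFunction.cardFactors n : ℝ) - n.primeFactors.card) ≤
      2 * N := by
  have hΩ (n : ℕ) (hn : n ∈ Finset.Icc 1 N) : (ArithmeticFunction.cardFactors n : ℝ) =
      ∑ p ∈ N.primesLE, (n.factorization p : ℝ) := by
    rw [ArithmeticFunction.cardFactors_eq_sum_factorization,
      Finsupp.sum_of_support_subset (s := N.primesLE) _ _ _ (fun _ _ => rfl)]
    · push_cast; rfl
    · rw [Nat.support_factorization, ← filter_dvd_primesLE hn]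
      exact Finset.filter_subset _ _
  have hω (n : ℕ) (hn : n ∈ Finset.Icc 1 N) : (n.primeFactors.card : ℝ) =
      ∑ p ∈ N.primesLE, if p ∣ n then (1 : ℝ) else 0 := by
    rw [Finset.sum_boole, filter_dvd_primesLE hn]
  have hv (p : ℕ) (hp : p ∈ N.primesLE) :
      ∑ n ∈ Finset.Icc 1 N, (n.factorization p : ℝ) ≤ (N : ℝ) / (p - 1) := by
    have hpp := Nat.prime_of_mem_primesLE hp
    have : Fact p.Prime := ⟨hpp⟩
    have h1 := sub_one_mul_padicValNat_factorial (p := p) N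
    have h2 : N.factorial.factorization p = ∑ n ∈ Finset.Icc 1 N, n.factorization p := by
      rw [← Finset.prod_Ico_id_eq_factorial, Finset.Ico_add_one_right_eq_Icc, Nat.factorization_prod fun n hn => by
        have := (Finset.mem_Icc.1 hn).1
        omega]
      simp
    have hp1 : (1 : ℝ) < p := by exact_mod_cast hpp.one_lt
    rw [le_div_iff₀ (by linarith), ← Nat.cast_sum, ← h2, Nat.factorization_def _ hpp]
    have h3 : (p - 1) * padicValNat p N.factorial ≤ N := h1 ▸ Nat.sub_le _ _
    have h4 : (((p - 1 : ℕ) : ℝ)) * padicValNat p N.factorial ≤ N := by exact_mod_cast h3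
    rw [Nat.cast_sub hpp.one_le, Nat.cast_one] at h4
    linarith
  calc _ = ∑ n ∈ Finset.Icc 1 N, ∑ p ∈ N.primesLE,
        ((n.factorization p : ℝ) - if p ∣ n then (1 : ℝ) else 0) :=
      Finset.sum_congr rfl fun n hn => by rw [hΩ n hn, hω n hn, Finset.sum_sub_distrib]
    _ = ∑ p ∈ N.primesLE, (∑ n ∈ Finset.Icc 1 N, (n.factorization p : ℝ) - (N / p : ℕ)) := by
      rw [Finset.sum_comm]
      refine Finset.sum_congr rfl fun p _ => ?_
      rw [Finset.sum_sub_distrib, sum_ite_dvd_Icc]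
    _ ≤ ∑ p ∈ N.primesLE, (N * ((1 : ℝ) / (p * (p - 1))) + 1) :=
      Finset.sum_le_sum fun p hp => by
        have h1 := hv p hp
        have h2 := sub_one_le_natCast_div N p
        have hp1 : (1 : ℝ) < p := by exact_mod_cast Nat.one_lt_of_mem_primesLE hp
        have hp2 : (p : ℝ) - 1 ≠ 0 := by linarith
        have : (N : ℝ) * (1 / (p * (p - 1))) = N / (p - 1) - N / p := by
          field_simp
          ring
        linarith
    _ ≤ _ := by
      rw [Finset.sum_add_distrib, ← Finset.mul_sum]
      have h1 := mul_le_mul_of_nonneg_left (sum_primesLE_inv_mul_pred_le N)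
        (Nat.cast_nonneg (α := ℝ) N)
      have h2 : (N.primesLE.card : ℝ) ≤ N := by
        have : N.primesLE ⊆ Finset.Icc 1 N := fun p hp => Finset.mem_Icc.2
          ⟨(Nat.one_lt_of_mem_primesLE hp).le, Nat.le_of_mem_primesLE hp⟩
        have := Finset.card_le_card this
        rw [Nat.card_Icc] at this
        exact_mod_cast this
      simp only [Finset.sum_const, nsmul_eq_mul, mul_one]
      linarith

lemma card_primeFactors_le_cardFactors (n : ℕ) :
    n.primeFactors.card ≤ ArithmeticFunction.cardFactors n :=
  ArithmeticFunction.cardFactors_apply ▸ List.toFinset_card_le _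

lemma tendsto_card_filter_cardFactors_sub {η : ℝ} (hη : 0 < η) :
    Tendsto (fun N : ℕ => (((Finset.Icc 1 N).filter (fun n => η * Real.log (Real.log N) ≤
      (ArithmeticFunction.cardFactors n : ℝ) - n.primeFactors.card)).card : ℝ) / N)
      atTop (𝓝 0) := by
  have hL := tendsto_log_log_natCast
  refine squeeze_zero' (.of_forall fun N => by positivity) ?_
    (((tendsto_inv_atTop_zero.comp hL).const_mul (2 / η)).trans (by simp))
  filter_upwards [hL.eventually_gt_atTop 0, eventually_gt_atTop 0] with N hL0 hN
  have hN' : (0 : ℝ) < N := by exact_mod_cast hN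
  have hM := (card_filter_mul_le (Finset.Icc 1 N)
    (fun n => (ArithmeticFunction.cardFactors n : ℝ) - n.primeFactors.card)
    (fun n _ => sub_nonneg.2 (by exact_mod_cast card_primeFactors_le_cardFactors n))
    (η * Real.log (Real.log N))).trans (sum_cardFactors_sub_card_primeFactors_le N)
  rw [Function.comp_apply, div_le_iff₀ hN']
  have h2 : (2 / η * (Real.log (Real.log N))⁻¹ * N) * (η * Real.log (Real.log N)) = 2 * N := by
    field_simp
  rw [← h2] at hM
  exact le_of_mul_le_mul_right hM (by positivity)

lemma div_eq_one_div_add_one_div_iff {a n x y : ℕ} (hn : 0 < n) (hx : 0 < x) (hy : 0 < y) :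
    (a : ℚ) / n = 1 / x + 1 / y ↔ a * (x * y) = n * (x + y) := by
  have hn' : (n : ℚ) ≠ 0 := by positivity
  have hx' : (x : ℚ) ≠ 0 := by positivity
  have hy' : (y : ℚ) ≠ 0 := by positivity
  rw [div_add_div _ _ hx' hy', div_eq_div_iff hn' (by positivity), ← Nat.cast_inj (R := ℚ)]
  push_cast
  constructor <;> intro h <;> linarith

/-- The pairs counted by `R n a`. -/
def solutionSet (n a : ℕ) : Set (ℕ × ℕ) :=
  {p | 0 < p.1 ∧ 0 < p.2 ∧ a * (p.1 * p.2) = n * (p.1 + p.2)}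

lemma R_eq_ncard_solutionSet {n : ℕ} (hn : 0 < n) (a : ℕ) : R n a = (solutionSet n a).ncard := by
  rw [R, Nat.card_coe_set_eq]
  congr 1
  ext ⟨x, y⟩
  constructor
  · rintro ⟨hx, hy, h⟩
    exact ⟨hx, hy, (div_eq_one_div_add_one_div_iff hn hx hy).1 h⟩
  · rintro ⟨hx, hy, h⟩
    exact ⟨hx, hy, (div_eq_one_div_add_one_div_iff hn hx hy).2 h⟩

lemma R_mul_mul {g : ℕ} (hg : 0 < g) (n a : ℕ) : R (g * n) (g * a) = R n a := by
  have hg' : (g : ℚ) ≠ 0 := by positivity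
  simp only [R, Nat.cast_mul, mul_div_mul_left _ _ hg']

lemma lt_mul_of_mem_solutionSet {n a : ℕ} (hn : 0 < n) {p : ℕ × ℕ} (hp : p ∈ solutionSet n a) :
    n < a * p.1 := by
  obtain ⟨hx, hy, h⟩ := hp
  by_contra! hle
  have h1 := Nat.mul_le_mul_right p.2 hle
  have h2 : 0 < n * p.1 := Nat.mul_pos hn hx
  nlinarith

lemma sub_mul_sub_of_mem_solutionSet {n a : ℕ} (hn : 0 < n) {p : ℕ × ℕ}
    (hp : p ∈ solutionSet n a) : (a * p.1 - n) * (a * p.2 - n) = n ^ 2 := by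
  have h1 := lt_mul_of_mem_solutionSet hn hp
  obtain ⟨hx, hy, h⟩ := hp
  have h2 := lt_mul_of_mem_solutionSet (p := p.swap) (a := a) hn
    ⟨hy, hx, by simp only [Prod.fst_swap, Prod.snd_swap]; linarith⟩
  simp only [Prod.fst_swap] at h2
  obtain ⟨u, hu⟩ := Nat.exists_eq_add_of_le h1.le
  obtain ⟨v, hv⟩ := Nat.exists_eq_add_of_le h2.le
  rw [hu, hv, Nat.add_sub_cancel_left, Nat.add_sub_cancel_left]
  have h3 : (a * p.1) * (a * p.2) = n * (a * p.1 + a * p.2) := by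
    linear_combination a * h
  rw [hu, hv] at h3
  nlinarith

lemma mapsTo_solutionSet_divisors {n a : ℕ} (hn : 0 < n) (p : ℕ × ℕ) (hp : p ∈ solutionSet n a) :
    a * p.1 - n ∈ ((n ^ 2).divisors : Set ℕ) := by
  rw [Finset.mem_coe, Nat.mem_divisors]
  exact ⟨Dvd.intro _ (sub_mul_sub_of_mem_solutionSet hn hp), by positivity⟩

lemma injOn_solutionSet {n a : ℕ} (hn : 0 < n) (ha : 0 < a) :
    Set.InjOn (fun p : ℕ × ℕ => a * p.1 - n) (solutionSet n a) := by
  rintro ⟨x, y⟩ hp ⟨x', y'⟩ hp' h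
  have h1 := lt_mul_of_mem_solutionSet hn hp
  have h1' := lt_mul_of_mem_solutionSet hn hp'
  simp only at h h1 h1'
  have hx : x = x' := Nat.eq_of_mul_eq_mul_left ha (by omega)
  subst hx
  have h2 := hp.2.2
  have h2' := hp'.2.2
  simp only at h2 h2'
  have hy : (a * x - n) * y = (a * x - n) * y' := by
    rw [Nat.sub_mul, Nat.sub_mul]
    have e1 : a * x * y = n * x + n * y := by linarith
    have e2 : a * x * y' = n * x + n * y' := by linarith
    rw [e1, e2]
    omega
  rw [Nat.eq_of_mul_eq_mul_left (by omega) hy]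

lemma finite_solutionSet {n a : ℕ} (hn : 0 < n) (ha : 0 < a) : (solutionSet n a).Finite :=
  Set.Finite.of_injOn (mapsTo_solutionSet_divisors hn) (injOn_solutionSet hn ha)
    (Finset.finite_toSet _)

lemma card_divisors_sq_le {n : ℕ} (hn : 0 < n) :
    (n ^ 2).divisors.card ≤ 3 ^ ArithmeticFunction.cardFactors n := by
  rw [Nat.card_divisors (by positivity), Nat.primeFactors_pow _ two_ne_zero,
    ArithmeticFunction.cardFactors_eq_sum_factorization, Finsupp.sum, Nat.support_factorization,
    ← Finset.prod_pow_eq_pow_sum]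
  refine Finset.prod_le_prod' fun p _ => ?_
  rw [Nat.factorization_pow]
  have h := one_add_mul_le_pow (show (-2 : ℤ) ≤ 2 by norm_num) (n.factorization p)
  have h' : ((2 * n.factorization p + 1 : ℕ) : ℤ) ≤ ((3 ^ n.factorization p : ℕ) : ℤ) := by
    push_cast
    norm_num at h
    linarith
  simpa using Nat.cast_le.1 h'

lemma R_le_three_pow_cardFactors {n a : ℕ} (hn : 0 < n) (ha : 0 < a) :
    R n a ≤ 3 ^ ArithmeticFunction.cardFactors n := by
  rw [R_eq_ncard_solutionSet hn]
  refine le_trans ?_ (card_divisors_sq_le hn)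
  rw [← Set.ncard_coe_finset]
  exact Set.ncard_le_ncard_of_injOn _ (mapsTo_solutionSet_divisors hn) (injOn_solutionSet hn ha)
    (Finset.finite_toSet _)

/-- If `n` has enough prime factors in all residue classes to correct the class of any divisor of
`m ^ 2`, then each such divisor contributes to `R n a`. -/
lemma card_divisors_sq_le_R {n a m : ℕ} (hn : 0 < n) (ha : 0 < a) (hna : n.Coprime a)
    (q : (ZMod a)ˣ → ℕ) (hq : ∀ r, (q r : ZMod a) = r) (hqm : ∀ r, m.Coprime (q r))
    (hdvd : ∀ r, m * q r ∣ n) : (m ^ 2).divisors.card ≤ R n a := by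
  have hmn : m ∣ n := (dvd_mul_right _ _).trans (hdvd 1)
  have hex (e : ℕ) (he : e ∣ m ^ 2) : ∃ r, ((e * q r : ℕ) : ZMod a) = -n := by
    have hea : e.Coprime a := Nat.Coprime.coprime_dvd_left (he.trans (pow_dvd_pow_of_dvd hmn 2))
      (hna.pow_left 2)
    refine ⟨-(ZMod.unitOfCoprime n hna) * (ZMod.unitOfCoprime e hea)⁻¹, ?_⟩
    rw [Nat.cast_mul, hq, ← ZMod.coe_unitOfCoprime e hea, ← Units.val_mul, mul_comm,
      inv_mul_cancel_right]
    simp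
  choose! r hr using hex
  set d : ℕ → ℕ := fun e => e * q (r e) with hd
  have hdn (e : ℕ) (he : e ∣ m ^ 2) : d e * (n ^ 2 / d e) = n ^ 2 := by
    refine Nat.mul_div_cancel' ((Nat.mul_dvd_mul he (dvd_pow_self (q (r e)) two_ne_zero)).trans ?_)
    rw [← mul_pow]
    exact pow_dvd_pow_of_dvd (hdvd _) 2
  have hda (e : ℕ) (he : e ∣ m ^ 2) : a ∣ d e + n := by
    rw [← ZMod.natCast_eq_zero_iff, Nat.cast_add, hr e he, neg_add_cancel]
  have hda' (e : ℕ) (he : e ∣ m ^ 2) : a ∣ n ^ 2 / d e + n := by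
    rw [← ZMod.natCast_eq_zero_iff]
    have h := congrArg (Nat.cast (R := ZMod a)) (hdn e he)
    rw [Nat.cast_mul, hr e he] at h
    have hu : IsUnit (n : ZMod a) := ⟨ZMod.unitOfCoprime n hna, ZMod.coe_unitOfCoprime n hna⟩
    refine hu.mul_left_cancel ?_
    push_cast at h ⊢
    linear_combination -h
  rw [R_eq_ncard_solutionSet hn, ← Set.ncard_coe_finset]
  refine Set.ncard_le_ncard_of_injOn (fun e => ((d e + n) / a, (n ^ 2 / d e + n) / a)) ?_ ?_
    (finite_solutionSet hn ha)
  · intro e he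
    have he' := Nat.dvd_of_mem_divisors (Finset.mem_coe.1 he)
    obtain ⟨x, hx⟩ := hda e he'
    obtain ⟨y, hy⟩ := hda' e he'
    have hdd := hdn e he'
    simp only [hx, hy, Nat.mul_div_cancel_left _ ha]
    refine ⟨Nat.pos_of_ne_zero ?_, Nat.pos_of_ne_zero ?_, ?_⟩
    · rintro rfl
      rw [mul_zero] at hx
      omega
    · rintro rfl
      rw [mul_zero] at hy
      exact hn.ne' (Nat.add_eq_zero_iff.1 hy).2
    · refine Nat.eq_of_mul_eq_mul_left ha ?_
      calc a * (a * (x * y)) = (a * x) * (a * y) := by ring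
        _ = d e * (n ^ 2 / d e) + n * (d e + n ^ 2 / d e) + n ^ 2 := by rw [← hx, ← hy]; ring
        _ = n * ((d e + n) + (n ^ 2 / d e + n)) := by rw [hdd]; ring
        _ = a * (n * (x + y)) := by rw [hx, hy]; ring
  · intro e he e' he' h
    have he := Nat.dvd_of_mem_divisors (Finset.mem_coe.1 he)
    have he' := Nat.dvd_of_mem_divisors (Finset.mem_coe.1 he')
    have h1 := Nat.div_left_inj (hda e he) (hda e' he') |>.1 (Prod.ext_iff.1 h).1
    have h2 : e * q (r e) = e' * q (r e') := by simpa [hd] using h1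
    have hcop (e r) (he : e ∣ m ^ 2) : e.Coprime (q r) :=
      Nat.Coprime.coprime_dvd_left he ((hqm r).pow_left 2)
    refine Nat.dvd_antisymm ?_ ?_
    · exact (hcop e _ he).dvd_of_dvd_mul_right (h2 ▸ dvd_mul_right _ _)
    · exact (hcop e' _ he').dvd_of_dvd_mul_right (h2.symm ▸ dvd_mul_right _ _)

lemma card_divisors_prod_primes_sq (T : Finset ℕ) (hT : ∀ p ∈ T, p.Prime) :
    ((∏ p ∈ T, p) ^ 2).divisors.card = 3 ^ T.card := by
  induction T using Finset.induction_on with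
  | empty => simp
  | insert p T hp ih =>
    have hpp := hT p (Finset.mem_insert_self p T)
    have hT' (x : ℕ) (hx : x ∈ T) : x.Prime := hT x (Finset.mem_insert_of_mem hx)
    have hcop : p.Coprime (∏ p ∈ T, p) := Nat.Coprime.prod_right fun x hx =>
      (Nat.coprime_primes hpp (hT' x hx)).2 fun h => hp (h ▸ hx)
    rw [Finset.prod_insert hp, mul_pow, (hcop.pow 2 2).card_divisors_mul, ih hT',
      Finset.card_insert_of_notMem hp, Nat.divisors_prime_pow hpp, Finset.card_map,
      Finset.card_range, pow_succ]
    ring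

lemma three_pow_card_primeFactors_le {n a : ℕ} (hn : 0 < n) (ha : 0 < a)
    (h : ∀ r : (ZMod a)ˣ, ∃ p : ℕ, p.Prime ∧ p ∣ n ∧ (p : ZMod a) = r) :
    3 ^ n.primeFactors.card ≤ 3 ^ (2 * a) * R n a := by
  have : NeZero a := ⟨ha.ne'⟩
  choose q hqp hqn hqr using h
  set T := n.primeFactors \ (Finset.univ.image q ∪ a.primeFactors) with hT
  have hTp (p : ℕ) (hp : p ∈ T) : p.Prime :=
    Nat.prime_of_mem_primeFactors (Finset.mem_sdiff.1 hp).1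
  have hcard : n.primeFactors.card ≤ 2 * a + T.card := by
    have h1 := Finset.le_card_sdiff (Finset.univ.image q ∪ a.primeFactors) n.primeFactors
    have h2 := Finset.card_union_le (Finset.univ.image q) a.primeFactors
    have h3 : (Finset.univ.image q).card ≤ a := by
      refine Finset.card_image_le.trans ?_
      rw [Finset.card_univ, ZMod.card_units_eq_totient]
      exact Nat.totient_le a
    have h4 : a.primeFactors.card ≤ a := by
      have hs : a.primeFactors ⊆ Finset.Icc 1 a := fun p hp => Finset.mem_Icc.2
        ⟨(Nat.prime_of_mem_primeFactors hp).one_le, Nat.le_of_mem_primeFactors hp⟩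
      simpa using Finset.card_le_card hs
    rw [← hT] at h1
    omega
  refine (Nat.pow_le_pow_right (by norm_num) hcard).trans ?_
  rw [pow_add, ← card_divisors_prod_primes_sq T hTp]
  refine Nat.mul_le_mul_left _ ?_
  set m := ∏ p ∈ T, p with hm
  have hma : m.Coprime a := Nat.Coprime.prod_left fun p hp => by
    rw [(hTp p hp).coprime_iff_not_dvd]
    intro hd
    exact (Finset.mem_sdiff.1 hp).2 (Finset.mem_union_right _
      (Nat.mem_primeFactors.2 ⟨hTp p hp, hd, ha.ne'⟩))
  have hmq (r : (ZMod a)ˣ) : m.Coprime (q r) := Nat.Coprime.prod_left fun p hp => by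
    rw [Nat.coprime_primes (hTp p hp) (hqp r)]
    rintro rfl
    exact (Finset.mem_sdiff.1 hp).2 (Finset.mem_union_left _
      (Finset.mem_image_of_mem q (Finset.mem_univ r)))
  have hqa (r : (ZMod a)ˣ) : (q r).Coprime a := by
    rw [← ZMod.isUnit_iff_coprime, hqr]
    exact r.isUnit
  have hmn : m ∣ n := (Finset.prod_dvd_prod_of_subset _ _ _ Finset.sdiff_subset).trans
    (Nat.prod_primeFactors_dvd n)
  obtain ⟨g, n', a', hg, hcop, hn', ha'⟩ := Nat.exists_coprime' (m := n) (n := a)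
    (Nat.gcd_pos_of_pos_left _ hn)
  have hdvd : a' ∣ a := ⟨g, ha'⟩
  have hR : R n a = R n' a' := by
    rw [hn', ha', mul_comm n', mul_comm a', R_mul_mul hg]
  rw [hR]
  refine card_divisors_sq_le_R (Nat.pos_of_mul_pos_right (hn' ▸ hn))
    (Nat.pos_of_mul_pos_right (ha' ▸ ha)) hcop
    (q ∘ Function.surjInv (ZMod.unitsMap_surjective hdvd)) (fun r => ?_) (fun r => hmq _)
    (fun r => ?_)
  · have h1 := congrArg (ZMod.castHom hdvd (ZMod a')) (hqr (Function.surjInv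
      (ZMod.unitsMap_surjective hdvd) r))
    rw [map_natCast] at h1
    rw [Function.comp_apply, h1]
    exact congrArg Units.val (Function.surjInv_eq (ZMod.unitsMap_surjective hdvd) r)
  · rw [Function.comp_apply]
    set s := Function.surjInv (ZMod.unitsMap_surjective hdvd) r
    refine Nat.Coprime.dvd_of_dvd_mul_right (k := m * q s) (n := g) ?_ ?_
    · exact Nat.Coprime.coprime_dvd_right ⟨a', by rw [ha', mul_comm]⟩ (hma.mul_left (hqa s))
    · rw [← hn']
      exact (hmq s).mul_dvd_of_dvd_of_dvd hmn (hqn s)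

lemma tendsto_card_filter_mul_self_le :
    Tendsto (fun N : ℕ => (((Finset.Icc 1 N).filter (fun n => n * n ≤ N)).card : ℝ) / N)
      atTop (𝓝 0) := by
  have h : Tendsto (fun N : ℕ => 1 / √(N : ℝ)) atTop (𝓝 0) := by
    simp only [one_div]
    exact (Real.tendsto_sqrt_atTop.comp tendsto_natCast_atTop_atTop).inv_tendsto_atTop
  refine squeeze_zero (fun N => by positivity) (fun N => ?_) h
  have hcard : ((Finset.Icc 1 N).filter (fun n => n * n ≤ N)).card ≤ N.sqrt := by
    calc _ ≤ (Finset.Icc 1 N.sqrt).card := Finset.card_le_card fun n hn => by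
          simp only [Finset.mem_filter, Finset.mem_Icc] at hn ⊢
          exact ⟨hn.1.1, Nat.le_sqrt.2 hn.2⟩
      _ = N.sqrt := by simp
  have hsqrt : ((N.sqrt : ℕ) : ℝ) ≤ √(N : ℝ) := Real.nat_sqrt_le_real_sqrt
  rw [← Real.sqrt_div_self']
  gcongr
  exact (Nat.cast_le.2 hcard).trans hsqrt

lemma log_log_le_log_two_add_log_log {n N : ℕ} (hN : 2 ≤ N) (h : N < n * n) :
    Real.log (Real.log N) ≤ Real.log 2 + Real.log (Real.log n) := by
  have hn : 1 < n := by nlinarith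
  have hN' : (1 : ℝ) < N := by exact_mod_cast hN
  have hlog : 0 < Real.log n := Real.log_pos (by exact_mod_cast hn)
  rw [← Real.log_mul two_ne_zero hlog.ne']
  refine Real.log_le_log (Real.log_pos hN') ?_
  have hle : Real.log N ≤ Real.log ((n : ℝ) * n) :=
    Real.log_le_log (by linarith) (by exact_mod_cast h.le)
  rw [Real.log_mul (by positivity) (by positivity)] at hle
  linarith

lemma abs_log_R_sub_le {a n N : ℕ} (ha : 0 < a) {ε : ℝ} (hε : 0 < ε) (hN : 2 ≤ N) (hnN : n ≤ N)
    (hL : 4 * a + 2 + ε ≤ ε / 2 * Real.log (Real.log N)) (hsq : N < n * n)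
    (hω : |(n.primeFactors.card : ℝ) - Real.log (Real.log N)| < ε / 8 * Real.log (Real.log N))
    (hΩ : (ArithmeticFunction.cardFactors n : ℝ) - n.primeFactors.card <
      ε / 8 * Real.log (Real.log N))
    (hr : ∀ r : (ZMod a)ˣ, ∃ p : ℕ, p.Prime ∧ p ∣ n ∧ (p : ZMod a) = r) :
    |Real.log (R n a) - Real.log 3 * Real.log (Real.log n)| ≤ ε * Real.log (Real.log n) := by
  have hn : 1 < n := by nlinarith
  have hlower : (3 : ℝ) ^ n.primeFactors.card ≤ 3 ^ (2 * a) * R n a := by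
    exact_mod_cast three_pow_card_primeFactors_le (by lia) ha hr
  have hupper : (R n a : ℝ) ≤ 3 ^ ArithmeticFunction.cardFactors n := by
    exact_mod_cast R_le_three_pow_cardFactors (by lia) ha
  have hR : (0 : ℝ) < R n a :=
    pos_of_mul_pos_right ((by positivity : (0 : ℝ) < 3 ^ n.primeFactors.card).trans_le hlower)
      (by positivity)
  have hlog_upper := Real.log_le_log hR hupper
  have hlog_lower := Real.log_le_log (by positivity) hlower
  rw [Real.log_pow] at hlog_upper
  rw [Real.log_mul (by positivity) hR.ne', Real.log_pow, Real.log_pow] at hlog_lower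
  push_cast at hlog_lower
  have hlog3 : Real.log 3 ≤ 2 := by
    linarith [Real.log_le_sub_one_of_pos (by norm_num : (0 : ℝ) < 3)]
  have hlog3_pos : 0 < Real.log 3 := Real.log_pos (by norm_num)
  have hlog2 : Real.log 2 ≤ 1 := by
    linarith [Real.log_le_sub_one_of_pos (by norm_num : (0 : ℝ) < 2)]
  have hL_le := log_log_le_log_two_add_log_log hN hsq
  have hle_L : Real.log (Real.log n) ≤ Real.log (Real.log N) := by
    have hn' : (1 : ℝ) < n := by exact_mod_cast hn
    exact Real.log_le_log (Real.log_pos hn')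
      (Real.log_le_log (by linarith) (by exact_mod_cast hnN))
  have ha' : (0 : ℝ) < a := by exact_mod_cast ha
  set L := Real.log (Real.log N)
  set l := Real.log (Real.log n)
  have hLε : 0 < ε * L := by linarith
  obtain ⟨hω₁, hω₂⟩ := abs_lt.1 hω
  have hmain : ε / 2 * L + 4 * a + 2 ≤ ε * l := by
    have : ε * (L - 1) ≤ ε * l := by gcongr; linarith
    linarith
  rw [abs_le]
  constructor
  · have h₁ : Real.log 3 * (l - n.primeFactors.card + 2 * a) ≤
        Real.log 3 * (ε / 8 * L + 2 * a) := by gcongr; linarith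
    have h₂ : Real.log 3 * (ε / 8 * L + 2 * a) ≤ 2 * (ε / 8 * L + 2 * a) :=
      mul_le_mul_of_nonneg_right hlog3 (by linarith)
    linarith
  · have h₁ : Real.log 3 * (ArithmeticFunction.cardFactors n - l) ≤
        Real.log 3 * (1 + ε / 4 * L) := by gcongr; linarith
    have h₂ : Real.log 3 * (1 + ε / 4 * L) ≤ 2 * (1 + ε / 4 * L) :=
      mul_le_mul_of_nonneg_right hlog3 (by linarith)
    linarith

/-- A set whose complement has density zero has density one. -/
lemma tendsto_card_filter_one_of_not {P : ℕ → Prop}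
    (h : Tendsto (fun N : ℕ => (((Finset.Icc 1 N).filter (fun n => ¬ P n)).card : ℝ) / N)
      atTop (𝓝 0)) :
    Tendsto (fun N : ℕ => (((Finset.Icc 1 N).filter P).card : ℝ) / N) atTop (𝓝 1) := by
  have h1 := h.const_sub 1
  rw [sub_zero] at h1
  refine h1.congr' ?_
  filter_upwards [eventually_gt_atTop 0] with N hN
  have hcard : (((Finset.Icc 1 N).filter P).card : ℝ) +
      ((Finset.Icc 1 N).filter (fun n => ¬ P n)).card = N := by
    exact_mod_cast (by simpa using Finset.card_filter_add_card_filter_not (s := Finset.Icc 1 N) P)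
  have hN' : (N : ℝ) ≠ 0 := by positivity
  field_simp
  linarith

/-- For every fixed positive integer `a`, `log R(n; a)` has normal order
`(log 3) · log log n`: for every `ε > 0`, the set of `n` with
`|log R(n;a) - (log 3) log log n| ≤ ε log log n` has natural density `1`. -/
theorem stmt1 (a : ℕ) (ha : 0 < a) (ε : ℝ) (hε : 0 < ε) :
    Filter.Tendsto (fun N : ℕ =>
      (((Finset.Icc 1 N).filter (fun n =>
          |Real.log (R n a) - Real.log 3 * Real.log (Real.log n)| ≤
            ε * Real.log (Real.log n))).card : ℝ) / N)
      Filter.atTop (nhds 1) := by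
  have : NeZero a := ⟨ha.ne'⟩
  refine tendsto_card_filter_one_of_not ?_
  have hη : 0 < ε / 8 := by positivity
  have hsum := ((tendsto_card_filter_mul_self_le.add (tendsto_card_filter_primeFactors hη)).add
    (tendsto_card_filter_cardFactors_sub hη)).add
    (tendsto_finsetSum Finset.univ fun (r : (ZMod a)ˣ) _ =>
      tendsto_card_filter_forall_prime_ne r.isUnit)
  simp only [add_zero, Finset.sum_const_zero] at hsum
  refine squeeze_zero' (.of_forall fun N => by positivity) ?_ hsum
  have hlarge : ∀ᶠ N : ℕ in atTop, 4 * a + 2 + ε ≤ ε / 2 * Real.log (Real.log N) :=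
    (tendsto_log_log_natCast.const_mul_atTop (half_pos hε)).eventually_ge_atTop _
  filter_upwards [hlarge, eventually_ge_atTop 2] with N hL hN
  rw [← Finset.sum_div, ← add_div, ← add_div, ← add_div]
  gcongr
  rw [← Nat.cast_sum, ← Nat.cast_add, ← Nat.cast_add, ← Nat.cast_add, Nat.cast_le]
  refine (Finset.card_le_card ?_).trans <| (Finset.card_union_le _ _).trans <|
    add_le_add ((Finset.card_union_le _ _).trans <| add_le_add_left (Finset.card_union_le _ _) _)
      Finset.card_biUnion_le
  intro n hn
  rw [Finset.mem_filter] at hn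
  by_contra hmem
  simp only [Finset.mem_union, Finset.mem_biUnion, Finset.mem_filter, hn.1, true_and,
    Finset.mem_univ, not_or, not_exists, not_le, not_forall, not_not] at hmem
  obtain ⟨⟨⟨hsq, hω⟩, hΩ⟩, hr⟩ := hmem
  refine hn.2 (abs_log_R_sub_le ha hε hN (Finset.mem_Icc.1 hn.1).2 hL hsq hω hΩ fun r => ?_)
  obtain ⟨p, hp, hpn, hpr⟩ := hr r
  exact ⟨p, hp, hpn, hpr⟩
end

section
/- Let a be a fixed positive integer and let Φ(z) = (1/√(2π)) ∫_{−∞}^{z} e^{−t²/2} dt be the standard Gaussian distribution function. Then for every real number z, the limit as N → ∞ of (1/N) · card{ n ≤ N : (log R(n;a) − (log 3)·log log n) / ((log 3)·√(log log n)) ≤ z } equals Φ(z). -/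
open scoped Classical

/-- The standard Gaussian distribution function
`Φ(z) = (1/√(2π)) ∫_{-∞}^z e^{-t²/2} dt`. -/
noncomputable def Phi (z : ℝ) : ℝ :=
  (1 / Real.sqrt (2 * Real.pi)) * ∫ t in Set.Iic z, Real.exp (-t ^ 2 / 2)

namespace ErdosKac

open Filter Finset Topology

lemma sum_log_eq_sum_vonMangoldt (N : ℕ) :
    ∑ n ∈ Ioc 0 N, Real.log n =
      ∑ d ∈ Ioc 0 N, ArithmeticFunction.vonMangoldt d * ((N / d : ℕ) : ℝ) := by
  have h : ∀ n ∈ Ioc 0 N, Real.log n =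
      ∑ d ∈ Ioc 0 N, if d ∣ n then ArithmeticFunction.vonMangoldt d else 0 := by
    intro n hn
    rw [mem_Ioc] at hn
    rw [← ArithmeticFunction.vonMangoldt_sum, ← sum_filter]
    refine sum_congr ?_ fun _ _ => rfl
    ext d
    simp only [Nat.mem_divisors, mem_filter, mem_Ioc]
    constructor
    · rintro ⟨h1, h2⟩
      exact ⟨⟨Nat.pos_of_dvd_of_pos h1 hn.1, (Nat.le_of_dvd hn.1 h1).trans hn.2⟩, h1⟩
    · rintro ⟨_, h2⟩
      exact ⟨h2, hn.1.ne'⟩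
  rw [sum_congr rfl h, sum_comm]
  refine sum_congr rfl fun d _ => ?_
  rw [← sum_filter, sum_const, Nat.Ioc_filter_dvd_card_eq_div, nsmul_eq_mul, mul_comm]

lemma sum_log_le (N : ℕ) : ∑ n ∈ Ioc 0 N, Real.log n ≤ N * Real.log N := by
  calc ∑ n ∈ Ioc 0 N, Real.log n ≤ ∑ n ∈ Ioc 0 N, Real.log N := by
        refine sum_le_sum fun n hn => ?_
        rw [mem_Ioc] at hn
        exact Real.log_le_log (by exact_mod_cast hn.1) (by exact_mod_cast hn.2)
    _ = _ := by simp

lemma le_sum_log (N : ℕ) : N * Real.log N - N ≤ ∑ n ∈ Ioc 0 N, Real.log n := by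
  induction N with
  | zero => simp
  | succ n ih =>
    rw [sum_Ioc_succ_top (Nat.zero_le n)]
    rcases Nat.eq_zero_or_pos n with rfl | hn
    · simp
    have hn' : (0 : ℝ) < n := by exact_mod_cast hn
    have h : Real.log ((n + 1 : ℕ) : ℝ) - Real.log n ≤ 1 / n := by
      rw [← Real.log_div (by positivity) hn'.ne']
      refine (Real.log_le_sub_one_of_pos (by positivity)).trans (le_of_eq ?_)
      push_cast
      field_simp
      ring
    have h2 : n * (Real.log ((n + 1 : ℕ) : ℝ) - Real.log n) ≤ 1 := by
      calc _ ≤ n * (1 / n : ℝ) := by gcongr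
        _ = 1 := by field_simp
    push_cast at *
    nlinarith

/-- Mertens' first theorem for the von Mangoldt function. -/
lemma abs_sum_vonMangoldt_div_sub_log_le :
    ∃ C : ℝ, ∀ N : ℕ, 1 ≤ N →
      |∑ d ∈ Ioc 0 N, ArithmeticFunction.vonMangoldt d / d - Real.log N| ≤ C := by
  refine ⟨Real.log 4 + 5, fun N hN => ?_⟩
  have hN' : (0 : ℝ) < N := by exact_mod_cast hN
  have hΛ (d : ℕ) : 0 ≤ ArithmeticFunction.vonMangoldt d :=
    ArithmeticFunction.vonMangoldt_nonneg
  set V := ∑ d ∈ Ioc 0 N, ArithmeticFunction.vonMangoldt d / (d : ℝ) with hV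
  have h1 : ∑ n ∈ Ioc 0 N, Real.log n ≤ N * V := by
    rw [sum_log_eq_sum_vonMangoldt, hV, mul_sum]
    refine sum_le_sum fun d _ => ?_
    calc ArithmeticFunction.vonMangoldt d * ((N / d : ℕ) : ℝ)
        ≤ ArithmeticFunction.vonMangoldt d * ((N : ℝ) / d) := by
          have := @Nat.cast_div_le ℝ _ _ _ N d
          have := hΛ d
          gcongr
      _ = _ := by ring
  have h2 : N * V - Chebyshev.psi N ≤ ∑ n ∈ Ioc 0 N, Real.log n := by
    rw [sum_log_eq_sum_vonMangoldt, hV, mul_sum, Chebyshev.psi, Nat.floor_natCast,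
      ← sum_sub_distrib]
    refine sum_le_sum fun d hd => ?_
    rw [mem_Ioc] at hd
    have hd' : (0 : ℝ) < d := by exact_mod_cast hd.1
    have h3 : (N : ℝ) / d - 1 ≤ ((N / d : ℕ) : ℝ) := by
      rw [← Nat.floor_div_eq_div (K := ℝ)]
      exact (Nat.sub_one_lt_floor _).le
    calc (N : ℝ) * (ArithmeticFunction.vonMangoldt d / d) - ArithmeticFunction.vonMangoldt d
        = ArithmeticFunction.vonMangoldt d * ((N : ℝ) / d - 1) := by ring
      _ ≤ _ := mul_le_mul_of_nonneg_left h3 (hΛ d)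
  have h3 := sum_log_le N
  have h4 := le_sum_log N
  have h5 := Chebyshev.psi_le_const_mul_self hN'.le
  have h6 : (0 : ℝ) ≤ Real.log 4 := Real.log_nonneg (by norm_num)
  rw [abs_le]
  constructor
  · have : N * (Real.log N - 1) ≤ N * V := by linarith
    have := le_of_mul_le_mul_left this hN'
    linarith
  · have : N * V ≤ N * (Real.log N + (Real.log 4 + 4)) := by linarith
    have := le_of_mul_le_mul_left this hN'
    linarith

/-- Mertens' first theorem. -/
lemma abs_sum_log_div_sub_log_le :
    ∃ C : ℝ, ∀ N : ℕ, 1 ≤ N →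
      |∑ p ∈ Nat.primesLE N, Real.log p / p - Real.log N| ≤ C := by
  obtain ⟨C, hC⟩ := abs_sum_vonMangoldt_div_sub_log_le
  have hs := ArithmeticFunction.vonMangoldt.summable_residueClass_non_primes_div
    (q := 1) (0 : ZMod 1)
  set f : ℕ → ℝ := fun n => (if n.Prime then 0
    else ArithmeticFunction.vonMangoldt.residueClass (0 : ZMod 1) n) / n with hf
  have hf0 (n : ℕ) : 0 ≤ f n := by
    rw [hf]
    have := ArithmeticFunction.vonMangoldt.residueClass_nonneg (0 : ZMod 1) n
    positivity
  have hfe (n : ℕ) : ArithmeticFunction.vonMangoldt n / (n : ℝ)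
      = (if n.Prime then Real.log n / n else 0) + f n := by
    simp only [hf, ArithmeticFunction.vonMangoldt.residueClass]
    split_ifs with h
    · simp [ArithmeticFunction.vonMangoldt_apply_prime h]
    · rw [Set.indicator_of_mem]
      · simp
      · exact Subsingleton.elim (α := ZMod 1) _ _
  refine ⟨C + ∑' n, f n, fun N hN => ?_⟩
  have h1 : ∑ d ∈ Ioc 0 N, ArithmeticFunction.vonMangoldt d / (d : ℝ)
      = ∑ p ∈ Nat.primesLE N, Real.log p / p + ∑ d ∈ Ioc 0 N, f d := by
    rw [Nat.primesLE_eq_filter_Ioc_zero, sum_filter, ← sum_add_distrib]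
    exact sum_congr rfl fun d _ => hfe d
  have h2 : ∑ d ∈ Ioc 0 N, f d ≤ ∑' n, f n := hs.sum_le_tsum _ fun i _ => hf0 i
  have h3 : 0 ≤ ∑ d ∈ Ioc 0 N, f d := sum_nonneg fun i _ => hf0 i
  have h4 := hC N hN
  rw [h1, abs_le] at h4
  rw [abs_le]
  constructor <;> linarith [h4.1, h4.2]

/-- The sum of the reciprocals of the primes up to `N`. -/
noncomputable def primeRecipSum (N : ℕ) : ℝ := ∑ p ∈ Nat.primesLE N, (1 / p : ℝ)

/-- Mertens' second theorem. -/
lemma abs_primeRecipSum_sub_log_log_le :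
    ∃ C : ℝ, ∀ N : ℕ, 2 ≤ N → |primeRecipSum N - Real.log (Real.log N)| ≤ C := by
  obtain ⟨C, hC⟩ := abs_sum_log_div_sub_log_le
  set A : ℕ → ℝ := fun N => ∑ p ∈ Nat.primesLE N, Real.log p / p with hA
  set D : ℕ → ℝ := fun N => primeRecipSum N - A N / Real.log N - Real.log (Real.log N) with hD
  have hlog2 : 0 < Real.log 2 := Real.log_pos (by norm_num)
  have hlogpos : ∀ n : ℕ, 2 ≤ n → Real.log 2 ≤ Real.log n := fun n hn =>
    Real.log_le_log (by norm_num) (by exact_mod_cast hn)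
  have hC0 : 0 ≤ C := (abs_nonneg _).trans (hC 1 le_rfl)
  have hstep : ∀ n : ℕ, 2 ≤ n →
      |D (n + 1) - D n| ≤ (C + 1) * (1 / Real.log n - 1 / Real.log (n + 1 : ℕ)) := by
    intro n hn
    have hn0 : (0 : ℝ) < n := by positivity
    have hl0 : 0 < Real.log n := hlog2.trans_le (hlogpos n hn)
    have hl1 : 0 < Real.log (n + 1 : ℕ) := hlog2.trans_le (hlogpos (n + 1) (by omega))
    have hle : Real.log n ≤ Real.log (n + 1 : ℕ) :=
      Real.log_le_log hn0 (by push_cast; linarith)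
    have hΔ : Real.log (n + 1 : ℕ) - Real.log n ≤ 1 := by
      rw [← Real.log_div (by positivity) hn0.ne']
      refine (Real.log_le_sub_one_of_pos (by positivity)).trans ?_
      push_cast
      rw [add_div, div_self hn0.ne']
      have : 1 / (n : ℝ) ≤ 1 := by
        rw [div_le_one hn0]
        exact_mod_cast (by omega : 1 ≤ n)
      linarith
    have hS : primeRecipSum (n + 1) - primeRecipSum n
        = (A (n + 1) - A n) / Real.log (n + 1 : ℕ) := by
      simp only [primeRecipSum, hA, Nat.primesLE_succ]
      split_ifs with hp
      · rw [sum_insert (Nat.notMem_primesLE n), sum_insert (Nat.notMem_primesLE n)]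
        field_simp
        ring
      · simp
    have hDe : D (n + 1) - D n = (A n - Real.log n) * (1 / Real.log n - 1 / Real.log (n + 1 : ℕ))
        + ((1 - Real.log n / Real.log (n + 1 : ℕ))
          - (Real.log (Real.log (n + 1 : ℕ)) - Real.log (Real.log n))) := by
      have : D (n + 1) - D n = (primeRecipSum (n + 1) - primeRecipSum n)
          - (A (n + 1) / Real.log (n + 1 : ℕ) - A n / Real.log n)
          - (Real.log (Real.log (n + 1 : ℕ)) - Real.log (Real.log n)) := by
        simp only [hD]; ring
      rw [this, hS]
      field_simp
      ring
    set l := Real.log n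
    set m := Real.log (n + 1 : ℕ)
    have hu : Real.log m - Real.log l ≤ m / l - 1 := by
      rw [← Real.log_div hl1.ne' hl0.ne']
      exact Real.log_le_sub_one_of_pos (by positivity)
    have hv : 1 - l / m ≤ Real.log m - Real.log l := by
      rw [← Real.log_div hl1.ne' hl0.ne']
      refine (le_of_eq ?_).trans (Real.one_sub_inv_le_log_of_pos (by positivity))
      rw [inv_div]
    have hw : (m / l - 1) - (1 - l / m) ≤ 1 / l - 1 / m := by
      have e1 : (m / l - 1) - (1 - l / m) = (m - l) * (m - l) / (l * m) := by
        field_simp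
      have e2 : 1 / l - 1 / m = (m - l) * 1 / (l * m) := by field_simp
      rw [e1, e2]
      have : 0 ≤ m - l := by linarith
      gcongr
    have hd0 : 0 ≤ 1 / l - 1 / m := by
      have := one_div_le_one_div_of_le hl0 hle
      linarith
    rw [hDe]
    refine (abs_add_le _ _).trans ?_
    rw [abs_mul, abs_of_nonneg hd0, add_mul, one_mul]
    refine add_le_add (mul_le_mul_of_nonneg_right (hC n (by omega)) hd0) ?_
    rw [abs_le]
    constructor <;> linarith
  have hbound : ∀ n : ℕ, 2 ≤ n →
      |D n| ≤ |D 2| + (C + 1) * (1 / Real.log 2 - 1 / Real.log n) := by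
    intro n hn
    induction n, hn using Nat.le_induction with
    | base => simp
    | succ n hn ih =>
      have := hstep n hn
      have h2 := abs_sub_abs_le_abs_sub (D (n + 1)) (D n)
      linarith
  refine ⟨|D 2| + (C + 1) / Real.log 2 + (1 + C / Real.log 2), fun N hN => ?_⟩
  have hl := hlogpos N hN
  have hl0 := hlog2.trans_le hl
  have e : primeRecipSum N - Real.log (Real.log N)
      = D N + (1 + (A N - Real.log N) / Real.log N) := by
    simp only [hD]
    field_simp
    ring
  rw [e]
  refine (abs_add_le _ _).trans (add_le_add ?_ ((abs_add_le _ _).trans (add_le_add (by simp) ?_)))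
  · refine (hbound N hN).trans ?_
    rw [mul_sub, ← mul_div_assoc, mul_one]
    have : 0 ≤ (C + 1) * (1 / Real.log N) := by positivity
    linarith
  · rw [abs_div, abs_of_pos hl0]
    exact div_le_div₀ hC0 (hC N (by omega)) hlog2 hl

end ErdosKac

namespace ErdosKac

open Filter Finset Topology

lemma card_Icc_filter_dvd (N d : ℕ) : #{n ∈ Icc 1 N | d ∣ n} = N / d := by
  rw [← Nat.Ioc_filter_dvd_card_eq_div]
  rfl

lemma abs_floor_div_sub_inv_le {N d : ℕ} (hN : 1 ≤ N) (hd : 1 ≤ d) {σ : ℝ} (h0 : 0 ≤ σ)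
    (h1 : σ ≤ 1) :
    |((N / d : ℕ) : ℝ) / N - 1 / d| ≤ (N : ℝ) ^ (-σ) * (d : ℝ) ^ (σ - 1) := by
  have hN' : (0 : ℝ) < N := by exact_mod_cast hN
  have hd' : (0 : ℝ) < d := by exact_mod_cast hd
  rcases le_or_gt d N with h | h
  · have h2 : |((N / d : ℕ) : ℝ) / N - 1 / d| ≤ (N : ℝ)⁻¹ := by
      have e : ((N / d : ℕ) : ℝ) / N - 1 / d = (((N / d : ℕ) : ℝ) - (N : ℝ) / d) * (N : ℝ)⁻¹ := by
        field_simp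
      rw [e, abs_mul, abs_of_pos (inv_pos.2 hN')]
      refine mul_le_of_le_one_left (by positivity) ?_
      have a1 : ((N / d : ℕ) : ℝ) ≤ (N : ℝ) / d := Nat.cast_div_le
      have a2 : (N : ℝ) / d - 1 ≤ ((N / d : ℕ) : ℝ) := by
        rw [← Nat.floor_div_eq_div (K := ℝ)]
        exact (Nat.sub_one_lt_floor _).le
      rw [abs_le]
      constructor <;> linarith
    refine h2.trans ?_
    calc (N : ℝ)⁻¹ = (N : ℝ) ^ (-σ) * (N : ℝ) ^ (σ - 1) := by
          rw [← Real.rpow_add hN', ← Real.rpow_neg_one]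
          congr 1
          ring
      _ ≤ _ := by
          refine mul_le_mul_of_nonneg_left ?_ (by positivity)
          exact Real.rpow_le_rpow_of_nonpos hd' (by exact_mod_cast h) (by linarith)
  · rw [Nat.div_eq_of_lt h]
    have e : |((0 : ℕ) : ℝ) / N - 1 / d| = (d : ℝ) ^ (-σ) * (d : ℝ) ^ (σ - 1) := by
      rw [← Real.rpow_add hd']
      have : -σ + (σ - 1) = -1 := by ring
      rw [this, Real.rpow_neg_one]
      simp
    rw [e]
    refine mul_le_mul_of_nonneg_right ?_ (by positivity)
    exact Real.rpow_le_rpow_of_nonpos hN' (by exact_mod_cast h.le) (by linarith)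

/-- A fundamental lemma by Rankin's trick: the mean over `n ≤ N` of a multiplicative function
depending only on the divisibility of `n` by the primes in `P` is close to its Euler product. -/
lemma norm_mean_sub_prod_le {P : Finset ℕ} (hP : ∀ p ∈ P, p.Prime) (w : ℂ) {σ : ℝ} (h0 : 0 ≤ σ)
    (h1 : σ ≤ 1) {N : ℕ} (hN : 1 ≤ N) :
    ‖(∑ n ∈ Icc 1 N, ∏ p ∈ P, (1 + if p ∣ n then w else 0)) / N - ∏ p ∈ P, (1 + w / p)‖
      ≤ (N : ℝ) ^ (-σ) * Real.exp (‖w‖ * ∑ p ∈ P, (p : ℝ) ^ (σ - 1)) := by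
  have e1 : ∀ n : ℕ, ∏ p ∈ P, (1 + if p ∣ n then w else 0)
      = ∑ T ∈ P.powerset, if (∏ p ∈ T, p) ∣ n then w ^ #T else 0 := by
    intro n
    rw [prod_one_add]
    refine sum_congr rfl fun T hT => ?_
    rw [mem_powerset] at hT
    have hiff : (∏ p ∈ T, p) ∣ n ↔ ∀ p ∈ T, p ∣ n := by
      refine ⟨fun h p hp => (dvd_prod_of_mem _ hp).trans h, fun h => ?_⟩
      exact prod_primes_dvd n (fun p hp => (hP p (hT hp)).prime) h
    by_cases h : ∀ p ∈ T, p ∣ n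
    · rw [if_pos (hiff.2 h), prod_congr rfl fun p hp => if_pos (h p hp), prod_const]
    · rw [if_neg (mt hiff.1 h)]
      push Not at h
      obtain ⟨p, hp, hpn⟩ := h
      exact prod_eq_zero hp (if_neg hpn)
  have e2 : ∑ n ∈ Icc 1 N, ∏ p ∈ P, (1 + if p ∣ n then w else 0)
      = ∑ T ∈ P.powerset, w ^ #T * ((N / (∏ p ∈ T, p) : ℕ) : ℂ) := by
    simp_rw [e1]
    rw [sum_comm]
    refine sum_congr rfl fun T _ => ?_
    rw [← sum_filter, sum_const, card_Icc_filter_dvd, nsmul_eq_mul, mul_comm]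
  have e3 : ∏ p ∈ P, (1 + w / p) = ∑ T ∈ P.powerset, w ^ #T * (1 / ((∏ p ∈ T, p : ℕ) : ℂ)) := by
    rw [prod_one_add]
    refine sum_congr rfl fun T _ => ?_
    rw [prod_div_distrib, prod_const, Nat.cast_prod]
    ring
  have hN' : (0 : ℝ) ≤ N := Nat.cast_nonneg N
  rw [e2, e3, sum_div, ← sum_sub_distrib]
  calc _ ≤ ∑ T ∈ P.powerset, ‖w ^ #T * ((N / (∏ p ∈ T, p) : ℕ) : ℂ) / N
          - w ^ #T * (1 / ((∏ p ∈ T, p : ℕ) : ℂ))‖ := norm_sum_le _ _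
    _ ≤ ∑ T ∈ P.powerset, (N : ℝ) ^ (-σ) * ∏ p ∈ T, (‖w‖ * (p : ℝ) ^ (σ - 1)) := by
        refine sum_le_sum fun T hT => ?_
        rw [mem_powerset] at hT
        have hd : 1 ≤ ∏ p ∈ T, p := prod_pos fun p hp => (hP p (hT hp)).pos
        have := abs_floor_div_sub_inv_le hN hd h0 h1
        rw [mul_div_assoc, ← mul_sub, norm_mul, norm_pow, prod_mul_distrib, prod_const]
        have e4 : ‖((N / (∏ p ∈ T, p) : ℕ) : ℂ) / N - 1 / ((∏ p ∈ T, p : ℕ) : ℂ)‖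
            = |((N / (∏ p ∈ T, p) : ℕ) : ℝ) / N - 1 / ((∏ p ∈ T, p : ℕ) : ℝ)| := by
          rw [← Real.norm_eq_abs, ← Complex.norm_real]
          push_cast
          rfl
        rw [e4, mul_left_comm]
        refine mul_le_mul_of_nonneg_left (this.trans (le_of_eq ?_)) (by positivity)
        rw [Nat.cast_prod, Real.finsetProd_rpow _ _ fun i _ => Nat.cast_nonneg i]
    _ = (N : ℝ) ^ (-σ) * ∏ p ∈ P, (1 + ‖w‖ * (p : ℝ) ^ (σ - 1)) := by
        rw [← mul_sum, prod_one_add]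
    _ ≤ _ := by
        rw [mul_sum, Real.exp_sum]
        refine mul_le_mul_of_nonneg_left (prod_le_prod (fun i _ => by positivity) fun i _ => ?_)
          (by positivity)
        rw [add_comm]
        exact Real.add_one_le_exp _

end ErdosKac

namespace ErdosKac

open Filter Finset Topology

/-- The normal order `log log N`. -/
noncomputable def logLog (N : ℕ) : ℝ := Real.log (Real.log N)

/-- The truncation level `N ^ (1 / log log N)`. -/
noncomputable def level (N : ℕ) : ℕ := ⌊Real.exp (Real.log N / logLog N)⌋₊

lemma tendsto_logLog : Tendsto logLog atTop atTop :=
  Real.tendsto_log_atTop.comp (Real.tendsto_log_atTop.comp tendsto_natCast_atTop_atTop)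

lemma tendsto_sqrt_logLog : Tendsto (fun N => √(logLog N)) atTop atTop :=
  Real.tendsto_sqrt_atTop.comp tendsto_logLog

lemma exp_logLog {N : ℕ} (hN : 2 ≤ N) : Real.exp (logLog N) = Real.log N :=
  Real.exp_log (Real.log_pos (by exact_mod_cast hN))

lemma tendsto_log_div_logLog : Tendsto (fun N : ℕ => Real.log N / logLog N) atTop atTop := by
  have h := (Real.tendsto_exp_div_pow_atTop 1).comp tendsto_logLog
  refine h.congr' ?_
  filter_upwards [eventually_ge_atTop 2] with N hN
  simp [exp_logLog hN]

lemma abs_primeRecipSum_level_sub_le :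
    ∃ C : ℝ, ∀ᶠ N in atTop,
      |primeRecipSum (level N) - logLog N| ≤ C + Real.log (logLog N) := by
  obtain ⟨C, hC⟩ := abs_primeRecipSum_sub_log_log_le
  refine ⟨C + Real.log 2, ?_⟩
  filter_upwards [eventually_ge_atTop 2, tendsto_logLog.eventually_ge_atTop 1,
    tendsto_log_div_logLog.eventually_ge_atTop 2] with N hN hL hy
  set u := Real.log N / logLog N with hu
  have hy3 : (3 : ℝ) ≤ Real.exp u := by linarith [Real.add_one_le_exp u]
  have hM1 : (level N : ℝ) ≤ Real.exp u := Nat.floor_le (Real.exp_pos _).le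
  have hM2 : Real.exp u < level N + 1 := Nat.lt_floor_add_one _
  have hM3 : 2 ≤ level N := Nat.le_floor (by push_cast; linarith)
  have hM0 : (0 : ℝ) < level N := by positivity
  have hl1 : Real.log (level N) ≤ u := by
    rw [← Real.log_exp u]; exact Real.log_le_log hM0 hM1
  have hlog2 : Real.log 2 ≤ 1 := by linarith [Real.log_two_lt_d9]
  have hl2 : u / 2 ≤ Real.log (level N) := by
    have : Real.log (Real.exp u / 2) ≤ Real.log (level N) :=
      Real.log_le_log (by positivity) (by linarith)
    rw [Real.log_div (Real.exp_ne_zero _) (by norm_num), Real.log_exp] at this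
    linarith
  have hl0 : 0 < Real.log (level N) := by linarith
  have hlu : Real.log u = logLog N - Real.log (logLog N) := by
    rw [hu, Real.log_div (Real.log_pos (by exact_mod_cast hN)).ne' (by linarith)]
    rfl
  have hk1 : Real.log (Real.log (level N)) ≤ Real.log u := Real.log_le_log hl0 hl1
  have hk2 : Real.log u - Real.log 2 ≤ Real.log (Real.log (level N)) := by
    rw [← Real.log_div (by linarith) (by norm_num)]
    exact Real.log_le_log (by linarith) hl2
  have hLL : 0 ≤ Real.log (logLog N) := Real.log_nonneg hL
  have hln2 : 0 ≤ Real.log 2 := Real.log_nonneg (by norm_num)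
  have := abs_le.1 (hC _ hM3)
  rw [abs_le]
  constructor <;> linarith [this.1, this.2]

lemma tendsto_const_add_log_div_sqrt (C : ℝ) :
    Tendsto (fun N => (C + Real.log (logLog N)) / √(logLog N)) atTop (𝓝 0) := by
  have h1 : Tendsto (fun x : ℝ => (C + Real.log x) / √x) atTop (𝓝 0) := by
    have h := (isLittleO_log_rpow_atTop (r := 1 / 2) (by norm_num)).tendsto_div_nhds_zero
    have h2 : Tendsto (fun x : ℝ => C / √x) atTop (𝓝 0) :=
      tendsto_const_nhds.div_atTop Real.tendsto_sqrt_atTop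
    have := h2.add h
    rw [add_zero] at this
    refine this.congr fun x => ?_
    rw [add_div, Real.sqrt_eq_rpow]
  exact h1.comp tendsto_logLog

lemma tendsto_primeRecipSum_level :
    Tendsto (fun N => (primeRecipSum (level N) - logLog N) / √(logLog N)) atTop (𝓝 0) := by
  obtain ⟨C, hC⟩ := abs_primeRecipSum_level_sub_le
  refine squeeze_zero_norm' ?_ (tendsto_const_add_log_div_sqrt C)
  filter_upwards [hC] with N hN
  rw [Real.norm_eq_abs, abs_div, abs_of_nonneg (Real.sqrt_nonneg _)]
  gcongr

lemma tendsto_primeRecipSum_sub_level :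
    Tendsto (fun N => (primeRecipSum N - primeRecipSum (level N)) / √(logLog N))
      atTop (𝓝 0) := by
  obtain ⟨C, hC⟩ := abs_primeRecipSum_sub_log_log_le
  have h : Tendsto (fun N => C / √(logLog N)) atTop (𝓝 0) :=
    tendsto_const_nhds.div_atTop tendsto_sqrt_logLog
  have h2 : Tendsto (fun N => (primeRecipSum N - logLog N) / √(logLog N)) atTop (𝓝 0) := by
    refine squeeze_zero_norm' ?_ h
    filter_upwards [eventually_ge_atTop 2] with N hN
    rw [Real.norm_eq_abs, abs_div, abs_of_nonneg (Real.sqrt_nonneg _)]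
    have := hC N hN
    gcongr
    exact this
  have := h2.sub tendsto_primeRecipSum_level
  rw [sub_zero] at this
  refine this.congr fun N => ?_
  rw [← sub_div]
  ring

lemma tendsto_primeRecipSum_level_div :
    Tendsto (fun N => primeRecipSum (level N) / logLog N) atTop (𝓝 1) := by
  have h := (tendsto_primeRecipSum_level.mul
    (tendsto_inv_atTop_zero.comp tendsto_sqrt_logLog)).add_const 1
  rw [zero_mul, zero_add] at h
  refine h.congr' ?_
  filter_upwards [tendsto_logLog.eventually_gt_atTop 0] with N hN
  have h1 := Real.mul_self_sqrt hN.le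
  have h2 : √(logLog N) ≠ 0 := (Real.sqrt_pos.2 hN).ne'
  have h3 := hN.ne'
  simp only [Function.comp_apply]
  rw [← div_eq_mul_inv, div_div, h1]
  field_simp
  ring

/-- The rescaled frequency at level `N`. -/
noncomputable def freq (t : ℝ) (N : ℕ) : ℝ := t / √(logLog N)

lemma tendsto_freq (t : ℝ) : Tendsto (freq t) atTop (𝓝 0) :=
  tendsto_const_nhds.div_atTop tendsto_sqrt_logLog

/-- The increment `exp (i τ) - 1`. -/
noncomputable def incr (t : ℝ) (N : ℕ) : ℂ := Complex.exp (Complex.I * freq t N) - 1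

lemma norm_incr_le (t : ℝ) (N : ℕ) : ‖incr t N‖ ≤ |freq t N| :=
  Real.norm_exp_I_mul_ofReal_sub_one_le

lemma freq_sq_mul {t : ℝ} {N : ℕ} (hN : 0 < logLog N) :
    freq t N ^ 2 * primeRecipSum (level N) = t ^ 2 * (primeRecipSum (level N) / logLog N) := by
  rw [freq, div_pow, Real.sq_sqrt hN.le]
  ring

lemma primeRecipSum_nonneg (N : ℕ) : 0 ≤ primeRecipSum N := by
  unfold primeRecipSum; positivity

lemma tendsto_incr_mul_sub (t : ℝ) :
    Tendsto (fun N => incr t N * primeRecipSum (level N) - Complex.I * freq t N * logLog N)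
      atTop (𝓝 (-t ^ 2 / 2 : ℝ)) := by
  have hsq : Tendsto (fun N => freq t N ^ 2 * primeRecipSum (level N)) atTop (𝓝 (t ^ 2)) := by
    have := tendsto_primeRecipSum_level_div.const_mul (t ^ 2)
    rw [mul_one] at this
    refine this.congr' ?_
    filter_upwards [tendsto_logLog.eventually_gt_atTop 0] with N hN
    rw [freq_sq_mul hN]
  have hrem : Tendsto (fun N => (incr t N - Complex.I * freq t N + freq t N ^ 2 / 2)
      * (primeRecipSum (level N) : ℂ)) atTop (𝓝 0) := by
    have hb : Tendsto (fun N => |freq t N| * Real.exp |freq t N|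
        * (freq t N ^ 2 * primeRecipSum (level N))) atTop (𝓝 0) := by
      have h1 := (tendsto_freq t).abs
      have := (h1.mul ((Real.continuous_exp.tendsto _).comp h1)).mul hsq
      simpa using this
    refine squeeze_zero_norm (fun N => ?_) hb
    have h := Complex.norm_exp_sub_sum_le_norm_mul_exp (Complex.I * freq t N) 3
    have e : Complex.exp (Complex.I * freq t N)
        - ∑ m ∈ range 3, (Complex.I * freq t N) ^ m / (m.factorial : ℂ)
        = incr t N - Complex.I * freq t N + freq t N ^ 2 / 2 := by
      simp only [sum_range_succ, range_zero, sum_empty, incr, Nat.factorial, mul_pow,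
        Complex.I_sq]
      push_cast
      ring
    rw [e, norm_mul, Complex.norm_I, one_mul, Complex.norm_real, Real.norm_eq_abs] at h
    rw [norm_mul, Complex.norm_real, Real.norm_of_nonneg (primeRecipSum_nonneg _)]
    calc _ ≤ |freq t N| ^ 3 * Real.exp |freq t N| * primeRecipSum (level N) :=
          mul_le_mul_of_nonneg_right h (primeRecipSum_nonneg _)
      _ = _ := by
          rw [← sq_abs]
          ring
  have hlin : Tendsto (fun N => Complex.I *
      ((t * ((primeRecipSum (level N) - logLog N) / √(logLog N)) : ℝ) : ℂ)) atTop (𝓝 0) := by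
    have := (Complex.continuous_ofReal.tendsto _).comp
      (tendsto_primeRecipSum_level.const_mul t)
    simpa using this.const_mul Complex.I
  have hsq' : Tendsto (fun N => ((-(freq t N ^ 2 * primeRecipSum (level N)) / 2 : ℝ) : ℂ)) atTop
      (𝓝 ((-t ^ 2 / 2 : ℝ) : ℂ)) :=
    (Complex.continuous_ofReal.tendsto _).comp (hsq.neg.div_const 2)
  have := (hrem.add hlin).add hsq'
  rw [zero_add, zero_add] at this
  refine this.congr fun N => ?_
  simp only [freq]
  push_cast
  ring

lemma tendsto_prod_mul_exp (t : ℝ) :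
    Tendsto (fun N => (∏ p ∈ Nat.primesLE (level N), (1 + incr t N / p))
      * Complex.exp (-(Complex.I * freq t N * logLog N))) atTop
      (𝓝 (Complex.exp (-t ^ 2 / 2 : ℝ))) := by
  have hK : Summable fun n : ℕ => (1 / (n : ℝ) ^ 2) :=
    Real.summable_one_div_nat_pow.2 (by norm_num)
  set K := ∑' n : ℕ, (1 / (n : ℝ) ^ 2)
  have hw0 : Tendsto (fun N => ‖incr t N‖) atTop (𝓝 0) :=
    squeeze_zero (fun _ => norm_nonneg _) (norm_incr_le t) (by simpa using (tendsto_freq t).abs)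
  set G : ℕ → ℂ := fun N => ∑ p ∈ Nat.primesLE (level N), Complex.log (1 + incr t N / p)
  have hsmall : ∀ᶠ N in atTop, ‖incr t N‖ ≤ 1 := hw0.eventually_le_const one_pos
  have hnorm : ∀ N, ‖incr t N‖ ≤ 1 → ∀ p ∈ Nat.primesLE (level N),
      ‖incr t N / (p : ℂ)‖ = ‖incr t N‖ / p ∧ ‖incr t N‖ / p ≤ 1 / 2 := by
    intro N hN p hp
    have h2 : (2 : ℝ) ≤ p := by exact_mod_cast (Nat.prime_of_mem_primesLE hp).two_le
    refine ⟨by simp, ?_⟩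
    exact div_le_div₀ zero_le_one hN (by norm_num) h2
  have hG : Tendsto (fun N => G N - incr t N * primeRecipSum (level N)) atTop (𝓝 0) := by
    have hb : Tendsto (fun N => ‖incr t N‖ ^ 2 * K) atTop (𝓝 0) := by
      simpa using (hw0.pow 2).mul_const K
    refine squeeze_zero_norm' ?_ hb
    filter_upwards [hsmall] with N hN
    have e : G N - incr t N * primeRecipSum (level N)
        = ∑ p ∈ Nat.primesLE (level N), (Complex.log (1 + incr t N / p) - incr t N / p) := by
      rw [sum_sub_distrib, primeRecipSum]
      push_cast
      rw [mul_sum]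
      simp only [mul_one_div]
      rfl
    rw [e]
    calc _ ≤ ∑ p ∈ Nat.primesLE (level N), ‖Complex.log (1 + incr t N / p) - incr t N / p‖ :=
          norm_sum_le _ _
      _ ≤ ∑ p ∈ Nat.primesLE (level N), ‖incr t N‖ ^ 2 * (1 / (p : ℝ) ^ 2) := by
          refine sum_le_sum fun p hp => ?_
          obtain ⟨h1, h2⟩ := hnorm N hN p hp
          have h3 := Complex.norm_log_one_add_sub_self_le (z := incr t N / p)
            (by rw [h1]; linarith)
          refine h3.trans ?_
          rw [h1, div_pow, mul_div_assoc, ← mul_one_div]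
          refine mul_le_of_le_one_right (by positivity) ?_
          have h4 : (1 - ‖incr t N‖ / p)⁻¹ ≤ 2 := by
            rw [inv_le_comm₀ (by linarith) (by norm_num)]
            linarith
          linarith
      _ ≤ _ := by
          rw [← mul_sum]
          exact mul_le_mul_of_nonneg_left (hK.sum_le_tsum _ fun i _ => by positivity)
            (by positivity)
  have hsum := hG.add (tendsto_incr_mul_sub t)
  rw [zero_add] at hsum
  refine ((Complex.continuous_exp.tendsto _).comp hsum).congr' ?_
  filter_upwards [hsmall] with N hN
  have hprod : ∏ p ∈ Nat.primesLE (level N), (1 + incr t N / p) = Complex.exp (G N) := by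
    rw [Complex.exp_sum]
    refine prod_congr rfl fun p hp => (Complex.exp_log ?_).symm
    obtain ⟨h1, h2⟩ := hnorm N hN p hp
    intro h0
    have : incr t N / (p : ℂ) = -1 := by linear_combination h0
    rw [this] at h1
    simp at h1
    linarith
  rw [hprod, ← Complex.exp_add]
  simp only [Function.comp_apply]
  congr 1
  ring

lemma tendsto_rankin_error (t : ℝ) :
    Tendsto (fun N : ℕ => (N : ℝ) ^ (-(logLog N / Real.log N)) * Real.exp (‖incr t N‖ *
      ∑ p ∈ Nat.primesLE (level N), (p : ℝ) ^ (logLog N / Real.log N - 1))) atTop (𝓝 0) := by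
  have hexp : Tendsto (fun N => √(logLog N) * (|t| * Real.exp 1 *
      (primeRecipSum (level N) / logLog N) - √(logLog N))) atTop atBot := by
    refine tendsto_sqrt_logLog.atTop_mul_atBot₀ ?_
    have h := tendsto_primeRecipSum_level_div.const_mul (|t| * Real.exp 1)
    exact h.add_atBot (tendsto_neg_atTop_atBot.comp tendsto_sqrt_logLog)
  refine squeeze_zero' (.of_forall fun N => by positivity) ?_
    (Real.tendsto_exp_atBot.comp hexp)
  filter_upwards [eventually_ge_atTop 2, tendsto_logLog.eventually_gt_atTop 0] with N hN hL
  have hlog : 0 < Real.log N := Real.log_pos (by exact_mod_cast hN)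
  have hN0 : (0 : ℝ) < N := by positivity
  have e1 : (N : ℝ) ^ (-(logLog N / Real.log N)) = Real.exp (-logLog N) := by
    rw [Real.rpow_def_of_pos hN0]
    congr 1
    field_simp
  have e2 : ∑ p ∈ Nat.primesLE (level N), (p : ℝ) ^ (logLog N / Real.log N - 1)
      ≤ Real.exp 1 * primeRecipSum (level N) := by
    rw [primeRecipSum, mul_sum]
    refine sum_le_sum fun p hp => ?_
    have hp0 : (0 : ℝ) < p := by exact_mod_cast (Nat.prime_of_mem_primesLE hp).pos
    rw [Real.rpow_sub_one hp0.ne', ← mul_one_div, Real.rpow_def_of_pos hp0]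
    refine mul_le_mul_of_nonneg_right (Real.exp_le_exp.2 ?_) (by positivity)
    have h3 : (p : ℝ) ≤ Real.exp (Real.log N / logLog N) :=
      (Nat.cast_le.2 (Nat.le_of_mem_primesLE hp)).trans (Nat.floor_le (Real.exp_pos _).le)
    have h4 : Real.log p ≤ Real.log N / logLog N := by
      rw [← Real.log_exp (Real.log N / logLog N)]
      exact Real.log_le_log hp0 h3
    calc Real.log p * (logLog N / Real.log N)
        ≤ (Real.log N / logLog N) * (logLog N / Real.log N) := by gcongr
      _ = 1 := by field_simp
  rw [e1, ← Real.exp_add]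
  refine Real.exp_le_exp.2 ?_
  have hs0 : 0 < √(logLog N) := Real.sqrt_pos.2 hL
  have hw : ‖incr t N‖ ≤ |t| / √(logLog N) := by
    refine (norm_incr_le t N).trans (le_of_eq ?_)
    rw [freq, abs_div, abs_of_pos hs0]
  have h5 : ‖incr t N‖ * ∑ p ∈ Nat.primesLE (level N), (p : ℝ) ^ (logLog N / Real.log N - 1)
      ≤ |t| / √(logLog N) * (Real.exp 1 * primeRecipSum (level N)) :=
    mul_le_mul hw e2 (sum_nonneg fun _ _ => by positivity) (by positivity)
  have h6 : √(logLog N) * (|t| * Real.exp 1 * (primeRecipSum (level N) / logLog N)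
      - √(logLog N)) = -logLog N + |t| / √(logLog N) * (Real.exp 1 * primeRecipSum (level N)) := by
    have h7 := Real.mul_self_sqrt hL.le
    have h8 : √(logLog N) / logLog N = 1 / √(logLog N) := by
      rw [div_eq_div_iff hL.ne' hs0.ne', h7, one_mul]
    calc _ = |t| * Real.exp 1 * primeRecipSum (level N) * (√(logLog N) / logLog N)
          - √(logLog N) * √(logLog N) := by ring
      _ = _ := by rw [h7, h8]; ring
  beta_reduce
  rw [h6]
  linarith

/-- The number of prime divisors of `n` up to the truncation level of `N`. -/
noncomputable def truncOmega (N n : ℕ) : ℕ := #{p ∈ Nat.primesLE (level N) | p ∣ n}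

lemma tendsto_mean_exp (t : ℝ) :
    Tendsto (fun N : ℕ => (∑ n ∈ Icc 1 N, Complex.exp (Complex.I *
      ((t * ((truncOmega N n - logLog N) / √(logLog N)) : ℝ) : ℂ))) / N) atTop
      (𝓝 (Complex.exp (-t ^ 2 / 2 : ℝ))) := by
  have hdiff : Tendsto (fun N : ℕ =>
      ((∑ n ∈ Icc 1 N, ∏ p ∈ Nat.primesLE (level N), (1 + if p ∣ n then incr t N else 0)) / N
        - ∏ p ∈ Nat.primesLE (level N), (1 + incr t N / p))
      * Complex.exp (-(Complex.I * freq t N * logLog N))) atTop (𝓝 0) := by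
    refine squeeze_zero_norm' ?_ (tendsto_rankin_error t)
    filter_upwards [eventually_ge_atTop 2, tendsto_logLog.eventually_gt_atTop 0] with N hN hL
    have hlog : 0 < Real.log N := Real.log_pos (by exact_mod_cast hN)
    have hph : ‖Complex.exp (-(Complex.I * freq t N * logLog N))‖ = 1 := by
      rw [show -(Complex.I * freq t N * logLog N)
        = ((-(freq t N * logLog N) : ℝ) : ℂ) * Complex.I by push_cast; ring]
      exact Complex.norm_exp_ofReal_mul_I _
    rw [norm_mul, hph, mul_one]
    refine norm_mean_sub_prod_le (fun p hp => Nat.prime_of_mem_primesLE hp) _ (by positivity) ?_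
      (by omega)
    rw [div_le_one hlog, logLog]
    linarith [Real.log_le_sub_one_of_pos hlog]
  have h := hdiff.add (tendsto_prod_mul_exp t)
  rw [zero_add] at h
  refine h.congr fun N => ?_
  rw [← add_mul, sub_add_cancel, div_mul_eq_mul_div, sum_mul]
  congr 1
  refine sum_congr rfl fun n _ => ?_
  have e1 : ∏ p ∈ Nat.primesLE (level N), (1 + if p ∣ n then incr t N else 0)
      = Complex.exp (Complex.I * freq t N) ^ truncOmega N n := by
    rw [truncOmega, ← prod_const, prod_filter]
    refine prod_congr rfl fun p _ => ?_
    split_ifs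
    · rw [incr]; ring
    · ring
  rw [e1, ← Complex.exp_nat_mul, ← Complex.exp_add]
  congr 1
  simp only [freq]
  push_cast
  ring

end ErdosKac

namespace ErdosKac

open Filter Finset Topology MeasureTheory ProbabilityTheory

lemma gaussianReal_Iic (z : ℝ) : (gaussianReal 0 1 (Set.Iic z)).toReal = Phi z := by
  rw [gaussianReal_apply_eq_integral 0 one_ne_zero,
    ENNReal.toReal_ofReal (integral_nonneg fun x => gaussianPDFReal_nonneg _ _ _), Phi,
    ← integral_const_mul]
  refine integral_congr_ae (.of_forall fun x => ?_)
  simp [gaussianPDFReal]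

/-- The law of `W` under the uniform distribution on `{1, …, N}`. -/
noncomputable def empiricalLaw (W : ℕ → ℝ) (N : ℕ) : Measure ℝ :=
  ∑ n ∈ Icc 1 N, (N : ENNReal)⁻¹ • Measure.dirac (W n)

lemma empiricalLaw_apply (W : ℕ → ℝ) (N : ℕ) {s : Set ℝ} (hs : MeasurableSet s) :
    empiricalLaw W N s = #{n ∈ Icc 1 N | W n ∈ s} * (N : ENNReal)⁻¹ := by
  rw [empiricalLaw, Measure.finsetSum_apply]
  simp only [Measure.smul_apply, Measure.dirac_apply' _ hs, smul_eq_mul, Set.indicator_apply,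
    Pi.one_apply, mul_ite, mul_one, mul_zero]
  rw [← sum_filter, sum_const, nsmul_eq_mul]

lemma isProbabilityMeasure_empiricalLaw (W : ℕ → ℝ) {N : ℕ} (hN : N ≠ 0) :
    IsProbabilityMeasure (empiricalLaw W N) := by
  constructor
  rw [empiricalLaw_apply W N MeasurableSet.univ]
  simp only [Set.mem_univ, filter_true, Nat.card_Icc, Nat.add_sub_cancel]
  exact ENNReal.mul_inv_cancel (by exact_mod_cast hN) (ENNReal.natCast_ne_top N)

lemma charFun_empiricalLaw (W : ℕ → ℝ) (N : ℕ) (t : ℝ) :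
    charFun (empiricalLaw W N) t
      = (∑ n ∈ Icc 1 N, Complex.exp (Complex.I * ((t * W n : ℝ) : ℂ))) / N := by
  rcases Nat.eq_zero_or_pos N with rfl | hN
  · simp [empiricalLaw]
  have hint : ∀ n ∈ Icc 1 N, Integrable (fun x : ℝ => Complex.exp (t * x * Complex.I))
      ((N : ENNReal)⁻¹ • Measure.dirac (W n)) := fun n _ =>
    (integrable_dirac (by simp)).smul_measure
      (ENNReal.inv_ne_top.2 (by exact_mod_cast hN.ne'))
  rw [charFun_apply_real, empiricalLaw, integral_finsetSum_measure hint, sum_div]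
  refine sum_congr rfl fun n _ => ?_
  rw [integral_smul_measure, integral_dirac, ENNReal.toReal_inv, ENNReal.toReal_natCast,
    Complex.real_smul, div_eq_inv_mul]
  push_cast
  congr 2
  ring

/-- Lévy's continuity theorem for empirical laws with a standard Gaussian limit. -/
lemma tendsto_card_le_of_tendsto_mean_exp {W : ℕ → ℕ → ℝ}
    (h : ∀ t : ℝ, Tendsto (fun N : ℕ =>
      (∑ n ∈ Icc 1 N, Complex.exp (Complex.I * ((t * W N n : ℝ) : ℂ))) / N) atTop
      (𝓝 (Complex.exp (-t ^ 2 / 2 : ℝ)))) (z : ℝ) :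
    Tendsto (fun N : ℕ => (#{n ∈ Icc 1 N | W N n ≤ z} : ℝ) / N) atTop (𝓝 (Phi z)) := by
  have hp (N : ℕ) : IsProbabilityMeasure (empiricalLaw (W (N + 1)) (N + 1)) :=
    isProbabilityMeasure_empiricalLaw _ N.succ_ne_zero
  let μ : ℕ → ProbabilityMeasure ℝ := fun N => ⟨empiricalLaw (W (N + 1)) (N + 1), hp N⟩
  let γ : ProbabilityMeasure ℝ := ⟨gaussianReal 0 1, inferInstance⟩
  have hμ : Tendsto μ atTop (𝓝 γ) := by
    refine ProbabilityMeasure.tendsto_iff_tendsto_charFun.2 fun t => ?_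
    have ht := (tendsto_add_atTop_iff_nat 1).2 (h t)
    have hγ : charFun (γ : Measure ℝ) t = Complex.exp (-t ^ 2 / 2 : ℝ) := by
      change charFun (gaussianReal 0 1) t = _
      rw [charFun_gaussianReal]
      congr 1
      push_cast
      ring
    rw [hγ]
    refine ht.congr fun N => ?_
    exact (charFun_empiricalLaw _ _ t).symm
  have hz : γ (frontier (Set.Iic z)) = 0 := by
    have := nullSingletonClass_gaussianReal (μ := 0) (v := 1) one_ne_zero
    rw [frontier_Iic]
    change (gaussianReal 0 1 {z}).toNNReal = 0
    rw [measure_singleton, ENNReal.toNNReal_zero]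
  have hlim := ProbabilityMeasure.tendsto_measure_of_null_frontier_of_tendsto hμ hz
  have hlim' := (NNReal.continuous_coe.tendsto _).comp hlim
  refine (tendsto_add_atTop_iff_nat 1).1 ?_
  have hγz : ((γ (Set.Iic z) : NNReal) : ℝ) = Phi z := gaussianReal_Iic z
  rw [hγz] at hlim'
  refine hlim'.congr fun N => ?_
  change (empiricalLaw (W (N + 1)) (N + 1) (Set.Iic z)).toReal = _
  rw [empiricalLaw_apply _ _ measurableSet_Iic]
  rw [ENNReal.toReal_mul, ENNReal.toReal_inv, ENNReal.toReal_natCast, ENNReal.toReal_natCast,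
    div_eq_mul_inv]
  rfl

lemma tendsto_card_truncOmega_le (z : ℝ) :
    Tendsto (fun N : ℕ =>
      (#{n ∈ Icc 1 N | (truncOmega N n - logLog N) / √(logLog N) ≤ z} : ℝ) / N)
      atTop (𝓝 (Phi z)) :=
  tendsto_card_le_of_tendsto_mean_exp tendsto_mean_exp z

lemma continuous_Phi : Continuous Phi := by
  have hint : Integrable (fun t : ℝ => Real.exp (-t ^ 2 / 2)) := by
    have := integrable_exp_neg_mul_sq (b := 1 / 2) (by norm_num)
    refine this.congr (.of_forall fun x => ?_)
    simp only
    congr 1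
    ring
  unfold Phi
  refine Continuous.mul continuous_const ?_
  have h (z : ℝ) : ∫ t in Set.Iic z, Real.exp (-t ^ 2 / 2)
      = (∫ t in Set.Iic 0, Real.exp (-t ^ 2 / 2)) + ∫ t in (0 : ℝ)..z, Real.exp (-t ^ 2 / 2) := by
    have := intervalIntegral.integral_Iic_sub_Iic (a := 0) (b := z)
      hint.integrableOn hint.integrableOn
    linarith
  rw [funext h]
  exact continuous_const.add (intervalIntegral.continuous_primitive
    (fun _ _ => hint.intervalIntegrable) 0)

end ErdosKac

namespace ErdosKac

open Filter Finset Topology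

lemma div_eq_inv_add_inv_iff {a n x y : ℕ} (hn : 0 < n) (hx : 0 < x) (hy : 0 < y) :
    (a : ℚ) / n = 1 / x + 1 / y ↔ a * x * y = n * (x + y) := by
  have hn' : (n : ℚ) ≠ 0 := by positivity
  have hx' : (x : ℚ) ≠ 0 := by positivity
  have hy' : (y : ℚ) ≠ 0 := by positivity
  rw [← @Nat.cast_inj ℚ]
  push_cast
  rw [div_add_div _ _ hx' hy', div_eq_div_iff hn' (mul_ne_zero hx' hy')]
  constructor <;> intro h <;> linarith

lemma R_eq_ncard {n : ℕ} (hn : 0 < n) (a : ℕ) :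
    R n a = {p : ℕ × ℕ | 0 < p.1 ∧ 0 < p.2 ∧ a * p.1 * p.2 = n * (p.1 + p.2)}.ncard := by
  rw [R, Nat.card_coe_set_eq]
  congr 1
  ext p
  simp only [Set.mem_ofPred_eq]
  constructor
  · rintro ⟨h1, h2, h3⟩
    exact ⟨h1, h2, (div_eq_inv_add_inv_iff hn h1 h2).1 h3⟩
  · rintro ⟨h1, h2, h3⟩
    exact ⟨h1, h2, (div_eq_inv_add_inv_iff hn h1 h2).2 h3⟩

lemma lt_mul_of_mul_mul_eq {a n x y : ℕ} (hn : 0 < n) (hx : 0 < x)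
    (h : a * x * y = n * (x + y)) : n < a * x := by
  refine lt_of_mul_lt_mul_right (a := y) ?_ (Nat.zero_le y)
  rw [h, mul_add]
  have := Nat.mul_pos hn hx
  omega

lemma mapsTo_injOn_solutions {n : ℕ} (hn : 0 < n) (a : ℕ) :
    Set.MapsTo (fun p : ℕ × ℕ => a * p.1 - n)
      {p : ℕ × ℕ | 0 < p.1 ∧ 0 < p.2 ∧ a * p.1 * p.2 = n * (p.1 + p.2)}
      ((n ^ 2).divisors : Set ℕ) ∧
    Set.InjOn (fun p : ℕ × ℕ => a * p.1 - n)
      {p : ℕ × ℕ | 0 < p.1 ∧ 0 < p.2 ∧ a * p.1 * p.2 = n * (p.1 + p.2)} := by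
  constructor
  · rintro ⟨x, y⟩ ⟨hx, hy, h⟩
    simp only at hx hy h
    have h1 := lt_mul_of_mul_mul_eq hn hx h
    have h2 : n < a * y := lt_mul_of_mul_mul_eq (y := x) hn hy (by linarith)
    simp only [mem_coe, Nat.mem_divisors]
    refine ⟨⟨a * y - n, ?_⟩, by positivity⟩
    zify [h1.le, h2.le] at h ⊢
    linear_combination (-(a : ℤ)) * h
  · rintro ⟨x, y⟩ ⟨hx, hy, h⟩ ⟨x', y'⟩ ⟨hx', hy', h'⟩ he
    simp only at hx hy h hx' hy' h' he
    have h1 := lt_mul_of_mul_mul_eq hn hx h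
    have h2 := lt_mul_of_mul_mul_eq hn hx' h'
    have ha : 0 < a := Nat.pos_of_mul_pos_right (hn.trans h1)
    have hxx : x = x' := Nat.eq_of_mul_eq_mul_left ha (by omega)
    subst hxx
    have hyy : y = y' := by
      zify at h h' h1 ⊢
      have h3 : ((a : ℤ) * x - n) * (y - y') = 0 := by linear_combination h - h'
      rcases mul_eq_zero.1 h3 with h4 | h4 <;> linarith
    rw [hyy]

lemma solutions_finite {n : ℕ} (hn : 0 < n) (a : ℕ) :
    {p : ℕ × ℕ | 0 < p.1 ∧ 0 < p.2 ∧ a * p.1 * p.2 = n * (p.1 + p.2)}.Finite :=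
  Set.Finite.of_injOn (mapsTo_injOn_solutions hn a).1 (mapsTo_injOn_solutions hn a).2
    (finite_toSet _)

lemma R_le_card_divisors {n : ℕ} (hn : 0 < n) (a : ℕ) : R n a ≤ #(n ^ 2).divisors := by
  rw [R_eq_ncard hn, ← Set.ncard_coe_finset]
  exact Set.ncard_le_ncard_of_injOn _ (mapsTo_injOn_solutions hn a).1
    (mapsTo_injOn_solutions hn a).2 (finite_toSet _)

lemma card_divisors_sq_le {n : ℕ} (hn : 0 < n) :
    #(n ^ 2).divisors ≤ 3 ^ ∑ p ∈ n.primeFactors, n.factorization p := by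
  rw [Nat.card_divisors (by positivity), Nat.primeFactors_pow _ two_ne_zero, ← prod_pow_eq_pow_sum]
  refine prod_le_prod' fun p _ => ?_
  rw [Nat.factorization_pow, Finsupp.smul_apply, smul_eq_mul]
  generalize n.factorization p = k
  induction k with
  | zero => simp
  | succ k ih => rw [pow_succ]; omega

lemma R_le_three_pow {n : ℕ} (hn : 0 < n) (a : ℕ) :
    R n a ≤ 3 ^ ∑ p ∈ n.primeFactors, n.factorization p :=
  (R_le_card_divisors hn a).trans (card_divisors_sq_le hn)

lemma mem_solutions_of_mul_eq_sq {m a e e' : ℕ} (hm : 0 < m) (ha : 0 < a) (hc : m.Coprime a)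
    (he : e * e' = m ^ 2) (hd : a ∣ e + m) :
    ((e + m) / a, (e' + m) / a) ∈
      {p : ℕ × ℕ | 0 < p.1 ∧ 0 < p.2 ∧ a * p.1 * p.2 = m * (p.1 + p.2)} := by
  have hec : e.Coprime a := (hc.pow_left 2).coprime_dvd_left ⟨e', he.symm⟩
  have hd' : a ∣ e' + m := by
    refine hec.symm.dvd_of_dvd_mul_left (m := e) ?_
    have : e * (e' + m) = m * (e + m) := by rw [mul_add, he]; ring
    rw [this]
    exact hd.mul_left m
  obtain ⟨x, hx⟩ := hd
  obtain ⟨y, hy⟩ := hd'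
  rw [hx, hy, Nat.mul_div_cancel_left _ ha, Nat.mul_div_cancel_left _ ha]
  have hx0 : 0 < x := Nat.pos_of_ne_zero fun h => by subst h; omega
  have hy0 : 0 < y := Nat.pos_of_ne_zero fun h => by subst h; omega
  refine ⟨hx0, hy0, ?_⟩
  refine Nat.eq_of_mul_eq_mul_left ha ?_
  simp only
  zify at *
  linear_combination (-(a : ℤ) * y + m) * hx + (-(e : ℤ)) * hy + he

lemma three_pow_le_card_divisors_sq_prod {K : Finset ℕ} (hK : ∀ p ∈ K, p.Prime) :
    3 ^ #K ≤ #((∏ p ∈ K, p) ^ 2).divisors := by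
  have h0 : ∏ p ∈ K, p ≠ 0 := prod_ne_zero_iff.2 fun p hp => (hK p hp).ne_zero
  rw [Nat.card_divisors (pow_ne_zero _ h0), Nat.primeFactors_pow _ two_ne_zero,
    Nat.primeFactors_prod hK, ← prod_const]
  refine prod_le_prod' fun p hp => ?_
  rw [Nat.factorization_pow, Finsupp.smul_apply, smul_eq_mul]
  have := (hK p hp).factorization_pos_of_dvd h0 (dvd_prod_of_mem _ hp)
  omega

lemma three_pow_le_mul_R_of_coprime {m a : ℕ} (hm : 0 < m) (ha : 0 < a) (hc : m.Coprime a)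
    (h : ∀ r : (ZMod a)ˣ, ∃ p : ℕ, p.Prime ∧ p ∣ m ∧ (p : ZMod a) = r) :
    3 ^ #m.primeFactors ≤ 3 ^ a * R m a := by
  have : NeZero a := ⟨ha.ne'⟩
  choose q hqp hqm hqr using h
  set Q := univ.image q with hQ
  have hQcard : #Q ≤ a := by
    refine card_image_le.trans ?_
    rw [card_univ, ZMod.card_units_eq_totient]
    exact Nat.totient_le a
  set K := m.primeFactors \ Q with hK
  have hKp : ∀ p ∈ K, p.Prime := fun p hp => Nat.prime_of_mem_primeFactors (mem_sdiff.1 hp).1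
  have hKcard : #m.primeFactors ≤ a + #K := by
    have := le_card_sdiff Q m.primeFactors
    rw [← hK] at this
    omega
  set k := ∏ p ∈ K, p with hk
  have hkm : k ∣ m := (prod_dvd_prod_of_subset _ _ _ sdiff_subset).trans
    (Nat.prod_primeFactors_dvd m)
  have hqk : ∀ r, ¬ q r ∣ k := by
    intro r hr
    have hmem : q r ∈ k.primeFactors := by
      refine Nat.mem_primeFactors.2 ⟨hqp r, hr, ?_⟩
      rintro h0
      rw [h0, zero_dvd_iff] at hkm
      omega
    rw [hk, Nat.primeFactors_prod hKp, hK] at hmem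
    exact (mem_sdiff.1 hmem).2 (mem_image_of_mem q (mem_univ r))
  have hdc : ∀ d, d ∣ k ^ 2 → d.Coprime a := fun d hd =>
    (hc.pow_left 2).coprime_dvd_left (hd.trans (pow_dvd_pow_of_dvd hkm 2))
  have hcls : ∀ d, d ∣ k ^ 2 → ∃ r, a ∣ d * q r + m := by
    intro d hd
    refine ⟨-(ZMod.unitOfCoprime m hc) * (ZMod.unitOfCoprime d (hdc d hd))⁻¹, ?_⟩
    rw [← ZMod.natCast_eq_zero_iff]
    push_cast
    rw [hqr]
    have e : (d : ZMod a) = (ZMod.unitOfCoprime d (hdc d hd) : ZMod a) := rfl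
    rw [e, Units.val_mul, Units.val_neg, mul_left_comm, Units.mul_inv, ZMod.coe_unitOfCoprime]
    ring
  choose! r hr using hcls
  have hdvd : ∀ d, d ∣ k ^ 2 → d * q (r d) ∣ m ^ 2 := by
    intro d hd
    have h1 : k * q (r d) ∣ m := by
      refine Nat.Coprime.mul_dvd_of_dvd_of_dvd ?_ hkm (hqm _)
      exact ((hqp _).coprime_iff_not_dvd.2 (hqk _)).symm
    refine Dvd.dvd.trans ?_ (pow_dvd_pow_of_dvd h1 2)
    rw [mul_pow]
    exact mul_dvd_mul hd (dvd_pow_self _ two_ne_zero)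
  have hcard : #(k ^ 2).divisors ≤ R m a := by
    rw [R_eq_ncard hm, ← Set.ncard_coe_finset]
    refine Set.ncard_le_ncard_of_injOn
      (fun d => ((d * q (r d) + m) / a, (m ^ 2 / (d * q (r d)) + m) / a)) ?_ ?_
      (solutions_finite hm a)
    · intro d hd
      have hd' := Nat.dvd_of_mem_divisors (mem_coe.1 hd)
      exact mem_solutions_of_mul_eq_sq hm ha hc (Nat.mul_div_cancel' (hdvd d hd')) (hr d hd')
    · intro d₁ hd₁ d₂ hd₂ he
      have h₁ := Nat.dvd_of_mem_divisors (mem_coe.1 hd₁)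
      have h₂ := Nat.dvd_of_mem_divisors (mem_coe.1 hd₂)
      have he1 := congrArg Prod.fst he
      simp only at he1
      have he2 : d₁ * q (r d₁) + m = d₂ * q (r d₂) + m := by
        rw [← Nat.mul_div_cancel' (hr d₁ h₁), he1, Nat.mul_div_cancel' (hr d₂ h₂)]
      have he3 : d₁ * q (r d₁) = d₂ * q (r d₂) := by omega
      have hq : q (r d₁) = q (r d₂) := by
        have h3 : q (r d₁) ∣ d₂ * q (r d₂) := he3 ▸ Dvd.intro_left _ rfl
        rcases (hqp _).dvd_mul.1 h3 with h4 | h4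
        · exact absurd ((hqp _).dvd_of_dvd_pow (h4.trans h₂)) (hqk _)
        · exact (Nat.prime_dvd_prime_iff_eq (hqp _) (hqp _)).1 h4
      rw [hq] at he3
      exact Nat.eq_of_mul_eq_mul_right (hqp _).pos he3
  calc 3 ^ #m.primeFactors ≤ 3 ^ (a + #K) := Nat.pow_le_pow_right (by norm_num) hKcard
    _ = 3 ^ a * 3 ^ #K := pow_add _ _ _
    _ ≤ 3 ^ a * R m a :=
        Nat.mul_le_mul_left _ ((three_pow_le_card_divisors_sq_prod hKp).trans hcard)

/-- `n` has a prime factor, not dividing `a`, in each reduced residue class modulo each divisor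
of `a`. -/
def HasAllClasses (a n : ℕ) : Prop :=
  ∀ b ∈ a.divisors, ∀ r : (ZMod b)ˣ, ∃ p : ℕ, p.Prime ∧ ¬ p ∣ a ∧ p ∣ n ∧ (p : ZMod b) = r

lemma R_mul_mul {g m b : ℕ} (hg : 0 < g) : R (g * m) (g * b) = R m b := by
  have hg' : (g : ℚ) ≠ 0 := by positivity
  unfold R
  push_cast
  rw [mul_div_mul_left _ _ hg']

lemma three_pow_le_mul_R {a n : ℕ} (ha : 0 < a) (hn : 0 < n) (h : HasAllClasses a n) :
    3 ^ #n.primeFactors ≤ 9 ^ a * R n a := by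
  obtain ⟨g, m, b, hg, hc, rfl, rfl⟩ :
      ∃ g m b : ℕ, 0 < g ∧ m.Coprime b ∧ n = g * m ∧ a = g * b := by
    obtain ⟨m, b, hc, h1, h2⟩ := Nat.exists_coprime n a
    exact ⟨n.gcd a, m, b, Nat.gcd_pos_of_pos_left _ hn, hc, by rw [mul_comm, ← h1],
      by rw [mul_comm, ← h2]⟩
  have hm : 0 < m := Nat.pos_of_mul_pos_left hn
  have hb : 0 < b := Nat.pos_of_mul_pos_left ha
  rw [R_mul_mul hg]
  have h1 := three_pow_le_mul_R_of_coprime hm hb hc fun r => by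
    obtain ⟨p, hp, hpa, hpn, hpr⟩ := h b (Nat.mem_divisors.2 ⟨Dvd.intro_left g rfl, ha.ne'⟩) r
    refine ⟨p, hp, ?_, hpr⟩
    rcases hp.dvd_mul.1 hpn with h2 | h2
    · exact absurd (h2.mul_right b) hpa
    · exact h2
  have h2 : #(g * m).primeFactors ≤ g + #m.primeFactors := by
    rw [Nat.primeFactors_mul hg.ne' hm.ne']
    refine (card_union_le _ _).trans (Nat.add_le_add_right ?_ _)
    have : g.primeFactors ⊆ Icc 1 g := fun p hp => mem_Icc.2
      ⟨(Nat.prime_of_mem_primeFactors hp).pos, Nat.le_of_mem_primeFactors hp⟩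
    simpa using card_le_card this
  calc 3 ^ #(g * m).primeFactors ≤ 3 ^ (g + #m.primeFactors) :=
        Nat.pow_le_pow_right (by norm_num) h2
    _ = 3 ^ g * 3 ^ #m.primeFactors := pow_add _ _ _
    _ ≤ 3 ^ g * (3 ^ b * R m b) := Nat.mul_le_mul_left _ h1
    _ = 3 ^ (g + b) * R m b := by rw [pow_add, mul_assoc]
    _ ≤ 9 ^ (g * b) * R m b := by
        refine Nat.mul_le_mul_right _ ?_
        rw [show (9 : ℕ) = 3 ^ 2 by norm_num, ← pow_mul]
        refine Nat.pow_le_pow_right (by norm_num) ?_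
        nlinarith [Nat.le_mul_of_pos_right g hb, Nat.le_mul_of_pos_left b hg]

end ErdosKac

namespace ErdosKac

open Filter Finset Topology

lemma not_summable_primes_residueClass {b : ℕ} [NeZero b] {r : ZMod b} (hr : IsUnit r) :
    ¬ Summable fun n : ℕ => if n.Prime ∧ (n : ZMod b) = r then 1 / (n : ℝ) else 0 := by
  intro hsum
  obtain ⟨C, hC⟩ := ArithmeticFunction.vonMangoldt.LSeries_residueClass_lower_bound hr
  have hnp := ArithmeticFunction.vonMangoldt.summable_residueClass_non_primes_div r
  set res := ArithmeticFunction.vonMangoldt.residueClass r with hres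
  have hres0 : ∀ n, 0 ≤ res n := ArithmeticFunction.vonMangoldt.residueClass_nonneg r
  set g : ℕ → ℝ := fun n => if n.Prime ∧ (n : ZMod b) = r then 1 / (n : ℝ) else 0 with hg
  set A : ℝ → ℕ → ℝ := fun x n => (if n.Prime then res n else 0) / (n : ℝ) ^ x with hA
  set B : ℝ → ℕ → ℝ := fun x n => (if n.Prime then 0 else res n) / (n : ℝ) ^ x with hB
  have hAeq : ∀ x : ℝ, ∀ n : ℕ, (x - 1) * A x n = g n *
      ((x - 1) * Real.log n * Real.exp (-((x - 1) * Real.log n))) := by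
    intro x n
    simp only [hA, hg, hres, ArithmeticFunction.vonMangoldt.residueClass]
    by_cases hp : n.Prime
    · have hn0 : (0 : ℝ) < n := by exact_mod_cast hp.pos
      by_cases hc : (n : ZMod b) = r
      · rw [if_pos hp, if_pos ⟨hp, hc⟩, Set.indicator_of_mem (by exact hc),
          ArithmeticFunction.vonMangoldt_apply_prime hp]
        have : (n : ℝ) ^ x = n * Real.exp ((x - 1) * Real.log n) := by
          rw [show x = 1 + (x - 1) by ring, Real.rpow_add hn0, Real.rpow_one,
            Real.rpow_def_of_pos hn0]
          congr 2
          ring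
        rw [this, Real.exp_neg]
        field_simp
      · rw [if_pos hp, if_neg (fun h => hc h.2), Set.indicator_of_notMem (by exact hc)]
        simp
    · simp [hp]
  have hg0 : ∀ n, 0 ≤ g n := by
    intro n
    simp only [hg]
    positivity
  have hue : ∀ u : ℝ, u * Real.exp (-u) ≤ 1 := fun u => by
    rw [Real.exp_neg, ← div_eq_mul_inv, div_le_one (Real.exp_pos u)]
    linarith [Real.add_one_le_exp u]
  have hAnn : ∀ x n, 0 ≤ A x n := by
    intro x n
    have := hres0 n
    simp only [hA]
    positivity
  have hAle : ∀ x : ℝ, ∀ n : ℕ, (x - 1) * A x n ≤ g n := by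
    intro x n
    rw [hAeq]
    exact mul_le_of_le_one_right (hg0 n) (hue _)
  have hAsum : ∀ x : ℝ, 1 < x → Summable fun n => (x - 1) * A x n := fun x hx =>
    Summable.of_nonneg_of_le (fun n => mul_nonneg (by linarith) (hAnn x n)) (hAle x) hsum
  have hBle : ∀ x : ℝ, 1 < x → ∀ n : ℕ, B x n ≤ (if n.Prime then 0 else res n) / n := by
    intro x hx n
    have h0 := hres0 n
    rcases Nat.eq_zero_or_pos n with rfl | hn
    · simp only [hB]
      rw [Nat.cast_zero, Real.zero_rpow (by linarith)]
    have h1 : (1 : ℝ) ≤ n := by exact_mod_cast hn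
    have h2 : (n : ℝ) ≤ (n : ℝ) ^ x := by
      conv_lhs => rw [← Real.rpow_one n]
      exact Real.rpow_le_rpow_of_exponent_le h1 hx.le
    simp only [hB]
    have h3 : 0 ≤ if n.Prime then 0 else res n := by positivity
    gcongr
  have hBnn : ∀ x n, 0 ≤ B x n := by
    intro x n
    have := hres0 n
    simp only [hB]
    positivity
  have hBsum : ∀ x : ℝ, 1 < x → Summable (B x) := fun x hx =>
    Summable.of_nonneg_of_le (hBnn x) (hBle x hx) hnp
  set K := ∑' n : ℕ, (if n.Prime then 0 else res n) / (n : ℝ)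
  have hlow : ∀ x ∈ Set.Ioc (1 : ℝ) 2,
      (b.totient : ℝ)⁻¹ - (C + K) * (x - 1) ≤ ∑' n, (x - 1) * A x n := by
    intro x hx
    have hx0 : 0 < x - 1 := by linarith [hx.1]
    have h1 := hC hx
    have h2 : ∑' n, res n / (n : ℝ) ^ x = ∑' n, A x n + ∑' n, B x n := by
      have hs : Summable (A x) := (summable_mul_left_iff hx0.ne').1 (hAsum x hx.1)
      rw [← hs.tsum_add (hBsum x hx.1)]
      refine tsum_congr fun n => ?_
      simp only [hA, hB]
      split_ifs <;> simp
    have h3 : ∑' n, B x n ≤ K := (hBsum x hx.1).tsum_le_tsum (hBle x hx.1) hnp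
    rw [h2] at h1
    have h4 : (b.totient : ℝ)⁻¹ / (x - 1) - C - K ≤ ∑' n, A x n := by linarith
    rw [tsum_mul_left]
    calc _ = (x - 1) * ((b.totient : ℝ)⁻¹ / (x - 1) - C - K) := by
          field_simp
          ring
      _ ≤ _ := mul_le_mul_of_nonneg_left h4 hx0.le
  have hlim0 : Tendsto (fun x : ℝ => x - 1) (𝓝[>] 1) (𝓝 0) := by
    have : Tendsto (fun x : ℝ => x - 1) (𝓝 1) (𝓝 (1 - 1)) := tendsto_id.sub_const 1
    rw [sub_self] at this
    exact this.mono_left nhdsWithin_le_nhds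
  have hdct : Tendsto (fun x : ℝ => ∑' n, (x - 1) * A x n) (𝓝[>] 1) (𝓝 (∑' _ : ℕ, (0 : ℝ))) := by
    refine tendsto_tsum_of_dominated_convergence hsum (fun n => ?_) ?_
    · simp_rw [hAeq]
      have h1 : Tendsto (fun x : ℝ => (x - 1) * Real.log n) (𝓝[>] 1) (𝓝 0) := by
        simpa using hlim0.mul_const (Real.log n)
      have h2 := (Real.continuous_exp.tendsto _).comp h1.neg
      simpa using (h1.mul h2).const_mul (g n)
    · filter_upwards [self_mem_nhdsWithin] with x hx n
      have hx' : (1 : ℝ) < x := hx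
      rw [Real.norm_of_nonneg (mul_nonneg (by linarith) (hAnn x n))]
      exact hAle x n
  rw [tsum_zero] at hdct
  have hleft : Tendsto (fun x : ℝ => (b.totient : ℝ)⁻¹ - (C + K) * (x - 1)) (𝓝[>] 1)
      (𝓝 (b.totient : ℝ)⁻¹) := by
    simpa using (hlim0.const_mul (C + K)).const_sub (b.totient : ℝ)⁻¹
  have hle := le_of_tendsto_of_tendsto hleft hdct (by
    filter_upwards [Ioc_mem_nhdsGT (show (1 : ℝ) < 2 by norm_num)] with x hx
    exact hlow x hx)
  have : 0 < (b.totient : ℝ)⁻¹ :=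
    inv_pos.2 (by exact_mod_cast Nat.totient_pos.2 (NeZero.pos b))
  linarith

lemma card_filter_div_le_add {P Q S : ℕ → Prop} {_ : DecidablePred P} {_ : DecidablePred Q}
    {_ : DecidablePred S} (h : ∀ n, P n → Q n ∨ S n) (N : ℕ) :
    (#{n ∈ Icc 1 N | P n} : ℝ) / N ≤
      (#{n ∈ Icc 1 N | Q n} : ℝ) / N + (#{n ∈ Icc 1 N | S n} : ℝ) / N := by
  have : #{n ∈ Icc 1 N | P n} ≤ #{n ∈ Icc 1 N | Q n} + #{n ∈ Icc 1 N | S n} := by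
    refine (card_le_card fun n hn => ?_).trans (card_union_le _ _)
    rw [mem_union, mem_filter, mem_filter]
    rw [mem_filter] at hn
    exact (h n hn.2).imp (⟨hn.1, ·⟩) (⟨hn.1, ·⟩)
  rw [← add_div]
  gcongr
  exact_mod_cast this

/-- The property `B N n` fails for all but `o(N)` of the integers `1 ≤ n ≤ N`. -/
def Negligible (B : ℕ → ℕ → Prop) : Prop :=
  Tendsto (fun N : ℕ => (#{n ∈ Icc 1 N | B N n} : ℝ) / N) atTop (𝓝 0)

lemma Negligible.mono {B B' : ℕ → ℕ → Prop} (h : Negligible B')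
    (hB : ∀ᶠ N in atTop, ∀ n ∈ Icc 1 N, B N n → B' N n) : Negligible B := by
  refine squeeze_zero' (.of_forall fun N => by positivity) ?_ h
  filter_upwards [hB] with N hN
  have : #{n ∈ Icc 1 N | B N n} ≤ #{n ∈ Icc 1 N | B' N n} := card_le_card fun n hn => by
    rw [mem_filter] at hn ⊢
    exact ⟨hn.1, hN n hn.1 hn.2⟩
  gcongr

lemma Negligible.or {B B' : ℕ → ℕ → Prop} (h : Negligible B) (h' : Negligible B') :
    Negligible fun N n => B N n ∨ B' N n := by
  have := h.add h'
  rw [add_zero] at this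
  exact squeeze_zero (fun N => by positivity)
    (fun N => card_filter_div_le_add (fun n hn => hn) N) this

lemma Negligible.exists_mem {ι : Type*} (s : Finset ι) {B : ι → ℕ → ℕ → Prop}
    (h : ∀ i ∈ s, Negligible (B i)) : Negligible fun N n => ∃ i ∈ s, B i N n := by
  induction s using Finset.induction_on with
  | empty => simp [Negligible]
  | insert i s _ ih =>
    refine ((h i (mem_insert_self i s)).or
      (ih fun j hj => h j (mem_insert_of_mem hj))).mono (.of_forall fun N n _ hB => ?_)
    obtain ⟨j, hj, hB⟩ := hB
    rcases mem_insert.1 hj with rfl | hj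
    · exact Or.inl hB
    · exact Or.inr ⟨j, hj, hB⟩

/-- Markov's inequality. -/
lemma negligible_of_mean {f : ℕ → ℕ → ℝ} {θ c : ℕ → ℝ} (hf : ∀ N n, 0 ≤ f N n)
    (hθ : ∀ᶠ N in atTop, 0 < θ N)
    (hc : ∀ᶠ N in atTop, ∑ n ∈ Icc 1 N, f N n ≤ c N * N)
    (hlim : Tendsto (fun N => c N / θ N) atTop (𝓝 0)) :
    Negligible fun N n => θ N < f N n := by
  refine squeeze_zero' (.of_forall fun N => by positivity) ?_ hlim
  filter_upwards [hθ, hc, eventually_ge_atTop 1] with N h1 h2 h3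
  have hN : (0 : ℝ) < N := by exact_mod_cast h3
  rw [div_le_div_iff₀ hN h1]
  refine le_trans ?_ h2
  calc (#{n ∈ Icc 1 N | θ N < f N n} : ℝ) * θ N
      = ∑ n ∈ Icc 1 N with θ N < f N n, θ N := by rw [sum_const, nsmul_eq_mul]
    _ ≤ ∑ n ∈ Icc 1 N with θ N < f N n, f N n :=
        sum_le_sum fun n hn => (mem_filter.1 hn).2.le
    _ ≤ _ := sum_le_sum_of_subset_of_nonneg (filter_subset _ _) fun n _ _ => hf N n

lemma negligible_mul_self_lt : Negligible fun N n => n * n < N := by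
  have h : Tendsto (fun N : ℕ => (√(N : ℝ))⁻¹) atTop (𝓝 0) :=
    tendsto_inv_atTop_zero.comp (Real.tendsto_sqrt_atTop.comp tendsto_natCast_atTop_atTop)
  have hlim : Tendsto (fun N : ℕ => (#{n ∈ Icc 1 N | n * n < N} : ℝ) / N) atTop (𝓝 0) := by
    refine squeeze_zero (fun N => by positivity) (fun N => ?_) h
    rw [← Real.sqrt_div_self]
    gcongr
    refine le_trans (Nat.cast_le.2 ?_) (Real.nat_sqrt_le_real_sqrt (a := N))
    refine (card_le_card (t := Icc 1 N.sqrt) fun n hn => ?_).trans (by simp)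
    rw [mem_filter, mem_Icc] at hn
    exact mem_Icc.2 ⟨hn.1.1, Nat.le_sqrt.2 hn.2.le⟩
  unfold Negligible
  convert hlim

/-- If the reciprocals of the primes in `S` have divergent sum, almost all integers have a prime
factor in `S`. -/
lemma negligible_forall_not_dvd {S : ℕ → Prop} (hS : ∀ p, S p → p.Prime)
    (hsum : ¬ Summable fun p : ℕ => if S p then 1 / (p : ℝ) else 0) :
    Negligible fun _ n => ∀ p, S p → ¬ p ∣ n := by
  rw [not_summable_iff_tendsto_nat_atTop_of_nonneg (fun p => by positivity)] at hsum
  refine Metric.tendsto_atTop'.2 fun ε hε => ?_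
  have hexp := Real.tendsto_exp_neg_atTop_nhds_zero.comp hsum
  obtain ⟨M, hM⟩ := (hexp.eventually_lt_const (half_pos hε)).exists
  set P : Finset ℕ := {p ∈ range M | S p} with hP
  have hPp : ∀ p ∈ P, p.Prime := fun p hp => hS p (mem_filter.1 hp).2
  have herr : Tendsto (fun N : ℕ => (N : ℝ) ^ (-1 : ℝ) * Real.exp (‖(-1 : ℂ)‖ *
      ∑ p ∈ P, (p : ℝ) ^ ((1 : ℝ) - 1))) atTop (𝓝 0) := by
    have := ((tendsto_rpow_neg_atTop one_pos).comp
      (tendsto_natCast_atTop_atTop (R := ℝ))).mul_const (Real.exp (‖(-1 : ℂ)‖ *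
      ∑ p ∈ P, (p : ℝ) ^ ((1 : ℝ) - 1)))
    rw [zero_mul] at this
    exact this
  obtain ⟨N₀, hN₀⟩ := eventually_atTop.1 (herr.eventually_lt_const (half_pos hε))
  refine ⟨max N₀ 1, fun N hN => ?_⟩
  have hN1 : 1 ≤ N := (le_max_right _ _).trans hN.le
  have hN0 : N₀ ≤ N := (le_max_left _ _).trans hN.le
  have hmain := norm_mean_sub_prod_le hPp (-1) zero_le_one le_rfl hN1
  have hcount : (∑ n ∈ Icc 1 N, ∏ p ∈ P, (1 + if p ∣ n then (-1 : ℂ) else 0))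
      = ((#{n ∈ Icc 1 N | ∀ p ∈ P, ¬ p ∣ n} : ℝ) : ℂ) := by
    rw [card_filter]
    push_cast
    refine sum_congr rfl fun n _ => ?_
    split_ifs with h
    · exact prod_eq_one fun p hp => by rw [if_neg (h p hp), add_zero]
    · push Not at h
      obtain ⟨p, hp, hpn⟩ := h
      exact prod_eq_zero hp (by rw [if_pos hpn]; ring)
  have hprod : ∏ p ∈ P, (1 + (-1 : ℂ) / p) = ((∏ p ∈ P, (1 - 1 / (p : ℝ)) : ℝ) : ℂ) := by
    push_cast
    refine prod_congr rfl fun p _ => ?_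
    ring
  rw [hcount, hprod, ← Complex.ofReal_natCast, ← Complex.ofReal_div, ← Complex.ofReal_sub,
    Complex.norm_real, Real.norm_eq_abs] at hmain
  have hprod2 : ∏ p ∈ P, (1 - 1 / (p : ℝ)) ≤ Real.exp (-∑ p ∈ range M,
      if S p then 1 / (p : ℝ) else 0) := by
    rw [← sum_filter, ← sum_neg_distrib, Real.exp_sum]
    refine prod_le_prod (fun p hp => ?_) fun p hp => ?_
    · have : (1 : ℝ) ≤ p := by exact_mod_cast (hPp p hp).one_le
      rw [sub_nonneg, div_le_one (by linarith)]
      exact this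
    · linarith [Real.add_one_le_exp (-(1 / (p : ℝ)))]
  have hle : (#{n ∈ Icc 1 N | ∀ p, S p → ¬ p ∣ n} : ℝ) / N
      ≤ (#{n ∈ Icc 1 N | ∀ p ∈ P, ¬ p ∣ n} : ℝ) / N := by
    have : #{n ∈ Icc 1 N | ∀ p, S p → ¬ p ∣ n} ≤ #{n ∈ Icc 1 N | ∀ p ∈ P, ¬ p ∣ n} :=
      card_le_card fun n hn => by
        rw [mem_filter] at hn ⊢
        exact ⟨hn.1, fun p hp => hn.2 p (mem_filter.1 hp).2⟩
    gcongr
  rw [Real.dist_eq, sub_zero, abs_of_nonneg (by positivity)]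
  have h3 := hN₀ N hN0
  simp only [Function.comp_apply] at hM
  linarith [(abs_le.1 hmain).2]

lemma negligible_not_hasAllClasses {a : ℕ} (ha : 0 < a) :
    Negligible fun _ n => ¬ HasAllClasses a n := by
  have key : ∀ b ∈ a.divisors, Negligible fun _ n => ∃ r ∈ (Set.univ : Set (ZMod b)ˣ),
      ∀ p : ℕ, (p.Prime ∧ ¬ p ∣ a ∧ (p : ZMod b) = r) → ¬ p ∣ n := by
    intro b hb
    have : NeZero b := ⟨(Nat.pos_of_mem_divisors hb).ne'⟩
    refine (Negligible.exists_mem univ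
      (B := fun (r : (ZMod b)ˣ) _ n => ∀ p : ℕ, (p.Prime ∧ ¬ p ∣ a ∧ (p : ZMod b) = r) → ¬ p ∣ n)
      fun r _ => ?_).mono (.of_forall fun N n _ hn => by simpa using hn)
    refine negligible_forall_not_dvd (fun p hp => hp.1) fun hs => ?_
    refine not_summable_primes_residueClass (r := (r : ZMod b)) r.isUnit ?_
    refine (summable_congr_cofinite ?_).1 hs
    have hfin : {p : ℕ | p ∣ a}.Finite :=
      (finite_toSet a.divisors).subset fun p hp => by
        simpa using ⟨hp, ha.ne'⟩
    filter_upwards [hfin.compl_mem_cofinite] with p hp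
    have hp' : ¬ p ∣ a := hp
    simp [hp']
  refine (Negligible.exists_mem _ key).mono (.of_forall fun N n _ hn => ?_)
  unfold HasAllClasses at hn
  push Not at hn
  obtain ⟨b, hb, r, hr⟩ := hn
  exact ⟨b, hb, r, Set.mem_univ _, fun p hp hpn => hr p hp.1 hp.2.1 hpn hp.2.2⟩

end ErdosKac

namespace ErdosKac

open Filter Finset Topology

lemma Negligible.tendsto_of_sandwich {W : ℕ → ℕ → ℝ} {F : ℝ → ℝ} {T : ℕ → ℕ → Prop} {z : ℝ}
    (hW : ∀ z, Tendsto (fun N : ℕ => (#{n ∈ Icc 1 N | W N n ≤ z} : ℝ) / N) atTop (𝓝 (F z)))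
    (hF : Continuous F)
    (h : ∀ δ > 0, Negligible fun N n =>
      (T N n ∧ z + δ < W N n) ∨ (W N n ≤ z - δ ∧ ¬ T N n)) :
    Tendsto (fun N : ℕ => (#{n ∈ Icc 1 N | T N n} : ℝ) / N) atTop (𝓝 (F z)) := by
  have hplus : Tendsto (fun δ : ℝ => F (z + δ)) (𝓝[>] 0) (𝓝 (F z)) := by
    have : Tendsto (fun δ : ℝ => F (z + δ)) (𝓝 0) (𝓝 (F (z + 0))) :=
      (hF.comp (continuous_const.add continuous_id)).tendsto 0
    rw [add_zero] at this
    exact this.mono_left nhdsWithin_le_nhds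
  have hminus : Tendsto (fun δ : ℝ => F (z - δ)) (𝓝[>] 0) (𝓝 (F z)) := by
    have : Tendsto (fun δ : ℝ => F (z - δ)) (𝓝 0) (𝓝 (F (z - 0))) :=
      (hF.comp (continuous_const.sub continuous_id)).tendsto 0
    rw [sub_zero] at this
    exact this.mono_left nhdsWithin_le_nhds
  refine tendsto_order.2 ⟨fun u hu => ?_, fun u hu => ?_⟩
  · obtain ⟨δ, hδu, hδ⟩ := ((hminus.eventually_const_lt hu).and self_mem_nhdsWithin).exists
    have hlim := (hW (z - δ)).sub (h δ hδ)
    rw [sub_zero] at hlim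
    filter_upwards [hlim.eventually_const_lt hδu] with N hN
    refine hN.trans_le ?_
    rw [sub_le_iff_le_add]
    refine card_filter_div_le_add (fun n hn => ?_) N
    by_cases hT : T N n
    · exact Or.inl hT
    · exact Or.inr (Or.inr ⟨hn, hT⟩)
  · obtain ⟨δ, hδu, hδ⟩ := ((hplus.eventually_lt_const hu).and self_mem_nhdsWithin).exists
    have hlim := (hW (z + δ)).add (h δ hδ)
    rw [add_zero] at hlim
    filter_upwards [hlim.eventually_lt_const hδu] with N hN
    refine lt_of_le_of_lt ?_ hN
    refine card_filter_div_le_add (fun n hn => ?_) N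
    exact (le_or_gt (W N n) (z + δ)).imp id fun hgt => Or.inl ⟨hn, hgt⟩

lemma sum_ite_dvd_le (N d : ℕ) :
    ∑ n ∈ Icc 1 N, (if d ∣ n then (1 : ℝ) else 0) ≤ 1 / d * N := by
  rw [sum_boole, card_Icc_filter_dvd, one_div_mul_eq_div]
  exact Nat.cast_div_le

/-- The number of prime factors with multiplicity minus the number of distinct ones. -/
noncomputable def excess (n : ℕ) : ℝ := ∑ p ∈ n.primeFactors, ((n.factorization p : ℝ) - 1)

lemma excess_nonneg (n : ℕ) : 0 ≤ excess n := sum_nonneg fun p hp => by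
  have : 1 ≤ n.factorization p := Nat.pos_of_ne_zero (by
    rwa [← Finsupp.mem_support_iff, Nat.support_factorization])
  rw [sub_nonneg]
  exact_mod_cast this

lemma excess_le {N n : ℕ} (hn : n ∈ Icc 1 N) : excess n ≤
    ∑ p ∈ Nat.primesLE N, ∑ i ∈ Ico 2 (N + 1), if p ^ i ∣ n then (1 : ℝ) else 0 := by
  rw [mem_Icc] at hn
  have hsub : n.primeFactors ⊆ Nat.primesLE N := fun p hp =>
    Nat.mem_primesLE.2 ⟨(Nat.le_of_mem_primeFactors hp).trans hn.2, Nat.prime_of_mem_primeFactors hp⟩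
  refine le_trans ?_ (sum_le_sum_of_subset_of_nonneg hsub fun p _ _ =>
    sum_nonneg fun i _ => by positivity)
  refine sum_le_sum fun p hp => ?_
  rw [sum_boole, sub_le_iff_le_add, Nat.factorization_eq_card_pow_dvd n
    (Nat.prime_of_mem_primeFactors hp)]
  have : ({i ∈ Ico 1 n | p ^ i ∣ n} : Finset ℕ) ⊆
      insert 1 ({i ∈ Ico 2 (N + 1) | p ^ i ∣ n} : Finset ℕ) := fun i hi => by
    simp only [mem_filter, mem_insert, mem_Ico] at hi ⊢
    have := hi.1
    by_cases h1 : i = 1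
    · exact Or.inl h1
    · exact Or.inr ⟨by omega, hi.2⟩
  exact_mod_cast (card_le_card this).trans (card_insert_le _ _)

lemma exists_sum_excess_le : ∃ C : ℝ, ∀ N : ℕ, ∑ n ∈ Icc 1 N, excess n ≤ C * N := by
  have hK : Summable fun n : ℕ => (1 / (n : ℝ) ^ 2) :=
    Real.summable_one_div_nat_pow.2 (by norm_num)
  refine ⟨2 * ∑' n : ℕ, (1 / (n : ℝ) ^ 2), fun N => ?_⟩
  calc ∑ n ∈ Icc 1 N, excess n
      ≤ ∑ n ∈ Icc 1 N, ∑ p ∈ Nat.primesLE N, ∑ i ∈ Ico 2 (N + 1),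
          (if p ^ i ∣ n then (1 : ℝ) else 0) := sum_le_sum fun n hn => excess_le hn
    _ = ∑ p ∈ Nat.primesLE N, ∑ i ∈ Ico 2 (N + 1), ∑ n ∈ Icc 1 N,
          (if p ^ i ∣ n then (1 : ℝ) else 0) := by
        rw [sum_comm]
        exact sum_congr rfl fun p _ => sum_comm
    _ ≤ ∑ p ∈ Nat.primesLE N, 2 * (1 / (p : ℝ) ^ 2) * N := by
        refine sum_le_sum fun p hp => ?_
        have h2 : (2 : ℝ) ≤ p := by exact_mod_cast (Nat.prime_of_mem_primesLE hp).two_le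
        have hp2 : 1 / (p : ℝ) ≤ 1 / 2 := one_div_le_one_div_of_le (by norm_num) h2
        calc _ ≤ ∑ i ∈ Ico 2 (N + 1), (1 / (p : ℝ)) ^ i * N := by
              refine sum_le_sum fun i _ => (sum_ite_dvd_le N (p ^ i)).trans (le_of_eq ?_)
              rw [one_div_pow, Nat.cast_pow]
          _ = (∑ i ∈ Ico 2 (N + 1), (1 / (p : ℝ)) ^ i) * N := by rw [sum_mul]
          _ ≤ (1 / (p : ℝ)) ^ 2 / (1 - 1 / p) * N := by
              gcongr
              exact geom_sum_Ico_le_of_lt_one (by positivity) (by linarith)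
          _ ≤ 2 * (1 / (p : ℝ) ^ 2) * N := by
              gcongr
              rw [div_le_iff₀ (by linarith), one_div_pow]
              have : 0 ≤ 1 / (p : ℝ) ^ 2 := by positivity
              nlinarith
    _ = 2 * (∑ p ∈ Nat.primesLE N, 1 / (p : ℝ) ^ 2) * N := by rw [← sum_mul, ← mul_sum]
    _ ≤ _ := by
        gcongr
        exact hK.sum_le_tsum _ fun i _ => by positivity

lemma eventually_pos_mul_sqrt {δ : ℝ} (hδ : 0 < δ) : ∀ᶠ N in atTop, 0 < δ * √(logLog N) := by
  filter_upwards [tendsto_sqrt_logLog.eventually_gt_atTop 0] with N hN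
  positivity

lemma negligible_lt_excess {δ : ℝ} (hδ : 0 < δ) :
    Negligible fun N n => δ * √(logLog N) < excess n := by
  obtain ⟨C, hC⟩ := exists_sum_excess_le
  exact negligible_of_mean (f := fun _ n => excess n) (fun _ n => excess_nonneg n)
    (eventually_pos_mul_sqrt hδ) (.of_forall hC)
    (tendsto_const_nhds.div_atTop (tendsto_sqrt_logLog.const_mul_atTop hδ))

/-- The number of prime divisors of `n` between the truncation level of `N` and `N`. -/
noncomputable def tailOmega (N n : ℕ) : ℝ :=
  ∑ p ∈ Nat.primesLE N \ Nat.primesLE (level N), if p ∣ n then 1 else 0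

lemma card_primeFactors_le {N n : ℕ} (hn : n ∈ Icc 1 N) :
    (#n.primeFactors : ℝ) ≤ truncOmega N n + tailOmega N n := by
  rw [mem_Icc] at hn
  rw [tailOmega, sum_boole, truncOmega]
  have : n.primeFactors ⊆ ({p ∈ Nat.primesLE (level N) | p ∣ n} : Finset ℕ) ∪
      ({p ∈ Nat.primesLE N \ Nat.primesLE (level N) | p ∣ n} : Finset ℕ) := fun p hp => by
    have h1 : p ∈ Nat.primesLE N := Nat.mem_primesLE.2
      ⟨(Nat.le_of_mem_primeFactors hp).trans hn.2, Nat.prime_of_mem_primeFactors hp⟩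
    have h2 := Nat.dvd_of_mem_primeFactors hp
    by_cases h3 : p ∈ Nat.primesLE (level N)
    · exact mem_union_left _ (mem_filter.2 ⟨h3, h2⟩)
    · exact mem_union_right _ (mem_filter.2 ⟨mem_sdiff.2 ⟨h1, h3⟩, h2⟩)
  exact_mod_cast (card_le_card this).trans (card_union_le _ _)

lemma truncOmega_le_card_primeFactors {N n : ℕ} (hn : 0 < n) :
    truncOmega N n ≤ #n.primeFactors := card_le_card fun p hp => by
  rw [mem_filter] at hp
  exact Nat.mem_primeFactors.2 ⟨Nat.prime_of_mem_primesLE hp.1, hp.2, hn.ne'⟩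

lemma level_le {N : ℕ} (hN : 1 ≤ N) (hL : 1 ≤ logLog N) : level N ≤ N := by
  have hlog : 0 ≤ Real.log N := Real.log_nonneg (by exact_mod_cast hN)
  refine Nat.floor_le_of_le ?_
  calc _ ≤ Real.exp (Real.log N) := Real.exp_le_exp.2 (div_le_self hlog hL)
    _ = N := Real.exp_log (by exact_mod_cast hN)

lemma negligible_lt_tailOmega {δ : ℝ} (hδ : 0 < δ) :
    Negligible fun N n => δ * √(logLog N) < tailOmega N n := by
  refine negligible_of_mean (c := fun N => primeRecipSum N - primeRecipSum (level N))
    (fun N n => sum_nonneg fun p _ => by positivity) (eventually_pos_mul_sqrt hδ) ?_ ?_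
  · filter_upwards [tendsto_logLog.eventually_ge_atTop 1, eventually_ge_atTop 1] with N hL hN
    have hsub : Nat.primesLE (level N) ⊆ Nat.primesLE N := fun p hp => by
      rw [Nat.mem_primesLE] at hp ⊢
      exact ⟨hp.1.trans (level_le hN hL), hp.2⟩
    unfold tailOmega
    rw [sum_comm, primeRecipSum, primeRecipSum, ← sum_sdiff hsub, add_sub_cancel_right, sum_mul]
    exact sum_le_sum fun p _ => sum_ite_dvd_le N p
  · have := tendsto_primeRecipSum_sub_level.mul_const δ⁻¹
    rw [zero_mul] at this
    refine this.congr fun N => ?_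
    rw [← div_eq_mul_inv, div_div, mul_comm (√_)]

lemma logLog_bounds {N n : ℕ} (hn : n ∈ Icc 1 N) (h : N ≤ n * n) (hL : 2 ≤ logLog N) :
    logLog N - 1 ≤ logLog n ∧ logLog n ≤ logLog N := by
  rw [mem_Icc] at hn
  have hn0 : (0 : ℝ) < n := by exact_mod_cast hn.1
  have hN0 : (0 : ℝ) < N := by exact_mod_cast hn.1.trans hn.2
  have hlogN : 0 < Real.log N := by
    rcases (Real.log_nonneg (by exact_mod_cast hn.1.trans hn.2) : 0 ≤ Real.log N).lt_or_eq
      with h0 | h0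
    · exact h0
    · rw [logLog, ← h0, Real.log_zero] at hL
      linarith
  have h1 : Real.log N ≤ 2 * Real.log n := by
    have : Real.log N ≤ Real.log (n * n) := Real.log_le_log hN0 (by exact_mod_cast h)
    rw [Real.log_mul hn0.ne' hn0.ne'] at this
    linarith
  have hlogn : 0 < Real.log n := by linarith
  constructor
  · have h2 : Real.log (Real.log N) ≤ Real.log (2 * Real.log n) := Real.log_le_log hlogN h1
    rw [Real.log_mul two_ne_zero hlogn.ne'] at h2
    have := Real.log_two_lt_d9
    unfold logLog
    linarith
  · exact Real.log_le_log hlogn (Real.log_le_log hn0 (by exact_mod_cast hn.2))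

lemma abs_normalization_sub_le {l L : ℝ} (z : ℝ) (hl : 1 ≤ l) (h1 : L - 1 ≤ l) (h2 : l ≤ L) :
    |l + z * √l - (L + z * √L)| ≤ 1 + |z| := by
  have h3 : √l ≤ √L := Real.sqrt_le_sqrt h2
  have h4 : √L ≤ √l + 1 := by
    rw [Real.sqrt_le_left (by positivity)]
    nlinarith [Real.sq_sqrt (zero_le_one.trans hl), Real.sqrt_nonneg l]
  calc |l + z * √l - (L + z * √L)| = |(l - L) + z * (√l - √L)| := by ring_nf
    _ ≤ |l - L| + |z| * |√l - √L| := by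
        rw [← abs_mul]
        exact abs_add_le _ _
    _ ≤ 1 + |z| * 1 := by
        have h5 : |l - L| ≤ 1 := abs_le.2 ⟨by linarith, by linarith⟩
        have h6 : |√l - √L| ≤ 1 := abs_le.2 ⟨by linarith, by linarith⟩
        gcongr
    _ = _ := by rw [mul_one]

/-- The normalized value of `log R(n; a)`. -/
noncomputable def normalizedLogR (a n : ℕ) : ℝ :=
  (Real.log (R n a) - Real.log 3 * Real.log (Real.log n)) /
    (Real.log 3 * Real.sqrt (Real.log (Real.log n)))

lemma log_R_bounds {a N n : ℕ} (ha : 0 < a) (hn : n ∈ Icc 1 N) (h : HasAllClasses a n) :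
    Real.log 3 * (truncOmega N n - 2 * a) ≤ Real.log (R n a) ∧
      Real.log (R n a) ≤ Real.log 3 * (truncOmega N n + tailOmega N n + excess n) := by
  have hn0 : 0 < n := (mem_Icc.1 hn).1
  have h3 : 0 < Real.log 3 := Real.log_pos (by norm_num)
  have hlow := three_pow_le_mul_R ha hn0 h
  have hR : 0 < R n a := by
    rcases Nat.eq_zero_or_pos (R n a) with h0 | h0
    · rw [h0, mul_zero] at hlow
      exact absurd hlow (pow_pos three_pos _).not_ge
    · exact h0
  have hR' : (0 : ℝ) < R n a := by exact_mod_cast hR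
  constructor
  · have h1 : ((3 : ℝ) ^ #n.primeFactors) ≤ 3 ^ (2 * a) * R n a := by
      rw [pow_mul]
      norm_num
      exact_mod_cast hlow
    have h2 := Real.log_le_log (by positivity) h1
    rw [Real.log_mul (by positivity) hR'.ne', Real.log_pow, Real.log_pow] at h2
    push_cast at h2
    have h4 : (truncOmega N n : ℝ) ≤ #n.primeFactors := by
      exact_mod_cast truncOmega_le_card_primeFactors hn0
    nlinarith
  · have h1 : (R n a : ℝ) ≤ 3 ^ ∑ p ∈ n.primeFactors, n.factorization p := by
      exact_mod_cast R_le_three_pow hn0 a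
    have h2 := Real.log_le_log hR' h1
    rw [Real.log_pow, mul_comm] at h2
    refine h2.trans (mul_le_mul_of_nonneg_left ?_ h3.le)
    have h4 := card_primeFactors_le hn
    have h5 : excess n = ((∑ p ∈ n.primeFactors, n.factorization p : ℕ) : ℝ) -
        #n.primeFactors := by
      rw [excess, sum_sub_distrib, sum_const, nsmul_one]
      push_cast
      rfl
    linarith

lemma negligible_normalizedLogR {a : ℕ} (ha : 0 < a) (z : ℝ) {δ : ℝ} (hδ : 0 < δ) :
    Negligible fun N n =>
      (normalizedLogR a n ≤ z ∧ z + δ < (truncOmega N n - logLog N) / √(logLog N)) ∨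
      ((truncOmega N n - logLog N) / √(logLog N) ≤ z - δ ∧ ¬ normalizedLogR a n ≤ z) := by
  have hδ' : 0 < δ / 3 := by positivity
  refine ((negligible_mul_self_lt.or (negligible_not_hasAllClasses ha)).or
    ((negligible_lt_excess hδ').or (negligible_lt_tailOmega hδ'))).mono ?_
  filter_upwards [tendsto_logLog.eventually_ge_atTop 2,
    (tendsto_sqrt_logLog.const_mul_atTop hδ').eventually_ge_atTop (1 + |z| + 2 * a)]
    with N hL hbig n hn hB
  by_contra! hgood
  obtain ⟨⟨hnn, hcls⟩, hexc, htail⟩ := hgood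
  have hs : 0 < √(logLog N) := Real.sqrt_pos.2 (by linarith)
  have h3 : 0 < Real.log 3 := Real.log_pos (by norm_num)
  obtain ⟨hl1, hl2⟩ := logLog_bounds hn hnn hL
  have hl0 : 1 ≤ logLog n := by linarith
  have hsl : 0 < √(logLog n) := Real.sqrt_pos.2 (by linarith)
  have hnorm := abs_le.1 (abs_normalization_sub_le z hl0 hl1 hl2)
  obtain ⟨hlow, hup⟩ := log_R_bounds ha hn hcls
  have hiff : normalizedLogR a n ≤ z ↔
      Real.log (R n a) ≤ Real.log 3 * (logLog n + z * √(logLog n)) := by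
    unfold normalizedLogR
    change (_ - Real.log 3 * logLog n) / (Real.log 3 * √(logLog n)) ≤ z ↔ _
    rw [div_le_iff₀ (by positivity), sub_le_iff_le_add]
    ring_nf
  rcases hB with ⟨hT, hW⟩ | ⟨hW, hT⟩
  · rw [lt_div_iff₀ hs] at hW
    have := le_of_mul_le_mul_left (hlow.trans (hiff.1 hT)) h3
    nlinarith
  · rw [div_le_iff₀ hs] at hW
    refine hT (hiff.2 (hup.trans (mul_le_mul_of_nonneg_left ?_ h3.le)))
    have : (0 : ℝ) ≤ a := Nat.cast_nonneg a
    nlinarith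

end ErdosKac

/-- Erdős–Kac type theorem for `R(n; a)`. -/
theorem stmt2 (a : ℕ) (ha : 0 < a) (z : ℝ) :
    Filter.Tendsto (fun N : ℕ =>
      (((Finset.Icc 1 N).filter (fun n =>
          (Real.log (R n a) - Real.log 3 * Real.log (Real.log n)) /
            (Real.log 3 * Real.sqrt (Real.log (Real.log n))) ≤ z)).card : ℝ) / N)
      Filter.atTop (nhds (Phi z)) := by
  have := ErdosKac.Negligible.tendsto_of_sandwich ErdosKac.tendsto_card_truncOmega_le
    ErdosKac.continuous_Phi (fun δ hδ => ErdosKac.negligible_normalizedLogR ha z hδ)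
  convert this
  rfl
end
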